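/- arXiv:2602.15175 — 2 statements merged into one kernel-verified Lean document; each statement's English description precedes it below -/
import Mathlib

section
/- The b-th power of the ideal I_{a,b} equals the (ab)-th power of the maximal homogeneous ideal: I_{a,b}^b = 𝔪^{ab}, where 𝔪 = (u_0,…,u_b) ⊆ R. (Consequence of the degree-b isomorphism (1.8); the case j = b of Conjecture 1.4.) -/
open MvPolynomial

/-- The generic binary form `G = ∑_{i=0}^{b} u_i x^i y^{b-i}` of degree `b`,
viewed as a polynomial in two variables `x = X 0`, `y = X 1` with coefficients in
`R = MvPolynomial (Fin (b+1)) ℂ`. -/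
noncomputable def genForm (b : ℕ) : MvPolynomial (Fin 2) (MvPolynomial (Fin (b + 1)) ℂ) :=
  ∑ i : Fin (b + 1),
    MvPolynomial.C (MvPolynomial.X i) *
      MvPolynomial.X (0 : Fin 2) ^ (i : ℕ) * MvPolynomial.X (1 : Fin 2) ^ (b - (i : ℕ))

/-- The coefficient `c_j ∈ R` of `x^j y^{ab-j}` in `G^a`. -/
noncomputable def coeffC (a b j : ℕ) : MvPolynomial (Fin (b + 1)) ℂ :=
  MvPolynomial.coeff
    (Finsupp.single (0 : Fin 2) j + Finsupp.single (1 : Fin 2) (a * b - j))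
    (genForm b ^ a)

/-- The ideal `I_{a,b} ⊆ R` generated by the coefficients `c_0, …, c_d` of `G^a`,
where `d = ab`. -/
noncomputable def Iab (a b : ℕ) : Ideal (MvPolynomial (Fin (b + 1)) ℂ) :=
  Ideal.span (Set.range fun j : Fin (a * b + 1) => coeffC a b (j : ℕ))

namespace Dunkl

set_option linter.unusedSectionVars false

section Operators

variable {ι : Type*} [DecidableEq ι]

/-- The algebra automorphism exchanging the variables `i` and `j`. -/
noncomputable def swapVar (i j : ι) : MvPolynomial ι ℂ →ₐ[ℂ] MvPolynomial ι ℂ :=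
  rename (Equiv.swap i j)

@[simp] lemma swapVar_X (i j k : ι) : swapVar i j (X k) = X (Equiv.swap i j k) := by
  simp [swapVar]

lemma swapVar_comm (i j : ι) : swapVar i j = swapVar j i := by
  simp [swapVar, Equiv.swap_comm]

lemma swapVar_swapVar (i j : ι) (f : MvPolynomial ι ℂ) : swapVar i j (swapVar i j f) = f := by
  simp [swapVar, rename_rename, ← Equiv.coe_trans]

lemma rename_swapVar (π : Equiv.Perm ι) (i j : ι) (f : MvPolynomial ι ℂ) :
    rename π (swapVar i j f) = swapVar (π i) (π j) (rename π f) := by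
  simp only [swapVar, rename_rename]
  congr 2
  funext k
  simp [Function.comp, Equiv.swap_apply_apply]

lemma X_sub_X_ne_zero {i j : ι} (h : i ≠ j) : (X i - X j : MvPolynomial ι ℂ) ≠ 0 :=
  sub_ne_zero.2 fun e => h (X_injective e)

lemma X_sub_X_dvd (i j : ι) (f : MvPolynomial ι ℂ) : X i - X j ∣ f - swapVar i j f := by
  induction f using MvPolynomial.induction_on with
  | C a => simp [swapVar]
  | add p q hp hq =>
    rw [map_add, add_sub_add_comm]
    exact dvd_add hp hq
  | mul_X p k hp =>
    have : p * X k - swapVar i j (p * X k)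
        = (p - swapVar i j p) * X k + swapVar i j p * (X k - X (Equiv.swap i j k)) := by
      rw [map_mul, swapVar_X]; ring
    rw [this]
    refine dvd_add (hp.mul_right _) (Dvd.dvd.mul_left ?_ _)
    by_cases hki : k = i
    · subst hki; simp
    · by_cases hkj : k = j
      · subst hkj
        rw [Equiv.swap_apply_right]
        exact ⟨-1, by ring⟩
      · simp [Equiv.swap_apply_of_ne_of_ne hki hkj]

/-- The divided difference `(f - s_{ij} f) / (x_i - x_j)`, and zero when `i = j`. -/
noncomputable def divDiff (i j : ι) : MvPolynomial ι ℂ →ₗ[ℂ] MvPolynomial ι ℂ :=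
  if h : i = j then 0 else
  { toFun := fun f => (X_sub_X_dvd i j f).choose
    map_add' := fun f g => by
      apply mul_left_cancel₀ (X_sub_X_ne_zero h)
      rw [mul_add, ← (X_sub_X_dvd i j _).choose_spec, ← (X_sub_X_dvd i j _).choose_spec,
        ← (X_sub_X_dvd i j _).choose_spec, map_add]
      ring
    map_smul' := fun c f => by
      apply mul_left_cancel₀ (X_sub_X_ne_zero h)
      rw [RingHom.id_apply, mul_smul_comm, ← (X_sub_X_dvd i j _).choose_spec,
        ← (X_sub_X_dvd i j _).choose_spec, map_smul, smul_sub] }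

lemma divDiff_spec (i j : ι) (f : MvPolynomial ι ℂ) :
    (X i - X j) * divDiff i j f = f - swapVar i j f := by
  by_cases h : i = j
  · subst h; simp [swapVar]
  · rw [divDiff, dif_neg h]
    exact (X_sub_X_dvd i j f).choose_spec.symm

lemma divDiff_eq {i j : ι} (h : i ≠ j) {f g : MvPolynomial ι ℂ}
    (hg : (X i - X j) * g = f - swapVar i j f) : divDiff i j f = g :=
  mul_left_cancel₀ (X_sub_X_ne_zero h) (by rw [divDiff_spec, hg])

lemma divDiff_of_swapVar_eq (i j : ι) {f : MvPolynomial ι ℂ} (h : swapVar i j f = f) :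
    divDiff i j f = 0 := by
  by_cases hij : i = j
  · simp [divDiff, hij]
  · exact divDiff_eq hij (by simp [h])

lemma divDiff_mul (i j : ι) (f g : MvPolynomial ι ℂ) :
    divDiff i j (f * g) = divDiff i j f * g + swapVar i j f * divDiff i j g := by
  by_cases hij : i = j
  · simp [divDiff, hij]
  · refine divDiff_eq hij ?_
    have h1 := divDiff_spec i j f
    have h2 := divDiff_spec i j g
    rw [map_mul]
    linear_combination g * h1 + swapVar i j f * h2

lemma divDiff_comm (i j : ι) (f : MvPolynomial ι ℂ) : divDiff j i f = - divDiff i j f := by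
  by_cases hij : i = j
  · simp [divDiff, hij]
  · refine divDiff_eq (Ne.symm hij) ?_
    rw [swapVar_comm j i]
    linear_combination divDiff_spec i j f

lemma rename_divDiff (π : Equiv.Perm ι) (i j : ι) (f : MvPolynomial ι ℂ) :
    rename π (divDiff i j f) = divDiff (π i) (π j) (rename π f) := by
  by_cases hij : i = j
  · simp [divDiff, hij]
  · symm
    refine divDiff_eq (fun h => hij (π.injective h)) ?_
    have := congrArg (rename π) (divDiff_spec i j f)
    simpa [rename_swapVar] using this

lemma divDiff_X_left {i j : ι} (h : i ≠ j) : divDiff i j (X i : MvPolynomial ι ℂ) = 1 :=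
  divDiff_eq h (by simp)

lemma divDiff_X_right {i j : ι} (h : i ≠ j) : divDiff i j (X j : MvPolynomial ι ℂ) = -1 :=
  divDiff_eq h (by simp)

lemma divDiff_X_of_ne {i j k : ι} (hi : k ≠ i) (hj : k ≠ j) :
    divDiff i j (X k : MvPolynomial ι ℂ) = 0 :=
  divDiff_of_swapVar_eq _ _ (by rw [swapVar_X, Equiv.swap_apply_of_ne_of_ne hi hj])

/-- The Dunkl operator with parameter `-a` attached to the variable `i` among the variables `s`. -/
noncomputable def dunkl (a : ℕ) (s : Finset ι) (i : ι) :
    MvPolynomial ι ℂ →ₗ[ℂ] MvPolynomial ι ℂ :=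
  if i ∈ s then (pderiv i).toLinearMap - (a : ℂ) • ∑ j ∈ s, divDiff i j else 0

variable {a : ℕ} {s : Finset ι}

lemma dunkl_apply {i : ι} (hi : i ∈ s) (f : MvPolynomial ι ℂ) :
    dunkl a s i f = pderiv i f - (a : ℂ) • ∑ j ∈ s, divDiff i j f := by
  simp [dunkl, hi]

lemma dunkl_of_notMem {i : ι} (hi : i ∉ s) : dunkl a s i = 0 := by
  simp [dunkl, hi]

lemma rename_dunkl {π : Equiv.Perm ι} (hπ : ∀ k, π k ∈ s ↔ k ∈ s) (i : ι)
    (f : MvPolynomial ι ℂ) :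
    rename π (dunkl a s i f) = dunkl a s (π i) (rename π f) := by
  by_cases hi : i ∈ s
  · rw [dunkl_apply hi, dunkl_apply ((hπ i).2 hi), map_sub, map_smul, map_sum,
      pderiv_rename π.injective]
    congr 2
    simp only [rename_divDiff]
    exact Finset.sum_bij (fun k _ => π k) (fun k hk => (hπ k).2 hk)
      (fun _ _ _ _ h => π.injective h)
      (fun k hk => ⟨π.symm k, (hπ _).1 (by simpa using hk), by simp⟩) (fun _ _ => rfl)
  · rw [dunkl_of_notMem hi, dunkl_of_notMem (mt (hπ i).1 hi)]; simp

lemma swap_mem_iff {i j : ι} (hi : i ∈ s) (hj : j ∈ s) (k : ι) :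
    Equiv.swap i j k ∈ s ↔ k ∈ s := by
  by_cases hki : k = i
  · subst hki; simp [hi, hj]
  · by_cases hkj : k = j
    · subst hkj; simp [hi, hj]
    · rw [Equiv.swap_apply_of_ne_of_ne hki hkj]

lemma swapVar_dunkl {i j : ι} (hi : i ∈ s) (hj : j ∈ s) (k : ι) (f : MvPolynomial ι ℂ) :
    swapVar i j (dunkl a s k f) = dunkl a s (Equiv.swap i j k) (swapVar i j f) :=
  rename_dunkl (swap_mem_iff hi hj) k f

lemma dunkl_one (i : ι) : dunkl a s i 1 = 0 := by
  by_cases hi : i ∈ s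
  · rw [dunkl_apply hi, Finset.sum_eq_zero fun j _ => divDiff_of_swapVar_eq i j (map_one _)]
    simp
  · simp [dunkl_of_notMem hi]

lemma dunkl_X_mul_self {i : ι} (hi : i ∈ s) (f : MvPolynomial ι ℂ) :
    dunkl a s i (X i * f) = X i * dunkl a s i f + f
      - (a : ℂ) • ∑ j ∈ s.erase i, swapVar i j f := by
  rw [dunkl_apply hi, dunkl_apply hi, Derivation.leibniz, pderiv_X_self,
    ← Finset.add_sum_erase s _ hi, ← Finset.add_sum_erase s _ hi,
    divDiff_of_swapVar_eq i i (by simp [swapVar]), divDiff_of_swapVar_eq i i (by simp [swapVar]),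
    zero_add, zero_add]
  have : ∀ j ∈ s.erase i, divDiff i j (X i * f) = X i * divDiff i j f + swapVar i j f := by
    intro j hj
    have hne := (Finset.ne_of_mem_erase hj).symm
    have := divDiff_spec i j f
    rw [divDiff_mul, divDiff_X_left hne, swapVar_X, Equiv.swap_apply_left]
    linear_combination -this
  rw [Finset.sum_congr rfl this, Finset.sum_add_distrib, ← Finset.mul_sum]
  simp only [smul_eq_mul, smul_add, mul_sub, mul_smul_comm]
  ring

lemma dunkl_X_mul_of_mem {i k : ι} (hi : i ∈ s) (hk : k ∈ s) (h : k ≠ i)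
    (f : MvPolynomial ι ℂ) :
    dunkl a s i (X k * f) = X k * dunkl a s i f + (a : ℂ) • swapVar i k f := by
  have hk' : k ∈ s := hk
  rw [dunkl_apply hi, dunkl_apply hi, Derivation.leibniz, pderiv_X_of_ne h]
  have : ∀ j ∈ s, divDiff i j (X k * f) = X k * divDiff i j f
      - if j = k then swapVar i k f else 0 := by
    intro j hj
    by_cases hji : j = i
    · subst hji
      simp [divDiff, Ne.symm h]
    · split_ifs with hjk
      · subst hjk
        have := divDiff_spec i j f
        rw [divDiff_mul, divDiff_X_right h.symm, swapVar_X, Equiv.swap_apply_right]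
        linear_combination this
      · rw [divDiff_mul, divDiff_X_of_ne h (Ne.symm hjk), swapVar_X,
          Equiv.swap_apply_of_ne_of_ne h (Ne.symm hjk)]
        ring
  rw [Finset.sum_congr rfl this, Finset.sum_sub_distrib, ← Finset.mul_sum,
    Finset.sum_ite_eq' , if_pos hk]
  simp only [smul_eq_mul, smul_sub, mul_sub, mul_smul_comm]
  simp only [smul_eq_C_mul]
  ring

lemma dunkl_mul_of_invariant (i : ι) {p : MvPolynomial ι ℂ} (hp : pderiv i p = 0)
    (hsym : ∀ j ∈ s, swapVar i j p = p) (f : MvPolynomial ι ℂ) :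
    dunkl a s i (p * f) = p * dunkl a s i f := by
  by_cases hi : i ∈ s
  · rw [dunkl_apply hi, dunkl_apply hi, Derivation.leibniz, hp]
    have : ∀ j ∈ s, divDiff i j (p * f) = p * divDiff i j f := by
      intro j hj
      rw [divDiff_mul, divDiff_of_swapVar_eq i j (hsym j hj), hsym j hj]
      ring
    rw [Finset.sum_congr rfl this, ← Finset.mul_sum]
    simp [mul_sub]
  · simp [dunkl_of_notMem hi]

lemma dunkl_X_mul_of_notMem (i : ι) {k : ι} (hk : k ∉ s) (f : MvPolynomial ι ℂ) :
    dunkl a s i (X k * f) = X k * dunkl a s i f := by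
  by_cases hi : i ∈ s
  · have hki : k ≠ i := fun h => hk (h ▸ hi)
    refine dunkl_mul_of_invariant i (pderiv_X_of_ne hki) (fun j hj => ?_) f
    rw [swapVar_X, Equiv.swap_apply_of_ne_of_ne hki fun h => hk (h ▸ hj)]
  · simp [dunkl_of_notMem hi]

lemma dunkl_comm_aux {i j : ι} (hi : i ∈ s) (hj : j ∈ s) (hij : i ≠ j) (f : MvPolynomial ι ℂ)
    (h : dunkl a s i (dunkl a s j f) = dunkl a s j (dunkl a s i f)) :
    dunkl a s i (dunkl a s j (X i * f)) = dunkl a s j (dunkl a s i (X i * f)) := by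
  rw [dunkl_X_mul_of_mem hj hi hij, dunkl_X_mul_self hi, map_add, map_sub, map_add,
    dunkl_X_mul_self hi, dunkl_X_mul_of_mem hj hi hij, h, map_smul, map_smul, map_sum]
  have h1 : dunkl a s i (swapVar j i f) = swapVar i j (dunkl a s j f) := by
    rw [swapVar_dunkl hi hj, Equiv.swap_apply_right, swapVar_comm]
  have h2 : ∑ k ∈ s.erase i, dunkl a s j (swapVar i k f)
      = dunkl a s j (swapVar i j f) +
        ∑ k ∈ (s.erase i).erase j, swapVar i k (dunkl a s j f) := by
    rw [← Finset.add_sum_erase _ _ (Finset.mem_erase.2 ⟨hij.symm, hj⟩)]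
    congr 1
    refine Finset.sum_congr rfl fun k hk => ?_
    simp only [Finset.mem_erase] at hk
    rw [swapVar_dunkl hi hk.2.2, Equiv.swap_apply_of_ne_of_ne hij.symm (Ne.symm hk.1)]
  have h3 : ∑ k ∈ s.erase i, swapVar i k (dunkl a s j f)
      = swapVar i j (dunkl a s j f) +
        ∑ k ∈ (s.erase i).erase j, swapVar i k (dunkl a s j f) := by
    rw [← Finset.add_sum_erase _ _ (Finset.mem_erase.2 ⟨hij.symm, hj⟩)]
  have h4 : swapVar j i (dunkl a s i f) = dunkl a s j (swapVar i j f) := by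
    rw [swapVar_dunkl hj hi, Equiv.swap_apply_right, swapVar_comm]
  rw [h1, h2, h3, h4]
  simp only [smul_eq_C_mul]
  ring

lemma dunkl_comm (i j : ι) (f : MvPolynomial ι ℂ) :
    dunkl a s i (dunkl a s j f) = dunkl a s j (dunkl a s i f) := by
  by_cases hi : i ∈ s
  swap
  · simp [dunkl_of_notMem hi]
  by_cases hj : j ∈ s
  swap
  · simp [dunkl_of_notMem hj]
  by_cases hij : i = j
  · rw [hij]
  induction f using MvPolynomial.induction_on with
  | C c =>
    have : (C c : MvPolynomial ι ℂ) = c • 1 := by rw [smul_eq_C_mul, mul_one]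
    simp [this, dunkl_one]
  | add p q hp hq => simp [hp, hq]
  | mul_X p k hp =>
    rw [mul_comm]
    by_cases hki : k = i
    · subst hki
      exact dunkl_comm_aux hi hj hij p hp
    by_cases hkj : k = j
    · subst hkj
      exact (dunkl_comm_aux hj hi (Ne.symm hij) p hp.symm).symm
    by_cases hk : k ∈ s
    · rw [dunkl_X_mul_of_mem hj hk hkj, dunkl_X_mul_of_mem hi hk hki, map_add, map_add,
        dunkl_X_mul_of_mem hj hk hkj, dunkl_X_mul_of_mem hi hk hki, hp, map_smul, map_smul,
        swapVar_dunkl hi hk, swapVar_dunkl hj hk,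
        Equiv.swap_apply_of_ne_of_ne (Ne.symm hij) (Ne.symm hkj),
        Equiv.swap_apply_of_ne_of_ne hij (Ne.symm hki)]
      ring
    · simp only [dunkl_X_mul_of_notMem _ hk, hp]

end Operators

section Pairing

variable {ι : Type*}

open scoped IsMulCommutative in
lemma exists_algHom_of_commute {A : Type*} [Ring A] [Algebra ℂ A] (t : ι → A)
    (ht : ∀ i j, t i * t j = t j * t i) :
    ∃ φ : MvPolynomial ι ℂ →ₐ[ℂ] A, ∀ i, φ (X i) = t i := by
  have hcomm : ∀ x ∈ Set.range t, ∀ y ∈ Set.range t, x * y = y * x := by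
    rintro _ ⟨i, rfl⟩ _ ⟨j, rfl⟩
    exact ht i j
  have := Algebra.isMulCommutative_adjoin ℂ hcomm
  refine ⟨(Algebra.adjoin ℂ (Set.range t)).val.comp
    (aeval fun i => (⟨t i, Algebra.subset_adjoin ⟨i, rfl⟩⟩ :
      Algebra.adjoin ℂ (Set.range t))), fun i => ?_⟩
  simp

variable [DecidableEq ι]

lemma exists_dunklHom (a : ℕ) (s : Finset ι) :
    ∃ φ : MvPolynomial ι ℂ →ₐ[ℂ] Module.End ℂ (MvPolynomial ι ℂ), ∀ i, φ (X i) = dunkl a s i :=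
  exists_algHom_of_commute _ fun i j => LinearMap.ext fun f => dunkl_comm i j f

/-- Substitution of the Dunkl operators for the variables of a polynomial. -/
noncomputable def dunklHom (a : ℕ) (s : Finset ι) :
    MvPolynomial ι ℂ →ₐ[ℂ] Module.End ℂ (MvPolynomial ι ℂ) :=
  (exists_dunklHom a s).choose

variable {a : ℕ} {s : Finset ι}

@[simp] lemma dunklHom_X (i : ι) : dunklHom a s (X i) = dunkl a s i :=
  (exists_dunklHom a s).choose_spec i

lemma dunklHom_mul_apply (p q f : MvPolynomial ι ℂ) :
    dunklHom a s (p * q) f = dunklHom a s p (dunklHom a s q f) := by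
  rw [map_mul, Module.End.mul_apply]

lemma dunklHom_C (c : ℂ) (f : MvPolynomial ι ℂ) : dunklHom a s (C c) f = c • f := by
  have : (C c : MvPolynomial ι ℂ) = algebraMap ℂ _ c := rfl
  rw [this, AlgHom.commutes, Module.algebraMap_end_apply]

/-- Induction principle for statements about the action of all polynomials in Dunkl operators. -/
lemma dunklHom_induction {motive : MvPolynomial ι ℂ → Prop} (p : MvPolynomial ι ℂ)
    (hC : ∀ c, motive (C c)) (hadd : ∀ p q, motive p → motive q → motive (p + q))
    (hX : ∀ p i, motive p → motive (X i * p)) : motive p := by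
  induction p using MvPolynomial.induction_on with
  | C c => exact hC c
  | add p q hp hq => exact hadd p q hp hq
  | mul_X p i hp => rw [mul_comm]; exact hX p i hp

lemma rename_dunklHom {π : Equiv.Perm ι} (hπ : ∀ k, π k ∈ s ↔ k ∈ s) (p f : MvPolynomial ι ℂ) :
    rename π (dunklHom a s p f) = dunklHom a s (rename π p) (rename π f) := by
  induction p using dunklHom_induction with
  | hC c => simp
  | hadd p q hp hq => simp [hp, hq]
  | hX p i hp => simp [hp, rename_dunkl hπ]

lemma swapVar_dunklHom {i j : ι} (hi : i ∈ s) (hj : j ∈ s) (p f : MvPolynomial ι ℂ) :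
    swapVar i j (dunklHom a s p f) = dunklHom a s (swapVar i j p) (swapVar i j f) :=
  rename_dunklHom (swap_mem_iff hi hj) p f

lemma dunklHom_one (p : MvPolynomial ι ℂ) : dunklHom a s p 1 = C (constantCoeff p) := by
  induction p using MvPolynomial.induction_on with
  | C c => simp [smul_eq_C_mul]
  | add p q hp hq => simp [hp, hq]
  | mul_X p i hp => simp [dunkl_one]

/-- The bilinear pairing of a polynomial in the Dunkl operators with a polynomial. -/
noncomputable def pairing (a : ℕ) (s : Finset ι) (f g : MvPolynomial ι ℂ) : ℂ :=
  constantCoeff (dunklHom a s f g)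

lemma constantCoeff_swapVar (i j : ι) (f : MvPolynomial ι ℂ) :
    constantCoeff (swapVar i j f) = constantCoeff f := by
  simp [swapVar, constantCoeff_rename]

lemma pairing_swapVar {i j : ι} (hi : i ∈ s) (hj : j ∈ s) (f g : MvPolynomial ι ℂ) :
    pairing a s f (swapVar i j g) = pairing a s (swapVar i j f) g := by
  rw [pairing, pairing, ← constantCoeff_swapVar i j, swapVar_dunklHom hi hj, swapVar_swapVar]

lemma pairing_add_right (f g h : MvPolynomial ι ℂ) :
    pairing a s f (g + h) = pairing a s f g + pairing a s f h := by simp [pairing]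

lemma pairing_add_left (f g h : MvPolynomial ι ℂ) :
    pairing a s (f + g) h = pairing a s f h + pairing a s g h := by simp [pairing]

lemma pairing_sub_right (f g h : MvPolynomial ι ℂ) :
    pairing a s f (g - h) = pairing a s f g - pairing a s f h := by simp [pairing]

lemma pairing_sub_left (f g h : MvPolynomial ι ℂ) :
    pairing a s (f - g) h = pairing a s f h - pairing a s g h := by simp [pairing]

lemma pairing_smul_right (c : ℂ) (f g : MvPolynomial ι ℂ) :
    pairing a s f (c • g) = c * pairing a s f g := by
  rw [pairing, map_smul, smul_eq_C_mul]; simp [pairing]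

lemma pairing_smul_left (c : ℂ) (f g : MvPolynomial ι ℂ) :
    pairing a s (c • f) g = c * pairing a s f g := by simp [pairing, smul_eq_C_mul]

lemma pairing_sum_right {κ : Type*} (t : Finset κ) (f : MvPolynomial ι ℂ)
    (g : κ → MvPolynomial ι ℂ) :
    pairing a s f (∑ k ∈ t, g k) = ∑ k ∈ t, pairing a s f (g k) := by simp [pairing]

lemma pairing_sum_left {κ : Type*} (t : Finset κ) (f : κ → MvPolynomial ι ℂ)
    (g : MvPolynomial ι ℂ) :
    pairing a s (∑ k ∈ t, f k) g = ∑ k ∈ t, pairing a s (f k) g := by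
  simp [pairing, LinearMap.sum_apply]

lemma pairing_X_mul_left (i : ι) (f g : MvPolynomial ι ℂ) :
    pairing a s (X i * f) g = pairing a s f (dunkl a s i g) := by
  rw [pairing, mul_comm, dunklHom_mul_apply, dunklHom_X, pairing]

lemma dunklHom_X_mul_of_notMem {i : ι} (hi : i ∉ s) (f g : MvPolynomial ι ℂ) :
    dunklHom a s f (X i * g) = X i * dunklHom a s f g := by
  induction f using dunklHom_induction with
  | hC c => simp
  | hadd p q hp hq => simp [hp, hq, mul_add]
  | hX p k hp => rw [dunklHom_mul_apply, hp, dunklHom_mul_apply, dunklHom_X,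
      dunkl_X_mul_of_notMem _ hi]

lemma pairing_X_mul_right {i : ι} (hi : i ∈ s) (f g : MvPolynomial ι ℂ) :
    pairing a s f (X i * g) = pairing a s (dunkl a s i f) g := by
  induction f using dunklHom_induction generalizing g with
  | hC c =>
    have : (C c : MvPolynomial ι ℂ) = c • 1 := by rw [smul_eq_C_mul, mul_one]
    simp [this, dunkl_one, pairing]
  | hadd p q hp hq => simp [pairing_add_left, hp, hq]
  | hX p j hp =>
    rw [pairing_X_mul_left]
    by_cases hj : j ∈ s
    · by_cases hji : j = i
      · subst hji
        rw [dunkl_X_mul_self hi, dunkl_X_mul_self hi, pairing_sub_right, pairing_sub_left,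
          pairing_add_left, pairing_add_right, pairing_smul_left, pairing_smul_right, hp,
          pairing_X_mul_left, pairing_sum_left, pairing_sum_right]
        congr 2
        exact Finset.sum_congr rfl fun k hk =>
          pairing_swapVar hi (Finset.mem_of_mem_erase hk) _ _
      · rw [dunkl_X_mul_of_mem hj hi (Ne.symm hji), dunkl_X_mul_of_mem hi hj hji,
          pairing_add_left, pairing_add_right, pairing_smul_left, pairing_smul_right, hp,
          pairing_X_mul_left, pairing_swapVar hj hi, swapVar_comm]
    · rw [dunkl_X_mul_of_notMem _ hj, pairing_X_mul_left, dunkl_of_notMem hj]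
      simp [pairing]

lemma pairing_comm (f g : MvPolynomial ι ℂ) : pairing a s f g = pairing a s g f := by
  induction g using dunklHom_induction generalizing f with
  | hC c =>
    have : (C c : MvPolynomial ι ℂ) = c • 1 := by rw [smul_eq_C_mul, mul_one]
    rw [this, pairing_smul_right, pairing_smul_left, pairing, pairing, dunklHom_one]
    simp
  | hadd p q hp hq => simp [pairing_add_left, pairing_add_right, hp, hq]
  | hX p i hp =>
    by_cases hi : i ∈ s
    · rw [pairing_X_mul_right hi, pairing_X_mul_left, hp]
    · rw [pairing_X_mul_left, dunkl_of_notMem hi, pairing, dunklHom_X_mul_of_notMem hi]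
      simp [pairing]

lemma pairing_mul_left (p f g : MvPolynomial ι ℂ) :
    pairing a s (p * f) g = pairing a s p (dunklHom a s f g) := by
  rw [pairing, dunklHom_mul_apply, pairing]

end Pairing

section Degrees

variable {ι : Type*} [DecidableEq ι]

lemma degreeOf_swapVar (i j k : ι) (f : MvPolynomial ι ℂ) :
    degreeOf k (swapVar i j f) = degreeOf (Equiv.swap i j k) f := by
  have := degreeOf_rename_of_injective (p := f) (Equiv.swap i j).injective (Equiv.swap i j k)
  rwa [Equiv.swap_apply_self] at this

lemma degreeOf_sub_le_of_le {k : ι} {f g : MvPolynomial ι ℂ} {N : ℕ} (hf : degreeOf k f ≤ N)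
    (hg : degreeOf k g ≤ N) : degreeOf k (f - g) ≤ N :=
  (degreeOf_sub_le k f g).trans (max_le hf hg)

lemma one_le_degreeOf_X_sub_X {i j k : ι} (hij : i ≠ j) (hk : k = i ∨ k = j) :
    1 ≤ degreeOf k (X i - X j : MvPolynomial ι ℂ) := by
  have : Finsupp.single k 1 ∈ (X i - X j : MvPolynomial ι ℂ).support := by
    rw [mem_support_iff, coeff_sub, coeff_X, coeff_X]
    rcases hk with rfl | rfl
    · rw [if_pos rfl, if_neg fun h => hij.symm (Finsupp.single_left_injective one_ne_zero h)]
      simp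
    · rw [if_neg fun h => hij (Finsupp.single_left_injective one_ne_zero h), if_pos rfl]
      simp
  simpa using monomial_le_degreeOf k this

lemma degreeOf_divDiff_le {i j k : ι} {f : MvPolynomial ι ℂ} {N : ℕ} (hf : degreeOf k f ≤ N)
    (hf' : degreeOf (Equiv.swap i j k) f ≤ N) : degreeOf k (divDiff i j f) ≤ N := by
  by_cases hij : i = j
  · simp [divDiff, hij]
  by_cases h0 : divDiff i j f = 0
  · simp [h0]
  have h1 := degreeOf_mul_eq (n := k) (X_sub_X_ne_zero hij) h0
  rw [divDiff_spec] at h1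
  have := degreeOf_sub_le_of_le hf ((degreeOf_swapVar i j k f).trans_le hf')
  omega

lemma degreeOf_divDiff_le_sub_one {i j : ι} {f : MvPolynomial ι ℂ} {N : ℕ}
    (hi : degreeOf i f ≤ N) (hj : degreeOf j f ≤ N) : degreeOf i (divDiff i j f) ≤ N - 1 := by
  by_cases hij : i = j
  · simp [divDiff, hij]
  by_cases h0 : divDiff i j f = 0
  · simp [h0]
  have h1 := degreeOf_mul_eq (n := i) (X_sub_X_ne_zero hij) h0
  rw [divDiff_spec] at h1
  have h2 := degreeOf_sub_le_of_le hi
    ((degreeOf_swapVar i j i f).trans_le (by rwa [Equiv.swap_apply_left]))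
  have h3 := one_le_degreeOf_X_sub_X hij (Or.inl rfl : i = i ∨ i = j)
  omega

lemma degreeOf_pderiv_le (i k : ι) (f : MvPolynomial ι ℂ) :
    degreeOf k (pderiv i f) ≤ degreeOf k f := by
  rw [degreeOf_le_iff]
  intro m hm
  rw [mem_support_iff, coeff_pderiv] at hm
  have := monomial_le_degreeOf k (mem_support_iff.2 (left_ne_zero_of_mul hm))
  rw [Finsupp.add_apply] at this
  omega

lemma degreeOf_pderiv_self_le (i : ι) (f : MvPolynomial ι ℂ) :
    degreeOf i (pderiv i f) ≤ degreeOf i f - 1 := by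
  rw [degreeOf_le_iff]
  intro m hm
  rw [mem_support_iff, coeff_pderiv] at hm
  have := monomial_le_degreeOf i (mem_support_iff.2 (left_ne_zero_of_mul hm))
  rw [Finsupp.add_apply, Finsupp.single_eq_same] at this
  omega

lemma degreeOf_smul_sum_le {κ : Type*} {t : Finset κ} {k : ι} {f : κ → MvPolynomial ι ℂ} {N : ℕ}
    (c : ℂ) (h : ∀ j ∈ t, degreeOf k (f j) ≤ N) : degreeOf k (c • ∑ j ∈ t, f j) ≤ N := by
  rw [smul_eq_C_mul]
  exact (degreeOf_C_mul_le _ _ _).trans ((degreeOf_sum_le _ _ _).trans (Finset.sup_le h))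

/-- Polynomials in the variables `s` of degree at most `N` in each of them. -/
def box (s : Finset ι) (N : ℕ) : Submodule ℂ (MvPolynomial ι ℂ) where
  carrier := {f | ∀ k, degreeOf k f ≤ if k ∈ s then N else 0}
  zero_mem' k := by simp
  add_mem' hf hg k := (degreeOf_add_le k _ _).trans (max_le (hf k) (hg k))
  smul_mem' c f hf k := by
    rw [smul_eq_C_mul]
    exact (degreeOf_C_mul_le _ _ _).trans (hf k)

variable {a : ℕ} {s : Finset ι} {N : ℕ}

lemma degreeOf_le_of_mem_box {f : MvPolynomial ι ℂ} (hf : f ∈ box s N) (k : ι) :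
    degreeOf k f ≤ N :=
  (hf k).trans (by split_ifs <;> simp)

lemma degreeOf_eq_zero_of_mem_box {f : MvPolynomial ι ℂ} (hf : f ∈ box s N) {k : ι}
    (hk : k ∉ s) : degreeOf k f = 0 := by
  simpa [hk] using hf k

lemma box_mono {M : ℕ} (h : M ≤ N) : box s M ≤ box s N := fun f hf k =>
  (hf k).trans (by split_ifs <;> simp [h])

lemma mem_box_of_bounds {f : MvPolynomial ι ℂ} (h : ∀ k ∈ s, degreeOf k f ≤ N)
    (h0 : ∀ k ∉ s, degreeOf k f = 0) : f ∈ box s N := fun k => by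
  split_ifs with hk
  · exact h k hk
  · exact (h0 k hk).le

lemma dunkl_mem_box {f : MvPolynomial ι ℂ} (hf : f ∈ box s N) (i : ι) :
    dunkl a s i f ∈ box s N := by
  by_cases hi : i ∈ s
  swap
  · simp [dunkl_of_notMem hi]
  rw [dunkl_apply hi]
  intro k
  refine degreeOf_sub_le_of_le ((degreeOf_pderiv_le _ _ _).trans (hf k))
    (degreeOf_smul_sum_le _ fun j hj => degreeOf_divDiff_le (hf k) ?_)
  have := hf (Equiv.swap i j k)
  simpa only [swap_mem_iff hi hj] using this

lemma degreeOf_dunkl_self_le {f : MvPolynomial ι ℂ} (hf : f ∈ box s N) (i : ι) :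
    degreeOf i (dunkl a s i f) ≤ N - 1 := by
  by_cases hi : i ∈ s
  swap
  · simp [dunkl_of_notMem hi]
  rw [dunkl_apply hi]
  refine degreeOf_sub_le_of_le ((degreeOf_pderiv_self_le _ _).trans
    (Nat.sub_le_sub_right (degreeOf_le_of_mem_box hf i) 1))
    (degreeOf_smul_sum_le _ fun j _ => degreeOf_divDiff_le_sub_one
      (degreeOf_le_of_mem_box hf _) (degreeOf_le_of_mem_box hf _))

lemma dunklHom_mem_box {f : MvPolynomial ι ℂ} (hf : f ∈ box s N) (p : MvPolynomial ι ℂ) :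
    dunklHom a s p f ∈ box s N := by
  induction p using dunklHom_induction with
  | hC c => rw [dunklHom_C]; exact Submodule.smul_mem _ _ hf
  | hadd p q hp hq => rw [map_add]; exact Submodule.add_mem _ hp hq
  | hX p i hp => rw [dunklHom_mul_apply, dunklHom_X]; exact dunkl_mem_box hp i

lemma eq_C_of_degreeOf_eq_zero {f : MvPolynomial ι ℂ} (h : ∀ k, degreeOf k f = 0) :
    f = C (constantCoeff f) := by
  ext m
  rw [coeff_C]
  split_ifs with hm
  · rw [← hm]; rfl
  · by_contra hne
    obtain ⟨k, hk⟩ := Finsupp.ne_iff.1 (Ne.symm hm)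
    have := monomial_le_degreeOf k (mem_support_iff.2 hne)
    rw [h k] at this
    exact hk (by simpa using this)

end Degrees

section Extraction

variable {ι : Type*} [DecidableEq ι]

/-- The coefficient of the monomial `J` with respect to the variables `t`, as a polynomial in the
remaining variables. -/
noncomputable def extract (t : Finset ι) (J : ι →₀ ℕ) :
    MvPolynomial ι ℂ →ₗ[ℂ] MvPolynomial ι ℂ :=
  (basisMonomials ι ℂ).constr ℂ fun m =>
    if m.filter (· ∈ t) = J then monomial (m.filter (· ∉ t)) 1 else 0

variable {t : Finset ι} {J : ι →₀ ℕ}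

lemma extract_monomial (m : ι →₀ ℕ) (c : ℂ) :
    extract t J (monomial m c)
      = if m.filter (· ∈ t) = J then monomial (m.filter (· ∉ t)) c else 0 := by
  have h : (monomial m c : MvPolynomial ι ℂ) = c • basisMonomials ι ℂ m := by
    simp [smul_monomial]
  rw [h, map_smul, extract, Module.Basis.constr_basis]
  split_ifs <;> simp [smul_monomial]

lemma linearMap_ext_monomial {f g : MvPolynomial ι ℂ →ₗ[ℂ] MvPolynomial ι ℂ}
    (h : ∀ m c, f (monomial m c) = g (monomial m c)) (p : MvPolynomial ι ℂ) : f p = g p := by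
  induction p using MvPolynomial.induction_on' with
  | monomial m c => exact h m c
  | add p q hp hq => rw [map_add, map_add, hp, hq]

lemma coeff_extract (hJ : ∀ i ∉ t, J i = 0) (m : ι →₀ ℕ) (f : MvPolynomial ι ℂ) :
    coeff m (extract t J f) = if ∀ i ∈ t, m i = 0 then coeff (m + J) f else 0 := by
  induction f using MvPolynomial.induction_on' with
  | add p q hp hq =>
    rw [map_add, coeff_add, hp, hq, coeff_add]
    split_ifs <;> simp
  | monomial n c =>
    rw [extract_monomial, coeff_monomial]
    by_cases hm : ∀ i ∈ t, m i = 0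
    · rw [if_pos hm]
      by_cases hn : n = m + J
      · subst hn
        have h1 : Finsupp.filter (· ∈ t) (m + J) = J := by
          ext i
          by_cases hi : i ∈ t <;> simp [hi, hm, hJ]
        have h2 : Finsupp.filter (· ∉ t) (m + J) = m := by
          ext i
          by_cases hi : i ∈ t <;> simp [hi, hm, hJ]
        simp [h1, h2]
      · rw [if_neg hn]
        split_ifs with h
        · rw [coeff_monomial, if_neg]
          rintro rfl
          apply hn
          rw [← h, add_comm, Finsupp.filter_add_filter_not]
        · simp
    · rw [if_neg hm]
      split_ifs
      · rw [coeff_monomial, if_neg]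
        rintro rfl
        exact hm fun i hi => by simp [hi]
      · simp

lemma extract_pderiv (hJ : ∀ i ∉ t, J i = 0) {i : ι} (hi : i ∉ t) (f : MvPolynomial ι ℂ) :
    extract t J (pderiv i f) = pderiv i (extract t J f) := by
  ext m
  rw [coeff_pderiv, coeff_extract hJ, coeff_extract hJ, coeff_pderiv]
  have : (∀ k ∈ t, m k + Finsupp.single i 1 k = 0) ↔ ∀ k ∈ t, m k = 0 := by
    refine forall₂_congr fun k hk => ?_
    rw [Finsupp.single_eq_of_ne (ne_of_mem_of_not_mem hk hi), add_zero]
  simp only [Finsupp.add_apply, this, hJ i hi, add_zero, add_right_comm m J]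
  split_ifs <;> simp

lemma extract_X_mul {i : ι} (hi : i ∉ t) (f : MvPolynomial ι ℂ) :
    extract t J (X i * f) = X i * extract t J f := by
  refine linearMap_ext_monomial (f := (extract t J) ∘ₗ LinearMap.mulLeft ℂ (X i))
    (g := LinearMap.mulLeft ℂ (X i) ∘ₗ extract t J) (fun m c => ?_) f
  simp only [LinearMap.comp_apply, LinearMap.mulLeft_apply]
  have h1 : Finsupp.filter (· ∈ t) (Finsupp.single i 1 + m) = Finsupp.filter (· ∈ t) m := by
    rw [Finsupp.filter_add, Finsupp.filter_single_of_neg (· ∈ t) hi, zero_add]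
  have h2 : Finsupp.filter (· ∉ t) (Finsupp.single i 1 + m)
      = Finsupp.single i 1 + Finsupp.filter (· ∉ t) m := by
    rw [Finsupp.filter_add, Finsupp.filter_single_of_pos (· ∉ t) hi]
  rw [X, monomial_mul, extract_monomial, extract_monomial, h1, h2]
  split_ifs <;> simp [monomial_mul]

lemma extract_swapVar {i j : ι} (hi : i ∉ t) (hj : j ∉ t) (f : MvPolynomial ι ℂ) :
    extract t J (swapVar i j f) = swapVar i j (extract t J f) := by
  refine linearMap_ext_monomial (f := (extract t J) ∘ₗ (swapVar i j).toLinearMap)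
    (g := (swapVar i j).toLinearMap ∘ₗ extract t J) (fun m c => ?_) f
  have hmem : ∀ k, Equiv.swap i j k ∈ t ↔ k ∈ t := by
    intro k
    by_cases hki : k = i
    · subst hki; simp [hi, hj]
    by_cases hkj : k = j
    · subst hkj; simp [hi, hj]
    rw [Equiv.swap_apply_of_ne_of_ne hki hkj]
  have h1 : Finsupp.filter (· ∈ t) (Finsupp.mapDomain (Equiv.swap i j) m)
      = Finsupp.filter (· ∈ t) m := by
    ext k
    by_cases hk : k ∈ t
    · rw [Finsupp.filter_apply, if_pos hk, Finsupp.filter_apply, if_pos hk,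
        Finsupp.mapDomain_equiv_apply, Equiv.symm_swap,
        Equiv.swap_apply_of_ne_of_ne (ne_of_mem_of_not_mem hk hi) (ne_of_mem_of_not_mem hk hj)]
    · simp [hk]
  have h2 : Finsupp.filter (· ∉ t) (Finsupp.mapDomain (Equiv.swap i j) m)
      = Finsupp.mapDomain (Equiv.swap i j) (Finsupp.filter (· ∉ t) m) := by
    ext k
    simp [Finsupp.filter_apply, Finsupp.mapDomain_equiv_apply, hmem]
  simp only [LinearMap.comp_apply, AlgHom.toLinearMap_apply, swapVar, rename_monomial,
    extract_monomial, h1, h2]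
  split_ifs
  · rw [rename_monomial]
  · simp

lemma extract_divDiff {i j : ι} (hi : i ∉ t) (hj : j ∉ t) (f : MvPolynomial ι ℂ) :
    extract t J (divDiff i j f) = divDiff i j (extract t J f) := by
  by_cases hij : i = j
  · simp [divDiff, hij]
  · symm
    refine divDiff_eq hij ?_
    rw [sub_mul, ← extract_X_mul hi, ← extract_X_mul hj, ← map_sub, ← sub_mul, divDiff_spec,
      map_sub, extract_swapVar hi hj]

variable {a : ℕ} {s : Finset ι}

lemma extract_dunkl (hJ : ∀ i ∉ t, J i = 0) (hst : Disjoint s t) (i : ι)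
    (f : MvPolynomial ι ℂ) :
    extract t J (dunkl a s i f) = dunkl a s i (extract t J f) := by
  by_cases hi : i ∈ s
  swap
  · simp [dunkl_of_notMem hi]
  have hs : ∀ j ∈ s, j ∉ t := fun j hj => Finset.disjoint_left.1 hst hj
  rw [dunkl_apply hi, dunkl_apply hi, map_sub, map_smul, map_sum, extract_pderiv hJ (hs i hi)]
  congr 2
  exact Finset.sum_congr rfl fun j hj => extract_divDiff (hs i hi) (hs j hj) f

lemma extract_dunklHom (hJ : ∀ i ∉ t, J i = 0) (hst : Disjoint s t) (p f : MvPolynomial ι ℂ) :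
    extract t J (dunklHom a s p f) = dunklHom a s p (extract t J f) := by
  induction p using dunklHom_induction with
  | hC c => simp
  | hadd p q hp hq => simp [hp, hq]
  | hX p i hp => simp [hp, extract_dunkl hJ hst]

lemma extract_mul_of_degreeOf_eq_zero {p : MvPolynomial ι ℂ} (hp : ∀ i ∈ t, degreeOf i p = 0)
    (f : MvPolynomial ι ℂ) : extract t J (p * f) = p * extract t J f := by
  have hmem : ∀ m ∈ p.support, ∀ g, extract t J (monomial m (coeff m p) * g)
      = monomial m (coeff m p) * extract t J g := by
    intro m hm g
    have hm0 : ∀ i ∈ t, m i = 0 := fun i hi => by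
      simpa [hp i hi] using monomial_le_degreeOf i hm
    refine linearMap_ext_monomial
      (f := (extract t J) ∘ₗ LinearMap.mulLeft ℂ (monomial m (coeff m p)))
      (g := LinearMap.mulLeft ℂ (monomial m (coeff m p)) ∘ₗ extract t J) (fun n c => ?_) g
    have h1 : Finsupp.filter (· ∈ t) (m + n) = Finsupp.filter (· ∈ t) n := by
      ext k
      by_cases hk : k ∈ t <;> simp [hk, hm0]
    have h2 : Finsupp.filter (· ∉ t) (m + n) = m + Finsupp.filter (· ∉ t) n := by
      ext k
      by_cases hk : k ∈ t <;> simp [hk, hm0]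
    simp only [LinearMap.comp_apply, LinearMap.mulLeft_apply, monomial_mul, extract_monomial,
      h1, h2]
    split_ifs <;> simp [monomial_mul]
  conv_lhs => rw [p.as_sum]
  conv_rhs => rw [p.as_sum]
  rw [Finset.sum_mul, Finset.sum_mul, map_sum]
  exact Finset.sum_congr rfl fun m hm => hmem m hm f

lemma degreeOf_extract_le (hJ : ∀ i ∉ t, J i = 0) (k : ι) (f : MvPolynomial ι ℂ) :
    degreeOf k (extract t J f) ≤ degreeOf k f := by
  rw [degreeOf_le_iff]
  intro m hm
  rw [mem_support_iff, coeff_extract hJ] at hm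
  have := monomial_le_degreeOf k (mem_support_iff.2 fun h => hm (by rw [h, ite_self]))
  rw [Finsupp.add_apply] at this
  omega

lemma degreeOf_extract_eq_zero (hJ : ∀ i ∉ t, J i = 0) {k : ι} (hk : k ∈ t)
    (f : MvPolynomial ι ℂ) : degreeOf k (extract t J f) = 0 := by
  rw [← Nat.le_zero, degreeOf_le_iff]
  intro m hm
  rw [mem_support_iff, coeff_extract hJ] at hm
  by_contra h
  exact hm (if_neg fun hall => h (hall k hk).le)

lemma eq_sum_extract (f : MvPolynomial ι ℂ) (t : Finset ι) :
    f = ∑ J ∈ f.support.image (Finsupp.filter (· ∈ t)), extract t J f * monomial J 1 := by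
  have key : ∀ m ∈ f.support,
      ∑ J ∈ f.support.image (Finsupp.filter (· ∈ t)),
        extract t J (monomial m (coeff m f)) * monomial J 1 = monomial m (coeff m f) := by
    intro m hm
    simp only [extract_monomial, ite_mul, zero_mul]
    rw [Finset.sum_ite_eq, if_pos (Finset.mem_image_of_mem _ hm), monomial_mul, mul_one,
      add_comm, Finsupp.filter_add_filter_not]
  conv_lhs => rw [f.as_sum]
  rw [← Finset.sum_congr rfl key, Finset.sum_comm]
  refine Finset.sum_congr rfl fun J _ => ?_
  conv_rhs => rw [f.as_sum]
  rw [map_sum, Finset.sum_mul]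

end Extraction

section Elementary

variable {ι : Type*}

/-- The polynomial `∏_{i ∈ s} (1 - x_i z)` in `z`. -/
noncomputable def genPoly (s : Finset ι) : Polynomial (MvPolynomial ι ℂ) :=
  ∏ i ∈ s, (1 - Polynomial.C (X i) * Polynomial.X)

/-- The signed elementary symmetric polynomials in the variables `s`. -/
noncomputable def elemCoeff (s : Finset ι) (r : ℕ) : MvPolynomial ι ℂ :=
  (genPoly s).coeff r

lemma natDegree_genPoly_le (s : Finset ι) : (genPoly s).natDegree ≤ s.card := by
  refine (Polynomial.natDegree_prod_le _ _).trans
    ((Finset.sum_le_card_nsmul _ _ 1 fun i _ => ?_).trans_eq (by simp))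
  compute_degree

lemma elemCoeff_eq_zero {s : Finset ι} {r : ℕ} (h : s.card < r) : elemCoeff s r = 0 :=
  Polynomial.coeff_eq_zero_of_natDegree_lt ((natDegree_genPoly_le s).trans_lt h)

lemma elemCoeff_zero (s : Finset ι) : elemCoeff s 0 = 1 := by
  simp [elemCoeff, genPoly, Polynomial.coeff_zero_eq_eval_zero, Polynomial.eval_prod]

/-- The algebra generated by the elementary symmetric polynomials in the variables `s`. -/
noncomputable def symAlg (s : Finset ι) : Subalgebra ℂ (MvPolynomial ι ℂ) :=
  Algebra.adjoin ℂ (Set.range (elemCoeff s))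

lemma elemCoeff_mem_symAlg (s : Finset ι) (r : ℕ) : elemCoeff s r ∈ symAlg s :=
  Algebra.subset_adjoin ⟨r, rfl⟩

variable [DecidableEq ι]

lemma genPoly_insert {l : ι} {s : Finset ι} (hl : l ∉ s) :
    genPoly (insert l s) = (1 - Polynomial.C (X l) * Polynomial.X) * genPoly s :=
  Finset.prod_insert hl

lemma elemCoeff_insert_succ {l : ι} {s : Finset ι} (hl : l ∉ s) (r : ℕ) :
    elemCoeff (insert l s) (r + 1) = elemCoeff s (r + 1) - X l * elemCoeff s r := by
  simp [elemCoeff, genPoly_insert hl, sub_mul, mul_assoc, Polynomial.coeff_X_mul]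

lemma elemCoeff_card (s : Finset ι) : elemCoeff s s.card = ∏ i ∈ s, (-X i) := by
  induction s using Finset.induction with
  | empty => simp [elemCoeff_zero]
  | insert l s hl ih =>
    rw [Finset.card_insert_of_notMem hl, elemCoeff_insert_succ hl,
      elemCoeff_eq_zero (Nat.lt_succ_self _), ih, Finset.prod_insert hl]
    ring

lemma elemCoeff_eq_sum (s : Finset ι) (r : ℕ) :
    elemCoeff s r = ∑ A ∈ s.powersetCard r, ∏ i ∈ A, (-X i) := by
  induction s using Finset.induction generalizing r with
  | empty =>
    cases r with
    | zero => simp [elemCoeff_zero]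
    | succ r => rw [elemCoeff_eq_zero (by simp), Finset.powersetCard_eq_empty.2 (by simp)]; simp
  | insert l s hl ih =>
    cases r with
    | zero => simp [elemCoeff_zero]
    | succ r =>
      rw [elemCoeff_insert_succ hl, ih, ih, Finset.powersetCard_succ_insert hl,
        Finset.sum_union, Finset.sum_image, Finset.mul_sum, sub_eq_add_neg,
        ← Finset.sum_neg_distrib]
      · congr 1
        refine Finset.sum_congr rfl fun A hA => ?_
        rw [Finset.prod_insert fun h => hl ((Finset.mem_powersetCard.1 hA).1 h)]
        ring
      · intro A hA B hB h
        have hA' : l ∉ A := fun h => hl ((Finset.mem_powersetCard.1 hA).1 h)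
        have hB' : l ∉ B := fun h => hl ((Finset.mem_powersetCard.1 hB).1 h)
        rw [← Finset.erase_insert hA', ← Finset.erase_insert hB', h]
      · rw [Finset.disjoint_left]
        intro A hA hA'
        obtain ⟨B, _, rfl⟩ := Finset.mem_image.1 hA'
        exact hl ((Finset.mem_powersetCard.1 hA).1 (Finset.mem_insert_self _ _))

lemma prod_swap_eq {M : Type*} [CommMonoid M] {s : Finset ι} {i j : ι} (hi : i ∈ s) (hj : j ∈ s)
    (f : ι → M) : ∏ k ∈ s, f (Equiv.swap i j k) = ∏ k ∈ s, f k :=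
  Finset.prod_bij (fun k _ => Equiv.swap i j k) (fun k hk => (swap_mem_iff hi hj k).2 hk)
    (fun _ _ _ _ h => (Equiv.swap i j).injective h)
    (fun k hk => ⟨Equiv.swap i j k, (swap_mem_iff hi hj k).2 hk, by simp⟩) (fun _ _ => rfl)

lemma map_swapVar_genPoly {s : Finset ι} {i j : ι} (hi : i ∈ s) (hj : j ∈ s) :
    (genPoly s).map (swapVar i j : MvPolynomial ι ℂ →+* MvPolynomial ι ℂ) = genPoly s := by
  rw [genPoly, Polynomial.map_prod, ← prod_swap_eq hi hj]
  simp

lemma swapVar_elemCoeff {s : Finset ι} {i j : ι} (hi : i ∈ s) (hj : j ∈ s) (r : ℕ) :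
    swapVar i j (elemCoeff s r) = elemCoeff s r := by
  conv_rhs => rw [elemCoeff, ← map_swapVar_genPoly hi hj, Polynomial.coeff_map]
  rfl

lemma swapVar_of_mem_symAlg {s : Finset ι} {i j : ι} (hi : i ∈ s) (hj : j ∈ s)
    {p : MvPolynomial ι ℂ} (hp : p ∈ symAlg s) : swapVar i j p = p := by
  have : symAlg s ≤ AlgHom.equalizer (swapVar i j) (AlgHom.id ℂ _) := by
    refine Algebra.adjoin_le ?_
    rintro _ ⟨r, rfl⟩
    exact swapVar_elemCoeff hi hj r
  exact this hp

lemma dunklHom_elemCoeff_insert (a : ℕ) {l : ι} {s : Finset ι} (hl : l ∉ s) (r : ℕ) :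
    dunklHom a s (elemCoeff (insert l s) r) = dunklHom a s (elemCoeff s r) := by
  cases r with
  | zero => rw [elemCoeff_zero, elemCoeff_zero]
  | succ r =>
    rw [elemCoeff_insert_succ hl, map_sub, map_mul, dunklHom_X, dunkl_of_notMem hl, zero_mul,
      sub_zero]

lemma exists_lift_symAlg (a : ℕ) {l : ι} {s : Finset ι} (hl : l ∉ s) {p : MvPolynomial ι ℂ}
    (hp : p ∈ symAlg s) : ∃ q ∈ symAlg (insert l s), dunklHom a s q = dunklHom a s p := by
  induction hp using Algebra.adjoin_induction with
  | mem x hx =>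
    obtain ⟨r, rfl⟩ := hx
    exact ⟨_, elemCoeff_mem_symAlg _ r, dunklHom_elemCoeff_insert a hl r⟩
  | algebraMap c => exact ⟨_, Subalgebra.algebraMap_mem _ c, rfl⟩
  | add x y _ _ hx hy =>
    obtain ⟨q, hq, h⟩ := hx
    obtain ⟨q', hq', h'⟩ := hy
    exact ⟨q + q', add_mem hq hq', by rw [map_add, map_add, h, h']⟩
  | mul x y _ _ hx hy =>
    obtain ⟨q, hq, h⟩ := hx
    obtain ⟨q', hq', h'⟩ := hy
    exact ⟨q * q', mul_mem hq hq', by rw [map_mul, map_mul, h, h']⟩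

end Elementary

section LeadingCoefficient

variable {ι : Type*} [DecidableEq ι]

/-- The coefficient of `x_l ^ N`. -/
noncomputable def leadCoeff (l : ι) (N : ℕ) : MvPolynomial ι ℂ →ₗ[ℂ] MvPolynomial ι ℂ :=
  extract {l} (Finsupp.single l N)

lemma single_apply_eq_zero_of_notMem (l : ι) (N : ℕ) :
    ∀ i ∉ ({l} : Finset ι), Finsupp.single l N i = 0 := fun _ hi =>
  Finsupp.single_eq_of_ne fun h => hi (Finset.mem_singleton.2 h)

lemma coeff_leadCoeff (l : ι) (N : ℕ) (m : ι →₀ ℕ) (f : MvPolynomial ι ℂ) :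
    coeff m (leadCoeff l N f) = if m l = 0 then coeff (m + Finsupp.single l N) f else 0 := by
  rw [leadCoeff, coeff_extract (single_apply_eq_zero_of_notMem l N)]
  simp

lemma leadCoeff_eq_zero {l : ι} {N : ℕ} {f : MvPolynomial ι ℂ} (h : degreeOf l f < N) :
    leadCoeff l N f = 0 := by
  ext m
  rw [coeff_leadCoeff, coeff_zero, ite_eq_right_iff]
  intro _
  by_contra hne
  have := monomial_le_degreeOf l (mem_support_iff.2 hne)
  rw [Finsupp.add_apply, Finsupp.single_eq_same] at this
  omega

lemma degreeOf_le_of_leadCoeff_eq_zero {l : ι} {N : ℕ} {f : MvPolynomial ι ℂ}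
    (h : degreeOf l f ≤ N) (h0 : leadCoeff l N f = 0) : degreeOf l f ≤ N - 1 := by
  rw [degreeOf_le_iff]
  intro m hm
  have h1 := monomial_le_degreeOf l hm
  by_contra hlt
  have hml : m l = N := by omega
  refine mem_support_iff.1 hm ?_
  have h2 := congrArg (coeff (m.erase l)) h0
  rw [coeff_leadCoeff, if_pos Finsupp.erase_same, coeff_zero, ← hml, add_comm,
    Finsupp.single_add_erase] at h2
  exact h2

lemma leadCoeff_X_mul_self (l : ι) (N : ℕ) (f : MvPolynomial ι ℂ) :
    leadCoeff l (N + 1) (X l * f) = leadCoeff l N f := by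
  ext m
  rw [coeff_leadCoeff, coeff_leadCoeff, Finsupp.single_add, ← add_assoc, add_comm _ (Finsupp.single l 1),
    coeff_X_mul]

lemma leadCoeff_mul {l : ι} (N : ℕ) {p : MvPolynomial ι ℂ} (hp : degreeOf l p = 0)
    (f : MvPolynomial ι ℂ) : leadCoeff l N (p * f) = p * leadCoeff l N f :=
  extract_mul_of_degreeOf_eq_zero (by simpa using hp) f

variable {a : ℕ} {l : ι} {s : Finset ι} {N : ℕ}

lemma leadCoeff_dunkl (hl : l ∉ s) (hN : 1 ≤ N) {f : MvPolynomial ι ℂ}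
    (hf : f ∈ box (insert l s) N) (i : ι) :
    leadCoeff l N (dunkl a (insert l s) i f) = dunkl a s i (leadCoeff l N f) := by
  by_cases hil : i = l
  · subst hil
    rw [dunkl_of_notMem hl, LinearMap.zero_apply]
    exact leadCoeff_eq_zero ((degreeOf_dunkl_self_le hf i).trans_lt (by omega))
  by_cases hi : i ∈ s
  · have hdis : Disjoint s {l} := Finset.disjoint_singleton_right.2 hl
    have h1 : leadCoeff l N (divDiff i l f) = 0 := by
      refine leadCoeff_eq_zero ?_
      have := degreeOf_divDiff_le_sub_one (degreeOf_le_of_mem_box hf l)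
        (degreeOf_le_of_mem_box hf i)
      rw [← neg_neg (divDiff i l f), ← divDiff_comm, degreeOf_neg]
      omega
    have h2 := extract_dunkl (a := a) (single_apply_eq_zero_of_notMem l N) hdis i f
    rw [leadCoeff] at h1 ⊢
    rw [← h2, dunkl_apply hi, dunkl_apply (Finset.mem_insert_of_mem hi), Finset.sum_insert hl,
      map_sub, map_sub, map_smul, map_smul, map_add, h1, zero_add]
  · rw [dunkl_of_notMem hi, dunkl_of_notMem (by simp [hil, hi])]
    simp

lemma leadCoeff_dunklHom (hl : l ∉ s) (hN : 1 ≤ N) {f : MvPolynomial ι ℂ}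
    (hf : f ∈ box (insert l s) N) (p : MvPolynomial ι ℂ) :
    leadCoeff l N (dunklHom a (insert l s) p f) = dunklHom a s p (leadCoeff l N f) := by
  induction p using dunklHom_induction with
  | hC c => simp
  | hadd p q hp hq => simp [hp, hq]
  | hX p i hp =>
    rw [dunklHom_mul_apply, dunklHom_X, leadCoeff_dunkl hl hN (dunklHom_mem_box hf p), hp,
      dunklHom_mul_apply, dunklHom_X]

end LeadingCoefficient

section SymmetricSpaces

variable {ι : Type*} [DecidableEq ι]

/-- The symmetric polynomials in the variables `s` of degree at most `N` in each variable. -/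
noncomputable def symBox (s : Finset ι) (N : ℕ) : Submodule ℂ (MvPolynomial ι ℂ) :=
  box s N ⊓ ⨅ i ∈ s, ⨅ j ∈ s, LinearMap.eqLocus (swapVar i j).toLinearMap LinearMap.id

variable {a : ℕ} {l : ι} {s : Finset ι} {N : ℕ}

lemma mem_symBox {f : MvPolynomial ι ℂ} :
    f ∈ symBox s N ↔ f ∈ box s N ∧ ∀ i ∈ s, ∀ j ∈ s, swapVar i j f = f := by
  simp [symBox, Submodule.mem_iInf, LinearMap.mem_eqLocus]

lemma symBox_mono {M : ℕ} (h : M ≤ N) : symBox s M ≤ symBox s N :=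
  inf_le_inf_right _ (box_mono h)

lemma degreeOf_eq_of_symm {f : MvPolynomial ι ℂ} (h : ∀ i ∈ s, ∀ j ∈ s, swapVar i j f = f)
    {i j : ι} (hi : i ∈ s) (hj : j ∈ s) : degreeOf i f = degreeOf j f := by
  rw [← h i hi j hj, degreeOf_swapVar, Equiv.swap_apply_left, h i hi j hj]

lemma mem_symBox_of_degreeOf_le {M : ℕ} {f : MvPolynomial ι ℂ} (hf : f ∈ symBox s N) (hl : l ∈ s)
    (h : degreeOf l f ≤ M) : f ∈ symBox s M := by
  obtain ⟨h1, h2⟩ := mem_symBox.1 hf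
  refine mem_symBox.2 ⟨mem_box_of_bounds (fun k hk => ?_)
    fun k hk => degreeOf_eq_zero_of_mem_box h1 hk, h2⟩
  rwa [degreeOf_eq_of_symm h2 hk hl]

lemma dunklHom_mem_symBox {p f : MvPolynomial ι ℂ} (hp : p ∈ symAlg s) (hf : f ∈ symBox s N) :
    dunklHom a s p f ∈ symBox s N := by
  obtain ⟨h1, h2⟩ := mem_symBox.1 hf
  refine mem_symBox.2 ⟨dunklHom_mem_box h1 p, fun i hi j hj => ?_⟩
  rw [swapVar_dunklHom hi hj, swapVar_of_mem_symAlg hi hj hp, h2 i hi j hj]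

lemma dunklHom_elemCoeff_card_mem (hs : s.Nonempty) {f : MvPolynomial ι ℂ}
    (hf : f ∈ symBox s N) : dunklHom a s (elemCoeff s s.card) f ∈ symBox s (N - 1) := by
  obtain ⟨l, hl⟩ := hs
  refine mem_symBox_of_degreeOf_le (dunklHom_mem_symBox (elemCoeff_mem_symAlg _ _) hf) hl ?_
  rw [elemCoeff_card, ← Finset.mul_prod_erase _ _ hl, neg_mul, map_neg, LinearMap.neg_apply,
    degreeOf_neg, dunklHom_mul_apply, dunklHom_X]
  exact degreeOf_dunkl_self_le (dunklHom_mem_box (mem_symBox.1 hf).1 _) l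

lemma eq_C_of_mem_symBox_zero {f : MvPolynomial ι ℂ} (hf : f ∈ symBox s 0) :
    f = C (constantCoeff f) :=
  eq_C_of_degreeOf_eq_zero fun k => by
    simpa using (mem_symBox.1 hf).1 k

lemma C_mem_symBox (c : ℂ) : (C c : MvPolynomial ι ℂ) ∈ symBox s N :=
  mem_symBox.2 ⟨fun k => by simp, fun i _ j _ => by simp [swapVar]⟩

lemma eq_C_of_mem_symBox_empty {f : MvPolynomial ι ℂ} (hf : f ∈ symBox ∅ N) :
    f = C (constantCoeff f) :=
  eq_C_of_degreeOf_eq_zero fun k => by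
    simpa using (mem_symBox.1 hf).1 k

lemma leadCoeff_mem_symBox (hl : l ∉ s) {f : MvPolynomial ι ℂ}
    (hf : f ∈ symBox (insert l s) N) : leadCoeff l N f ∈ symBox s N := by
  obtain ⟨h1, h2⟩ := mem_symBox.1 hf
  have hJ := single_apply_eq_zero_of_notMem l N
  refine mem_symBox.2 ⟨mem_box_of_bounds
    (fun k _ => (degreeOf_extract_le hJ k f).trans (degreeOf_le_of_mem_box h1 k))
    fun k hk => ?_, fun i hi j hj => ?_⟩
  · by_cases hkl : k = l
    · exact degreeOf_extract_eq_zero hJ (Finset.mem_singleton.2 hkl) f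
    · exact Nat.le_zero.1 ((degreeOf_extract_le hJ k f).trans_eq
        (degreeOf_eq_zero_of_mem_box h1 (by simp [hkl, hk])))
  · rw [leadCoeff, ← extract_swapVar (by simpa using ne_of_mem_of_not_mem hi hl)
      (by simpa using ne_of_mem_of_not_mem hj hl),
      h2 i (Finset.mem_insert_of_mem hi) j (Finset.mem_insert_of_mem hj)]

lemma mem_symBox_sub_one_of_leadCoeff (hl : l ∈ s) {f : MvPolynomial ι ℂ} (hf : f ∈ symBox s N)
    (h : leadCoeff l N f = 0) : f ∈ symBox s (N - 1) :=
  mem_symBox_of_degreeOf_le hf hl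
    (degreeOf_le_of_leadCoeff_eq_zero (degreeOf_le_of_mem_box (mem_symBox.1 hf).1 l) h)

/-- The span of the elementary symmetric polynomials. -/
noncomputable def elemSpan (s : Finset ι) : Submodule ℂ (MvPolynomial ι ℂ) :=
  Submodule.span ℂ (Set.range (elemCoeff s))

lemma elemCoeff_mem_box (s : Finset ι) (r : ℕ) : elemCoeff s r ∈ box s 1 := by
  induction s using Finset.induction generalizing r with
  | empty =>
    cases r with
    | zero => rw [elemCoeff_zero]; intro k; simp
    | succ r => rw [elemCoeff_eq_zero (by simp)]; exact zero_mem _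
  | insert l s hl ih =>
    cases r with
    | zero => rw [elemCoeff_zero]; intro k; simp
    | succ r =>
      rw [elemCoeff_insert_succ hl]
      intro k
      have h1 := ih (r + 1) k
      have h2 := ih r k
      have h3 := degreeOf_mul_le k (X l : MvPolynomial ι ℂ) (elemCoeff s r)
      rw [degreeOf_X] at h3
      by_cases hkl : k = l
      · subst hkl
        simp only [hl, if_false, if_true, Finset.mem_insert_self] at h1 h2 h3 ⊢
        exact degreeOf_sub_le_of_le (by omega) (by omega)
      · simp only [hkl, if_false, Finset.mem_insert, false_or] at h1 h2 h3 ⊢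
        exact degreeOf_sub_le_of_le h1 (by omega)

lemma elemSpan_pow_le_box (s : Finset ι) (N : ℕ) : elemSpan s ^ N ≤ box s N := by
  induction N with
  | zero =>
    rw [pow_zero, Submodule.one_le]
    intro k
    simp
  | succ N ih =>
    rw [pow_succ, Submodule.mul_le]
    intro p hp q hq k
    have hq' : q ∈ box s 1 := by
      refine (Submodule.span_le.2 ?_ : elemSpan s ≤ box s 1) hq
      rintro _ ⟨r, rfl⟩
      exact elemCoeff_mem_box s r
    have h1 := degreeOf_mul_le k p q
    have h2 := ih hp k
    have h3 := hq' k
    split_ifs at h2 h3 ⊢ <;> omega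

lemma elemSpan_pow_le_symAlg (s : Finset ι) (N : ℕ) :
    elemSpan s ^ N ≤ Subalgebra.toSubmodule (symAlg s) := by
  induction N with
  | zero => rw [pow_zero, Submodule.one_le]; exact one_mem (symAlg s)
  | succ N ih =>
    rw [pow_succ, Submodule.mul_le]
    intro p hp q hq
    refine mul_mem (s := symAlg s) (ih hp) ?_
    refine (Submodule.span_le.2 ?_ : elemSpan s ≤ Subalgebra.toSubmodule (symAlg s)) hq
    rintro _ ⟨r, rfl⟩
    exact elemCoeff_mem_symAlg s r

lemma elemSpan_pow_le_symBox (s : Finset ι) (N : ℕ) : elemSpan s ^ N ≤ symBox s N := fun _ hf =>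
  mem_symBox.2 ⟨elemSpan_pow_le_box s N hf, fun _ hi _ hj =>
    swapVar_of_mem_symAlg hi hj (elemSpan_pow_le_symAlg s N hf)⟩

lemma one_le_elemSpan (s : Finset ι) : 1 ≤ elemSpan s :=
  Submodule.one_le.2 (Submodule.subset_span ⟨0, elemCoeff_zero s⟩)

lemma elemSpan_pow_le_map_leadCoeff (hl : l ∉ s) (N : ℕ) :
    elemSpan s ^ N ≤ (elemSpan (insert l s) ^ N).map (leadCoeff l N) := by
  induction N with
  | zero =>
    rw [pow_zero, pow_zero, Submodule.one_le]
    refine ⟨1, Submodule.one_le.1 le_rfl, ?_⟩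
    ext m
    rw [coeff_leadCoeff, Finsupp.single_zero, add_zero, coeff_one, ite_eq_left_iff]
    intro h
    rw [if_neg]
    rintro rfl
    exact h rfl
  | succ N ih =>
    rw [pow_succ', Submodule.mul_le]
    intro p hp q hq
    obtain ⟨g, hg, rfl⟩ := ih hq
    have key : elemSpan s ≤ Submodule.comap (LinearMap.mulRight ℂ (leadCoeff l N g))
        ((elemSpan (insert l s) ^ (N + 1)).map (leadCoeff l (N + 1))) := by
      refine Submodule.span_le.2 ?_
      rintro _ ⟨r, rfl⟩
      have h0 : ∀ r, degreeOf l (elemCoeff s r) = 0 := fun r =>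
        degreeOf_eq_zero_of_mem_box (elemCoeff_mem_box s r) hl
      refine ⟨-elemCoeff (insert l s) (r + 1) * g, ?_, ?_⟩
      · rw [pow_succ']
        exact Submodule.mul_mem_mul (neg_mem (Submodule.subset_span ⟨_, rfl⟩)) hg
      · have hdeg : degreeOf l g < N + 1 := Nat.lt_succ_of_le
          (degreeOf_le_of_mem_box (elemSpan_pow_le_box _ _ hg) l)
        have : -elemCoeff (insert l s) (r + 1) * g
            = elemCoeff s r * (X l * g) - elemCoeff s (r + 1) * g := by
          rw [elemCoeff_insert_succ hl]; ring
        rw [this, map_sub, leadCoeff_mul _ (h0 _), leadCoeff_mul _ (h0 _), leadCoeff_X_mul_self,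
          leadCoeff_eq_zero hdeg]
        simp
    exact key hp

lemma symBox_le_elemSpan_pow (s : Finset ι) (N : ℕ) : symBox s N ≤ elemSpan s ^ N := by
  induction s using Finset.induction generalizing N with
  | empty =>
    intro f hf
    rw [eq_C_of_mem_symBox_empty hf]
    have h1 : (1 : MvPolynomial ι ℂ) ∈ elemSpan (∅ : Finset ι) ^ N := by
      have := Submodule.pow_mem_pow _ (Submodule.one_le.1 (one_le_elemSpan (∅ : Finset ι))) N
      rwa [one_pow] at this
    simpa [C_eq_smul_one] using Submodule.smul_mem _ (constantCoeff f) h1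
  | insert l s hl ih =>
    induction N with
    | zero =>
      intro f hf
      rw [eq_C_of_mem_symBox_zero hf, pow_zero]
      exact Submodule.mem_one.2 ⟨_, rfl⟩
    | succ N ihN =>
      intro f hf
      obtain ⟨g, hg, hgf⟩ := elemSpan_pow_le_map_leadCoeff hl (N + 1)
        (ih (N + 1) (leadCoeff_mem_symBox hl hf))
      have h1 : f - g ∈ symBox (insert l s) N :=
        mem_symBox_sub_one_of_leadCoeff (Finset.mem_insert_self l s)
          (sub_mem hf (elemSpan_pow_le_symBox _ _ hg)) (by rw [map_sub, hgf, sub_self])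
      have h2 : f - g ∈ elemSpan (insert l s) ^ (N + 1) := by
        have := Submodule.mul_mem_mul (ihN h1) (Submodule.one_le.1 (one_le_elemSpan (insert l s)))
        rwa [mul_one, ← pow_succ] at this
      simpa using add_mem h2 hg

lemma symBox_eq (s : Finset ι) (N : ℕ) : symBox s N = elemSpan s ^ N :=
  le_antisymm (symBox_le_elemSpan_pow s N) (elemSpan_pow_le_symBox s N)

lemma map_leadCoeff_symBox (hl : l ∉ s) (N : ℕ) :
    (symBox (insert l s) N).map (leadCoeff l N) = symBox s N := by
  refine le_antisymm ?_ ?_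
  · rintro _ ⟨f, hf, rfl⟩
    exact leadCoeff_mem_symBox hl hf
  · rw [symBox_eq s, symBox_eq (insert l s)]
    exact elemSpan_pow_le_map_leadCoeff hl N

instance finiteDimensional_box (s : Finset ι) (N : ℕ) : FiniteDimensional ℂ (box s N) := by
  have hfin : (Set.Iic (∑ i ∈ s, Finsupp.single i N)).Finite := Set.finite_Iic _
  have := FiniteDimensional.span_of_finite ℂ (hfin.image fun m => (monomial m (1 : ℂ)))
  refine Submodule.finiteDimensional_of_le (S₂ := Submodule.span ℂ
    ((fun m => (monomial m (1 : ℂ))) '' Set.Iic (∑ i ∈ s, Finsupp.single i N))) fun f hf => ?_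
  rw [f.as_sum]
  refine Submodule.sum_mem _ fun m hm => ?_
  rw [← mul_one (coeff m f), ← smul_eq_mul, ← smul_monomial]
  refine Submodule.smul_mem _ _ (Submodule.subset_span ⟨m, fun k => ?_, rfl⟩)
  rw [Finsupp.finsetSum_apply]
  have := (monomial_le_degreeOf k hm).trans (hf k)
  simpa [Finsupp.single_apply] using this

instance finiteDimensional_symBox (s : Finset ι) (N : ℕ) : FiniteDimensional ℂ (symBox s N) :=
  Submodule.finiteDimensional_of_le (inf_le_left : symBox s N ≤ box s N)

end SymmetricSpaces

section Dimension

variable {V : Type*} [AddCommGroup V] [Module ℂ V]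

lemma finrank_map_add_finrank_inf_ker (M : Submodule ℂ V) [FiniteDimensional ℂ M]
    (f : V →ₗ[ℂ] V) :
    Module.finrank ℂ (M.map f) + Module.finrank ℂ (M ⊓ LinearMap.ker f : Submodule ℂ V)
      = Module.finrank ℂ M := by
  rw [← LinearMap.finrank_range_add_finrank_ker (f.domRestrict M), LinearMap.range_domRestrict,
    LinearMap.ker_domRestrict]
  congr 1
  rw [← Submodule.map_comap_subtype]
  exact (Submodule.equivMapOfInjective M.subtype M.injective_subtype
    ((LinearMap.ker f).comap M.subtype)).finrank_eq.symm

lemma finrank_le_mul_of_map_pow_eq_bot (M : Submodule ℂ V) [FiniteDimensional ℂ M]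
    (f : V →ₗ[ℂ] V) (hf : M.map f ≤ M) (k : ℕ) (hk : M.map (f ^ k) = ⊥) :
    Module.finrank ℂ M ≤ k * Module.finrank ℂ (M ⊓ LinearMap.ker f : Submodule ℂ V) := by
  have hle : ∀ j, M.map (f ^ j) ≤ M := by
    intro j
    induction j with
    | zero => simp [Module.End.one_eq_id]
    | succ j ih =>
      rw [pow_succ', Module.End.mul_eq_comp, Submodule.map_comp]
      exact (Submodule.map_mono ih).trans hf
  have key : ∀ j, Module.finrank ℂ M ≤ Module.finrank ℂ (M.map (f ^ j))
      + j * Module.finrank ℂ (M ⊓ LinearMap.ker f : Submodule ℂ V) := by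
    intro j
    induction j with
    | zero =>
      have h0 : M.map (f ^ 0) = M := by simp [Module.End.one_eq_id]
      rw [h0, zero_mul, add_zero]
    | succ j ih =>
      have := Submodule.finiteDimensional_of_le (hle j)
      have h1 := finrank_map_add_finrank_inf_ker (M.map (f ^ j)) f
      rw [← Submodule.map_comp, ← Module.End.mul_eq_comp, ← pow_succ'] at h1
      have h2 := Submodule.finrank_mono (inf_le_inf_right (LinearMap.ker f) (hle j))
      rw [add_mul, one_mul]
      omega
  have := key k
  rwa [hk, finrank_bot, zero_add] at this

variable {ι : Type*} [DecidableEq ι]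

lemma finrank_symBox_eq_one (s : Finset ι) (N : ℕ)
    (h : ∀ f ∈ symBox s N, f = C (constantCoeff f)) :
    Module.finrank ℂ (symBox s N) = 1 := by
  have : symBox s N = Submodule.span ℂ {1} := by
    refine le_antisymm (fun f hf => ?_) ?_
    · rw [h f hf, C_eq_smul_one]
      exact Submodule.smul_mem _ _ (Submodule.mem_span_singleton_self 1)
    · rw [Submodule.span_singleton_le_iff_mem]
      exact C_mem_symBox 1
  rw [this, finrank_span_singleton one_ne_zero]

lemma symBox_insert_inf_ker_leadCoeff {l : ι} (s : Finset ι) (N : ℕ) :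
    symBox (insert l s) (N + 1) ⊓ LinearMap.ker (leadCoeff l (N + 1)) = symBox (insert l s) N := by
  refine le_antisymm ?_ ?_
  · rintro f ⟨hf, hf0⟩
    exact mem_symBox_sub_one_of_leadCoeff (Finset.mem_insert_self l s) hf hf0
  · intro f hf
    exact ⟨symBox_mono (Nat.le_succ N) hf, leadCoeff_eq_zero
      (Nat.lt_succ_of_le (degreeOf_le_of_mem_box (mem_symBox.1 hf).1 l))⟩

lemma finrank_symBox (s : Finset ι) (N : ℕ) :
    Module.finrank ℂ (symBox s N) = (N + s.card).choose s.card := by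
  induction s using Finset.induction generalizing N with
  | empty => simpa using finrank_symBox_eq_one ∅ N fun f hf => eq_C_of_mem_symBox_empty hf
  | insert l s hl ih =>
    rw [Finset.card_insert_of_notMem hl]
    induction N with
    | zero => simpa using finrank_symBox_eq_one (insert l s) 0 fun f hf => eq_C_of_mem_symBox_zero hf
    | succ N ihN =>
      rw [← finrank_map_add_finrank_inf_ker _ (leadCoeff l (N + 1)), map_leadCoeff_symBox hl,
        symBox_insert_inf_ker_leadCoeff, ih, ihN]
      rw [show N + 1 + (s.card + 1) = (N + (s.card + 1)) + 1 by ring, Nat.choose_succ_succ',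
        show N + 1 + s.card = N + (s.card + 1) by ring]

end Dimension

section Series

/-- Power series in one variable `z` over a polynomial ring. -/
abbrev PolySeries (ι : Type*) := PowerSeries (MvPolynomial ι ℂ)

variable {ι : Type*}

/-- Apply a linear map to every coefficient of a power series. -/
noncomputable def coeffwise (D : MvPolynomial ι ℂ →ₗ[ℂ] MvPolynomial ι ℂ)
    (F : PolySeries ι) : PolySeries ι :=
  PowerSeries.mk fun n => D (PowerSeries.coeff n F)

@[simp] lemma coeff_coeffwise (D : MvPolynomial ι ℂ →ₗ[ℂ] MvPolynomial ι ℂ)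
    (F : PolySeries ι) (n : ℕ) :
    PowerSeries.coeff n (coeffwise D F) = D (PowerSeries.coeff n F) :=
  PowerSeries.coeff_mk _ _

lemma coeffwise_sub (D : MvPolynomial ι ℂ →ₗ[ℂ] MvPolynomial ι ℂ)
    (F G : PolySeries ι) :
    coeffwise D (F - G) = coeffwise D F - coeffwise D G := by
  ext1 n; simp

lemma coeffwise_natCast_mul (D : MvPolynomial ι ℂ →ₗ[ℂ] MvPolynomial ι ℂ) (m : ℕ)
    (F : PolySeries ι) : coeffwise D (m * F) = m * coeffwise D F := by
  ext1 n
  simp [← nsmul_eq_mul]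

lemma coeffwise_X_mul (D : MvPolynomial ι ℂ →ₗ[ℂ] MvPolynomial ι ℂ)
    (F : PolySeries ι) :
    coeffwise D (PowerSeries.X * F) = PowerSeries.X * coeffwise D F := by
  ext1 n
  cases n <;> simp [PowerSeries.coeff_zero_X_mul, PowerSeries.coeff_succ_X_mul]

lemma coeffwise_mul {D : MvPolynomial ι ℂ →ₗ[ℂ] MvPolynomial ι ℂ}
    {σ : MvPolynomial ι ℂ →+* MvPolynomial ι ℂ} (h : ∀ f g, D (f * g) = D f * g + σ f * D g)
    (F G : PolySeries ι) :
    coeffwise D (F * G) = coeffwise D F * G + PowerSeries.map σ F * coeffwise D G := by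
  ext1 n
  simp [PowerSeries.coeff_mul, h, Finset.sum_add_distrib]

lemma coeffwise_pderiv_mul (i : ι) (F G : PolySeries ι) :
    coeffwise (pderiv i).toLinearMap (F * G)
      = coeffwise (pderiv i).toLinearMap F * G + F * coeffwise (pderiv i).toLinearMap G := by
  have := coeffwise_mul (D := (pderiv i).toLinearMap) (σ := RingHom.id _)
    (fun f g => by simp [mul_comm, add_comm]) F G
  simpa using this

/-- The power series `∏_{i ∈ s} (1 - x_i z)`. -/
noncomputable def genSeries (s : Finset ι) : PolySeries ι :=
  (genPoly s : Polynomial (MvPolynomial ι ℂ))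

/-- The geometric series `(1 - x_i z)⁻¹`. -/
noncomputable def geomSeries (i : ι) : PolySeries ι :=
  PowerSeries.mk fun n => X i ^ n

/-- The series `-log ∏_{i ∈ s} (1 - x_i z)`. -/
noncomputable def logSeries (s : Finset ι) : PolySeries ι :=
  PowerSeries.mk fun n => C ((n : ℂ)⁻¹) * ∑ i ∈ s, X i ^ n

@[simp] lemma coeff_geomSeries (i : ι) (n : ℕ) :
    PowerSeries.coeff n (geomSeries i) = (X i ^ n : MvPolynomial ι ℂ) :=
  PowerSeries.coeff_mk _ _

@[simp] lemma coeff_logSeries (s : Finset ι) (n : ℕ) :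
    PowerSeries.coeff n (logSeries s)
      = (C ((n : ℂ)⁻¹) * ∑ i ∈ s, X i ^ n : MvPolynomial ι ℂ) :=
  PowerSeries.coeff_mk _ _

lemma coeff_genSeries (s : Finset ι) (n : ℕ) :
    PowerSeries.coeff n (genSeries s) = elemCoeff s n := by
  simp [genSeries, elemCoeff]

lemma genSeries_eq_prod (s : Finset ι) :
    genSeries s = ∏ i ∈ s, (1 - PowerSeries.C (X i) * PowerSeries.X) := by
  simp only [genSeries, genPoly]
  rw [← Polynomial.coeToPowerSeries.ringHom_apply, map_prod]
  simp

/-- `x_i z / (1 - x_i z) = 1 / (1 - x_i z) - 1`. -/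
lemma C_mul_X_mul_geomSeries (i : ι) :
    PowerSeries.C (X i) * (PowerSeries.X * geomSeries i)
      = (geomSeries i - 1 : PolySeries ι) := by
  ext1 n
  cases n with
  | zero => rw [PowerSeries.coeff_C_mul, map_sub, coeff_geomSeries]; simp
  | succ n => simp [PowerSeries.coeff_succ_X_mul, PowerSeries.coeff_one, pow_succ']

lemma one_sub_mul_geomSeries (i : ι) :
    (1 - PowerSeries.C (X i) * PowerSeries.X) * geomSeries i
      = (1 : PolySeries ι) := by
  linear_combination -C_mul_X_mul_geomSeries i

variable [DecidableEq ι]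

lemma genSeries_insert {l : ι} {s : Finset ι} (hl : l ∉ s) :
    genSeries (insert l s) = (1 - PowerSeries.C (X l) * PowerSeries.X) * genSeries s := by
  rw [genSeries_eq_prod, genSeries_eq_prod, Finset.prod_insert hl]

lemma coeffwise_pderiv_one_sub (i l : ι) :
    coeffwise (pderiv i).toLinearMap (1 - PowerSeries.C (X l) * PowerSeries.X)
      = if i = l then -PowerSeries.X else 0 := by
  ext1 n
  rw [mul_comm]
  rcases n with _ | _ | n <;> by_cases h : i = l <;>
    simp [h, PowerSeries.coeff_one, PowerSeries.coeff_X, Ne.symm, eq_comm]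

lemma coeffwise_pderiv_genSeries_of_notMem {i : ι} {s : Finset ι} (hi : i ∉ s) :
    coeffwise (pderiv i).toLinearMap (genSeries s) = 0 := by
  induction s using Finset.induction with
  | empty => ext1 n; by_cases h : n = 0 <;> simp [genSeries_eq_prod, PowerSeries.coeff_one, h]
  | insert l s hl ih =>
    rw [Finset.mem_insert, not_or] at hi
    rw [genSeries_insert hl, coeffwise_pderiv_mul, ih hi.2, coeffwise_pderiv_one_sub,
      if_neg hi.1]
    simp

lemma coeffwise_pderiv_genSeries {i : ι} {s : Finset ι} (hi : i ∈ s) :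
    coeffwise (pderiv i).toLinearMap (genSeries s)
      = -(PowerSeries.X * geomSeries i * genSeries s) := by
  obtain ⟨t, ht, rfl⟩ : ∃ t, i ∉ t ∧ s = insert i t :=
    ⟨s.erase i, Finset.notMem_erase _ _, (Finset.insert_erase hi).symm⟩
  rw [genSeries_insert ht, coeffwise_pderiv_mul, coeffwise_pderiv_genSeries_of_notMem ht,
    coeffwise_pderiv_one_sub, if_pos rfl]
  linear_combination (PowerSeries.X * genSeries t) * one_sub_mul_geomSeries i

lemma coeffwise_pderiv_genSeries_pow {i : ι} {s : Finset ι} (hi : i ∈ s) (a : ℕ) :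
    coeffwise (pderiv i).toLinearMap (genSeries s ^ a)
      = -((a : PolySeries ι) * (PowerSeries.X * geomSeries i * genSeries s ^ a)) := by
  induction a with
  | zero => ext1 n; by_cases h : n = 0 <;> simp [PowerSeries.coeff_one, h]
  | succ a ih =>
    rw [pow_succ, coeffwise_pderiv_mul, ih, coeffwise_pderiv_genSeries hi]
    push_cast
    ring

lemma coeffwise_pderiv_logSeries {i : ι} {s : Finset ι} (hi : i ∈ s) :
    coeffwise (pderiv i).toLinearMap (logSeries s) = PowerSeries.X * geomSeries i := by
  ext1 n
  cases n with
  | zero => simp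
  | succ n =>
    simp only [coeff_coeffwise, coeff_logSeries, PowerSeries.coeff_succ_X_mul, coeff_geomSeries]
    rw [← smul_eq_C_mul, map_smul, map_sum, Finset.sum_eq_single i]
    · have : ((n + 1 : ℕ) : ℂ) ≠ 0 := by exact_mod_cast n.succ_ne_zero
      have h1 : ((n + 1 : ℕ) : MvPolynomial ι ℂ) = C ((n + 1 : ℕ) : ℂ) := by simp
      rw [Derivation.coeFn_coe, Derivation.leibniz_pow,
        pderiv_X_self, nsmul_eq_mul, h1, smul_eq_C_mul, ← mul_assoc, ← C_mul, inv_mul_cancel₀ this]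
      simp
    · intro j _ hj
      simp [pderiv_X_of_ne hj]
    · exact fun h => (h hi).elim

lemma coeffwise_pderiv_geomSeries {i j : ι} (h : i ≠ j) :
    coeffwise (pderiv j).toLinearMap (geomSeries i) = 0 := by
  ext1 n
  simp [pderiv_X_of_ne h]

lemma map_swapVar_genSeries {s : Finset ι} {i j : ι} (hi : i ∈ s) (hj : j ∈ s) :
    PowerSeries.map (swapVar i j : MvPolynomial ι ℂ →+* MvPolynomial ι ℂ) (genSeries s)
      = genSeries s := by
  ext1 n
  simp [coeff_genSeries, swapVar_elemCoeff hi hj]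

lemma map_swapVar_logSeries {s : Finset ι} {i j : ι} (hi : i ∈ s) (hj : j ∈ s) :
    PowerSeries.map (swapVar i j : MvPolynomial ι ℂ →+* MvPolynomial ι ℂ) (logSeries s)
      = logSeries s := by
  ext1 n
  have : ∑ k ∈ s, (X (Equiv.swap i j k) : MvPolynomial ι ℂ) ^ n = ∑ k ∈ s, X k ^ n :=
    prod_swap_eq (M := Multiplicative (MvPolynomial ι ℂ)) hi hj fun k => X k ^ n
  simp [swapVar_X, this, MvPolynomial.algHom_C]

lemma coeffwise_divDiff_geomSeries {i j : ι} (h : i ≠ j) :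
    coeffwise (divDiff j i) (geomSeries i)
      = -(PowerSeries.X * geomSeries i * geomSeries j) := by
  ext1 n
  rw [coeff_coeffwise]
  refine divDiff_eq h.symm ?_
  rw [← PowerSeries.coeff_C_mul, coeff_geomSeries, map_pow, swapVar_X, Equiv.swap_apply_right,
    ← coeff_geomSeries, ← coeff_geomSeries, ← map_sub]
  congr 1
  rw [map_sub]
  linear_combination geomSeries j * C_mul_X_mul_geomSeries i
    - geomSeries i * C_mul_X_mul_geomSeries j

lemma coeffwise_divDiff_geomSeries_of_ne {i j k : ι} (hj : i ≠ j) (hk : i ≠ k) :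
    coeffwise (divDiff j k) (geomSeries i) = 0 := by
  ext1 n
  simp only [coeff_coeffwise, coeff_geomSeries, map_zero]
  refine divDiff_of_swapVar_eq _ _ ?_
  rw [map_pow, swapVar_X, Equiv.swap_apply_of_ne_of_ne hj hk]

variable {s : Finset ι} (a : ℕ)

lemma coeffwise_dunkl {i : ι} (hi : i ∈ s) (F : PolySeries ι) :
    coeffwise (dunkl a s i) F = coeffwise (pderiv i).toLinearMap F
      - (a : PolySeries ι) * ∑ j ∈ s, coeffwise (divDiff i j) F := by
  ext1 n
  rw [← nsmul_eq_mul, map_sub, map_nsmul, map_sum]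
  simp [dunkl_apply hi, Nat.cast_smul_eq_nsmul]

lemma coeffwise_divDiff_of_symm {i j : ι} {F : PolySeries ι}
    (h : PowerSeries.map (swapVar i j : MvPolynomial ι ℂ →+* MvPolynomial ι ℂ) F = F) :
    coeffwise (divDiff i j) F = 0 := by
  ext1 n
  refine divDiff_of_swapVar_eq _ _ ?_
  conv_rhs => rw [← h, PowerSeries.coeff_map]
  rfl

lemma coeffwise_dunkl_of_symm {i : ι} (hi : i ∈ s) {F : PolySeries ι}
    (h : ∀ j ∈ s, PowerSeries.map (swapVar i j : MvPolynomial ι ℂ →+* MvPolynomial ι ℂ) F = F) :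
    coeffwise (dunkl a s i) F = coeffwise (pderiv i).toLinearMap F := by
  rw [coeffwise_dunkl a hi, Finset.sum_eq_zero fun j hj => coeffwise_divDiff_of_symm (h j hj),
    mul_zero, sub_zero]

lemma coeffwise_dunkl_geomSeries_mul {i j : ι} (hi : i ∈ s) (hj : j ∈ s) (hij : i ≠ j)
    {H : PolySeries ι}
    (h : ∀ k ∈ s, PowerSeries.map (swapVar j k : MvPolynomial ι ℂ →+* MvPolynomial ι ℂ) H = H) :
    coeffwise (dunkl a s j) (geomSeries i * H) = geomSeries i *
      (coeffwise (pderiv j).toLinearMap H + (a : PolySeries ι) * (PowerSeries.X * geomSeries j * H)) := by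
  have hdd : ∀ k ∈ s, coeffwise (divDiff j k) (geomSeries i * H)
      = if k = i then -(PowerSeries.X * geomSeries i * geomSeries j) * H else 0 := by
    intro k hk
    rw [coeffwise_mul (σ := (swapVar j k : MvPolynomial ι ℂ →+* MvPolynomial ι ℂ))
      (divDiff_mul j k), coeffwise_divDiff_of_symm (h k hk), mul_zero, add_zero]
    split_ifs with hki
    · rw [hki, coeffwise_divDiff_geomSeries hij]
    · rw [coeffwise_divDiff_geomSeries_of_ne hij (Ne.symm hki), zero_mul]
  rw [coeffwise_dunkl a hj, Finset.sum_congr rfl hdd, Finset.sum_ite_eq', if_pos hi,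
    coeffwise_pderiv_mul, coeffwise_pderiv_geomSeries hij]
  ring

lemma coeffwise_dunkl_genSeries_pow {i : ι} (hi : i ∈ s) :
    coeffwise (dunkl a s i) (genSeries s ^ a)
      = -(PowerSeries.X * (geomSeries i * ((a : PolySeries ι) * genSeries s ^ a))) := by
  rw [coeffwise_dunkl_of_symm a hi fun j hj => by rw [map_pow, map_swapVar_genSeries hi hj],
    coeffwise_pderiv_genSeries_pow hi]
  ring

lemma coeffwise_dunkl_genSeries_pow_mul_logSeries {i : ι} (hi : i ∈ s) :
    coeffwise (dunkl a s i) (genSeries s ^ a * logSeries s)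
      = PowerSeries.X * (geomSeries i *
        (genSeries s ^ a - (a : PolySeries ι) * (genSeries s ^ a * logSeries s))) := by
  rw [coeffwise_dunkl_of_symm a hi fun j hj => by
      rw [map_mul, map_pow, map_swapVar_genSeries hi hj, map_swapVar_logSeries hi hj],
    coeffwise_pderiv_mul, coeffwise_pderiv_genSeries_pow hi, coeffwise_pderiv_logSeries hi]
  ring

lemma coeffwise_neg (D : MvPolynomial ι ℂ →ₗ[ℂ] MvPolynomial ι ℂ)
    (F : PolySeries ι) : coeffwise D (-F) = -coeffwise D F := by
  ext1 n; simp

lemma coeffwise_dunkl_dunkl_genSeries_pow {i j : ι} (hi : i ∈ s) (hj : j ∈ s) (hij : i ≠ j) :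
    coeffwise (dunkl a s j) (coeffwise (dunkl a s i) (genSeries s ^ a)) = 0 := by
  rw [coeffwise_dunkl_genSeries_pow a hi, coeffwise_neg, coeffwise_X_mul,
    coeffwise_dunkl_geomSeries_mul a hi hj hij fun k hk => by
      rw [map_mul, map_pow, map_natCast, map_swapVar_genSeries hj hk],
    coeffwise_natCast_mul, coeffwise_pderiv_genSeries_pow hj]
  ring

lemma coeffwise_dunkl_dunkl_genSeries_pow_mul_logSeries {i j : ι} (hi : i ∈ s) (hj : j ∈ s)
    (hij : i ≠ j) :
    coeffwise (dunkl a s j) (coeffwise (dunkl a s i) (genSeries s ^ a * logSeries s))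
      = -((a : PolySeries ι) * (PowerSeries.X ^ 2 * geomSeries i * geomSeries j * genSeries s ^ a)) := by
  rw [coeffwise_dunkl_genSeries_pow_mul_logSeries a hi, coeffwise_X_mul,
    coeffwise_dunkl_geomSeries_mul a hi hj hij fun k hk => by
      rw [map_sub, map_mul, map_mul, map_pow, map_natCast, map_swapVar_genSeries hj hk,
        map_swapVar_logSeries hj hk],
    coeffwise_sub, coeffwise_natCast_mul, coeffwise_pderiv_mul, coeffwise_pderiv_genSeries_pow hj,
    coeffwise_pderiv_logSeries hj]
  ring

lemma derivative_genSeries (s : Finset ι) : PowerSeries.derivative (MvPolynomial ι ℂ) (genSeries s)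
    = -((∑ i ∈ s, PowerSeries.C (X i) * geomSeries i) * genSeries s) := by
  induction s using Finset.induction with
  | empty => simp [genSeries_eq_prod]
  | insert l s hl ih =>
    rw [genSeries_insert hl, Derivation.leibniz, ih, Finset.sum_insert hl, map_sub,
      Derivation.leibniz]
    simp only [smul_eq_mul, PowerSeries.derivative_X, PowerSeries.derivative_C,
      PowerSeries.derivative_one]
    linear_combination (PowerSeries.C (X l) * genSeries s) * one_sub_mul_geomSeries l

lemma derivative_logSeries (s : Finset ι) : PowerSeries.derivative (MvPolynomial ι ℂ) (logSeries s)
    = ∑ i ∈ s, PowerSeries.C (X i) * geomSeries i := by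
  ext1 n
  have : ((n + 1 : ℕ) : ℂ) ≠ 0 := by exact_mod_cast n.succ_ne_zero
  have h1 : ((n : MvPolynomial ι ℂ) + 1) = C ((n + 1 : ℕ) : ℂ) := by simp
  rw [PowerSeries.coeff_derivative, coeff_logSeries, map_sum, h1, mul_right_comm, ← C_mul,
    inv_mul_cancel₀ this]
  simp [pow_succ']

lemma X_mul_sum_geomSeries (s : Finset ι) :
    PowerSeries.X * ∑ i ∈ s, PowerSeries.C (X i) * geomSeries i
      = ∑ i ∈ s, geomSeries i - (s.card : PolySeries ι) := by
  rw [Finset.mul_sum, Finset.sum_congr rfl fun i _ => (by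
    linear_combination C_mul_X_mul_geomSeries i : PowerSeries.X * (PowerSeries.C (X i) *
      geomSeries i) = (geomSeries i - 1 : PolySeries ι))]
  simp

lemma derivative_genSeries_pow (s : Finset ι) :
    PowerSeries.derivative (MvPolynomial ι ℂ) (genSeries s ^ a)
    = -((a : PolySeries ι) * ((∑ i ∈ s, PowerSeries.C (X i) * geomSeries i) * genSeries s ^ a)) := by
  rcases a with _ | a
  · simp
  · rw [PowerSeries.derivative_pow, derivative_genSeries, Nat.add_sub_cancel]
    push_cast
    ring

lemma sum_coeffwise_dunkl_genSeries_pow :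
    ∑ i ∈ s, coeffwise (dunkl a s i) (genSeries s ^ a) = PowerSeries.X *
      (PowerSeries.X * PowerSeries.derivative (MvPolynomial ι ℂ) (genSeries s ^ a)
        - ((a * s.card : ℕ) : PolySeries ι) * genSeries s ^ a) := by
  rw [Finset.sum_congr rfl fun i hi => coeffwise_dunkl_genSeries_pow a hi, derivative_genSeries_pow,
    Finset.sum_neg_distrib, ← Finset.mul_sum, ← Finset.sum_mul]
  push_cast
  linear_combination (PowerSeries.X * (a : PolySeries ι) * genSeries s ^ a) * X_mul_sum_geomSeries s

lemma sum_coeffwise_dunkl_genSeries_pow_mul_logSeries :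
    ∑ i ∈ s, coeffwise (dunkl a s i) (genSeries s ^ a * logSeries s) = PowerSeries.X *
      (PowerSeries.X * PowerSeries.derivative (MvPolynomial ι ℂ) (genSeries s ^ a * logSeries s)
        - ((a * s.card : ℕ) : PolySeries ι) * (genSeries s ^ a * logSeries s) + (s.card : PolySeries ι) * genSeries s ^ a) := by
  rw [Finset.sum_congr rfl fun i hi => coeffwise_dunkl_genSeries_pow_mul_logSeries a hi,
    Derivation.leibniz, derivative_genSeries_pow, derivative_logSeries,
    ← Finset.mul_sum, ← Finset.sum_mul, smul_eq_mul, smul_eq_mul]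
  push_cast
  linear_combination (PowerSeries.X * ((a : PolySeries ι) * genSeries s ^ a * logSeries s - genSeries s ^ a))
    * X_mul_sum_geomSeries s

/-- The differential equation of `z ↦ G ^ a * log G`. -/
lemma genSeries_mul_derivative :
    genSeries s * PowerSeries.derivative (MvPolynomial ι ℂ) (genSeries s ^ a * logSeries s)
      - (a : PolySeries ι) * (PowerSeries.derivative (MvPolynomial ι ℂ) (genSeries s)
        * (genSeries s ^ a * logSeries s))
      = -(genSeries s ^ a * PowerSeries.derivative (MvPolynomial ι ℂ) (genSeries s)) := by
  rw [Derivation.leibniz, derivative_genSeries_pow, derivative_logSeries, derivative_genSeries,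
    smul_eq_mul, smul_eq_mul]
  ring

end Series

section Detectors

variable {ι : Type*} [DecidableEq ι] (a : ℕ) (s : Finset ι)

/-- The coefficients of `G ^ a * log G`, up to sign. -/
noncomputable def logCoeff (n : ℕ) : MvPolynomial ι ℂ :=
  PowerSeries.coeff n (genSeries s ^ a * logSeries s)

/-- A symmetric polynomial of degree `n` whose Dunkl pairing only sees pure powers `x_i ^ n`. -/
noncomputable def detector (n : ℕ) : MvPolynomial ι ℂ :=
  if n ≤ a * s.card then PowerSeries.coeff n (genSeries s ^ a) else logCoeff a s n

lemma detector_of_lt {n : ℕ} (h : a * s.card < n) : detector a s n = logCoeff a s n :=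
  if_neg h.not_ge

variable {s}

lemma coeff_genSeries_pow_eq_zero {n : ℕ} (h : a * s.card < n) :
    PowerSeries.coeff n (genSeries s ^ a) = 0 := by
  rw [genSeries, ← Polynomial.coe_pow, Polynomial.coeff_coe]
  refine Polynomial.coeff_eq_zero_of_natDegree_lt (lt_of_le_of_lt ?_ h)
  exact Polynomial.natDegree_pow_le.trans (Nat.mul_le_mul_left _ (natDegree_genPoly_le s))

lemma coeff_X_sq_mul_eq_zero {i j : ι} (hi : i ∈ s) (hj : j ∈ s) (hij : i ≠ j) (ha : 1 ≤ a) {n : ℕ}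
    (h : a * s.card < n) : PowerSeries.coeff n
      (PowerSeries.X ^ 2 * geomSeries i * geomSeries j * genSeries s ^ a) = 0 := by
  obtain ⟨a, rfl⟩ := Nat.exists_eq_add_of_le' ha
  obtain ⟨t, ht, rfl⟩ : ∃ t, j ∉ t ∧ s = insert j t :=
    ⟨s.erase j, Finset.notMem_erase _ _, (Finset.insert_erase hj).symm⟩
  obtain ⟨t, ht', rfl⟩ : ∃ u, i ∉ u ∧ t = insert i u :=
    ⟨t.erase i, Finset.notMem_erase _ _,
      (Finset.insert_erase (Finset.mem_of_mem_insert_of_ne hi hij)).symm⟩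
  set s := insert j (insert i t)
  have hs : genSeries s = (1 - PowerSeries.C (X j) * PowerSeries.X) *
      ((1 - PowerSeries.C (X i) * PowerSeries.X) * genSeries t) := by
    rw [genSeries_insert ht, genSeries_insert ht']
  have hcard : s.card = t.card + 2 := by
    rw [Finset.card_insert_of_notMem ht, Finset.card_insert_of_notMem ht']
  have : PowerSeries.X ^ 2 * geomSeries i * geomSeries j * genSeries s ^ (a + 1)
      = ((Polynomial.X ^ 2 * genPoly t * genPoly s ^ a : Polynomial (MvPolynomial ι ℂ)) :
        PolySeries ι) := by
    have h1 := one_sub_mul_geomSeries i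
    have h2 := one_sub_mul_geomSeries j
    have : (geomSeries i * geomSeries j * genSeries s : PolySeries ι) = genSeries t := by
      rw [hs]
      linear_combination ((1 - PowerSeries.C (X j) * PowerSeries.X) * geomSeries j
        * genSeries t) * h1 + genSeries t * h2
    rw [pow_succ]
    simp only [Polynomial.coe_mul, Polynomial.coe_pow, Polynomial.coe_X]
    change _ = PowerSeries.X ^ 2 * genSeries t * genSeries s ^ a
    linear_combination (PowerSeries.X ^ 2 * genSeries s ^ a) * this
  rw [this, Polynomial.coeff_coe]
  refine Polynomial.coeff_eq_zero_of_natDegree_lt (lt_of_le_of_lt ?_ h)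
  refine Polynomial.natDegree_mul_le.trans
    ((Nat.add_le_add (Polynomial.natDegree_mul_le.trans (Nat.add_le_add
      (Polynomial.natDegree_X_pow_le 2) (natDegree_genPoly_le t)))
      (Polynomial.natDegree_pow_le.trans (Nat.mul_le_mul_left a (natDegree_genPoly_le s)))).trans ?_)
  rw [hcard]
  linarith

lemma dunkl_dunkl_detector {i j : ι} (hi : i ∈ s) (hj : j ∈ s) (hij : i ≠ j) (n : ℕ) :
    dunkl a s j (dunkl a s i (detector a s n)) = 0 := by
  rw [detector]
  split_ifs with h
  · have := congrArg (PowerSeries.coeff n) (coeffwise_dunkl_dunkl_genSeries_pow a hi hj hij)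
    simpa using this
  · have := congrArg (PowerSeries.coeff n)
      (coeffwise_dunkl_dunkl_genSeries_pow_mul_logSeries a hi hj hij)
    rw [coeff_coeffwise, coeff_coeffwise] at this
    rw [logCoeff, this, map_neg, ← nsmul_eq_mul, map_nsmul]
    rcases Nat.eq_zero_or_pos a with rfl | ha
    · simp
    · rw [coeff_X_sq_mul_eq_zero a hi hj hij ha (not_le.1 h)]
      simp

lemma sum_dunkl_coeff_genSeries_pow (n : ℕ) :
    ∑ i ∈ s, dunkl a s i (PowerSeries.coeff (n + 1) (genSeries s ^ a))
      = ((n : ℂ) - (a * s.card : ℕ)) • PowerSeries.coeff n (genSeries s ^ a) := by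
  have := congrArg (PowerSeries.coeff (n + 1)) (sum_coeffwise_dunkl_genSeries_pow (s := s) a)
  rw [map_sum, PowerSeries.coeff_succ_X_mul, map_sub, ← nsmul_eq_mul, map_nsmul] at this
  simp only [coeff_coeffwise] at this
  rw [this, sub_smul, Nat.cast_smul_eq_nsmul, Nat.cast_smul_eq_nsmul]
  congr 1
  cases n with
  | zero => simp
  | succ n =>
    rw [PowerSeries.coeff_succ_X_mul, PowerSeries.coeff_derivative, nsmul_eq_mul]
    push_cast
    ring

lemma sum_dunkl_logCoeff (n : ℕ) :
    ∑ i ∈ s, dunkl a s i (logCoeff a s (n + 1))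
      = ((n : ℂ) - (a * s.card : ℕ)) • logCoeff a s n
        + (s.card : ℂ) • PowerSeries.coeff n (genSeries s ^ a) := by
  have := congrArg (PowerSeries.coeff (n + 1))
    (sum_coeffwise_dunkl_genSeries_pow_mul_logSeries (s := s) a)
  rw [map_sum, PowerSeries.coeff_succ_X_mul, map_add, map_sub, ← nsmul_eq_mul, map_nsmul,
    ← nsmul_eq_mul, map_nsmul] at this
  simp only [coeff_coeffwise] at this
  rw [logCoeff, this, sub_smul, Nat.cast_smul_eq_nsmul, Nat.cast_smul_eq_nsmul,
    Nat.cast_smul_eq_nsmul, logCoeff]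
  congr 2
  cases n with
  | zero => simp
  | succ n =>
    rw [PowerSeries.coeff_succ_X_mul, PowerSeries.coeff_derivative, nsmul_eq_mul]
    push_cast
    ring

lemma exists_sum_dunkl_detector (hs : s.Nonempty) (n : ℕ) : ∃ c : ℂ, c ≠ 0 ∧
    ∑ i ∈ s, dunkl a s i (detector a s (n + 1)) = c • detector a s n := by
  have hcard : (s.card : ℂ) ≠ 0 := by exact_mod_cast (Finset.card_pos.2 hs).ne'
  rcases lt_trichotomy n (a * s.card) with h | h | h
  · refine ⟨(n : ℂ) - (a * s.card : ℕ), ?_, ?_⟩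
    · rw [sub_ne_zero]; exact_mod_cast h.ne
    · rw [detector, detector, if_pos (Nat.succ_le_of_lt h), if_pos h.le, sum_dunkl_coeff_genSeries_pow]
  · refine ⟨s.card, hcard, ?_⟩
    rw [detector, detector, if_neg (by omega), if_pos h.le, sum_dunkl_logCoeff, h]
    simp
  · refine ⟨(n : ℂ) - (a * s.card : ℕ), ?_, ?_⟩
    · rw [sub_ne_zero]; exact_mod_cast h.ne'
    · rw [detector_of_lt a s h, detector_of_lt a s (by omega), sum_dunkl_logCoeff,
        coeff_genSeries_pow_eq_zero a h, smul_zero, add_zero]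

lemma detector_zero : detector a s 0 = 1 := by
  rw [detector, if_pos (Nat.zero_le _), PowerSeries.coeff_zero_eq_constantCoeff_apply, map_pow,
    ← PowerSeries.coeff_zero_eq_constantCoeff_apply, coeff_genSeries, elemCoeff_zero, one_pow]

/-- Scaling of all variables by `2`. -/
noncomputable def scaleTwo : MvPolynomial ι ℂ →ₐ[ℂ] MvPolynomial ι ℂ :=
  aeval fun i => C 2 * X i

@[simp] lemma scaleTwo_X (i : ι) : scaleTwo (X i) = (C 2 * X i : MvPolynomial ι ℂ) :=
  aeval_X _ _

lemma scaleTwo_C (c : ℂ) : scaleTwo (C c) = (C c : MvPolynomial ι ℂ) := aeval_C _ _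

lemma constantCoeff_scaleTwo (f : MvPolynomial ι ℂ) :
    constantCoeff (scaleTwo f) = constantCoeff f := by
  induction f using MvPolynomial.induction_on with
  | C c => rw [scaleTwo_C]
  | add p q hp hq => simp [hp, hq]
  | mul_X p i hp => simp

lemma scaleTwo_swapVar (i j : ι) (f : MvPolynomial ι ℂ) :
    scaleTwo (swapVar i j f) = swapVar i j (scaleTwo f) := by
  induction f using MvPolynomial.induction_on with
  | C c => simp [MvPolynomial.algHom_C]
  | add p q hp hq => simp [hp, hq]
  | mul_X p i hp => simp [hp, swapVar_X, MvPolynomial.algHom_C]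

lemma pderiv_scaleTwo (i : ι) (f : MvPolynomial ι ℂ) :
    pderiv i (scaleTwo f) = C 2 * scaleTwo (pderiv i f) := by
  induction f using MvPolynomial.induction_on with
  | C c => simp
  | add p q hp hq => simp [hp, hq, mul_add]
  | mul_X p j hp =>
    by_cases h : j = i
    · subst h
      simp [hp]
      ring
    · simp [hp, pderiv_X_of_ne h]
      ring

lemma divDiff_scaleTwo (i j : ι) (f : MvPolynomial ι ℂ) :
    divDiff i j (scaleTwo f) = C 2 * scaleTwo (divDiff i j f) := by
  by_cases h : i = j
  · simp [divDiff, h]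
  · refine divDiff_eq h ?_
    rw [← scaleTwo_swapVar, ← map_sub, ← divDiff_spec, map_mul, map_sub, scaleTwo_X, scaleTwo_X]
    ring

lemma dunkl_scaleTwo (i : ι) (f : MvPolynomial ι ℂ) :
    dunkl a s i (scaleTwo f) = (2 : ℂ) • scaleTwo (dunkl a s i f) := by
  by_cases hi : i ∈ s
  · simp only [dunkl_apply hi, pderiv_scaleTwo, divDiff_scaleTwo, map_sub, map_smul, map_sum,
      ← smul_eq_C_mul, ← Finset.smul_sum, smul_sub, smul_comm (2 : ℂ)]
  · simp [dunkl_of_notMem hi]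

lemma scaleTwo_elemCoeff (n : ℕ) : scaleTwo (elemCoeff s n) = C 2 ^ n * elemCoeff s n := by
  rw [elemCoeff_eq_sum, map_sum, Finset.mul_sum]
  refine Finset.sum_congr rfl fun A hA => ?_
  rw [map_prod, ← (Finset.mem_powersetCard.1 hA).2, ← Finset.prod_const, ← Finset.prod_mul_distrib]
  exact Finset.prod_congr rfl fun i _ => by simp

lemma map_scaleTwo_genSeries :
    PowerSeries.map ((scaleTwo : MvPolynomial ι ℂ →ₐ[ℂ] MvPolynomial ι ℂ) : MvPolynomial ι ℂ →+* MvPolynomial ι ℂ) (genSeries s)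
      = PowerSeries.rescale (C 2) (genSeries s) := by
  ext1 n
  simp [coeff_genSeries, scaleTwo_elemCoeff]

lemma map_scaleTwo_logSeries :
    PowerSeries.map ((scaleTwo : MvPolynomial ι ℂ →ₐ[ℂ] MvPolynomial ι ℂ) : MvPolynomial ι ℂ →+* MvPolynomial ι ℂ) (logSeries s)
      = PowerSeries.rescale (C 2) (logSeries s) := by
  ext1 n
  simp only [PowerSeries.coeff_map, coeff_logSeries, PowerSeries.coeff_rescale, RingHom.coe_coe,
    map_mul, map_sum, map_pow, scaleTwo_X, mul_pow, scaleTwo_C, ← Finset.mul_sum]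
  ring

lemma scaleTwo_detector (n : ℕ) :
    scaleTwo (detector a s n) = (2 : ℂ) ^ n • detector a s n := by
  have h (F : PolySeries ι) (hF : PowerSeries.map
      ((scaleTwo : MvPolynomial ι ℂ →ₐ[ℂ] MvPolynomial ι ℂ) : MvPolynomial ι ℂ →+* MvPolynomial ι ℂ) F = PowerSeries.rescale (C 2) F) :
      scaleTwo (PowerSeries.coeff n F) = (2 : ℂ) ^ n • PowerSeries.coeff n F := by
    have := congrArg (PowerSeries.coeff n) hF
    rwa [PowerSeries.coeff_map, PowerSeries.coeff_rescale, ← C_pow, ← smul_eq_C_mul] at this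
  rw [detector]
  split_ifs
  · exact h _ (by rw [map_pow, map_pow, map_scaleTwo_genSeries])
  · exact h _ (by
      rw [map_mul, map_mul, map_pow, map_pow, map_scaleTwo_genSeries, map_scaleTwo_logSeries])

lemma dunklHom_X_pow_scaleTwo (i : ι) (k : ℕ) (f : MvPolynomial ι ℂ) :
    dunklHom a s (X i ^ k) (scaleTwo f) = (2 : ℂ) ^ k • scaleTwo (dunklHom a s (X i ^ k) f) := by
  induction k generalizing f with
  | zero => simp
  | succ k ih =>
    rw [pow_succ, dunklHom_mul_apply, dunklHom_mul_apply, dunklHom_X, dunkl_scaleTwo, map_smul, ih,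
      smul_smul, pow_succ']

lemma pairing_X_pow_detector_of_ne (i : ι) {k n : ℕ} (h : k ≠ n) :
    pairing a s (X i ^ k) (detector a s n) = 0 := by
  have h1 := congrArg constantCoeff (dunklHom_X_pow_scaleTwo (s := s) a i k (detector a s n))
  rw [scaleTwo_detector, map_smul, constantCoeff_smul, constantCoeff_smul,
    constantCoeff_scaleTwo, smul_eq_mul, smul_eq_mul] at h1
  have h2 : (2 : ℂ) ^ n ≠ 2 ^ k := by
    have : (2 : ℕ) ^ n ≠ 2 ^ k := fun h' => h (Nat.pow_right_injective le_rfl h').symm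
    exact_mod_cast this
  by_contra h3
  exact h2 (mul_right_cancel₀ h3 h1)

lemma dunklHom_X_mul_X_mul_detector {i j : ι} (hij : i ≠ j) (p : MvPolynomial ι ℂ) (n : ℕ) :
    dunklHom a s (p * (X j * X i)) (detector a s n) = 0 := by
  rw [dunklHom_mul_apply, dunklHom_mul_apply, dunklHom_X, dunklHom_X]
  by_cases hi : i ∈ s
  · by_cases hj : j ∈ s
    · rw [dunkl_dunkl_detector a hi hj hij, map_zero]
    · simp [dunkl_of_notMem hj]
  · simp [dunkl_of_notMem hi]

lemma pairing_detector (hs : s.Nonempty) {n : ℕ} (hn : 1 ≤ n) (h : MvPolynomial ι ℂ) :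
    pairing a s h (detector a s n)
      = ∑ i ∈ s, coeff (Finsupp.single i n) h * pairing a s (X i ^ n) (detector a s n) := by
  induction h using MvPolynomial.induction_on' with
  | add p q hp hq => simp [pairing_add_left, hp, hq, add_mul, Finset.sum_add_distrib]
  | monomial m c =>
    by_cases hm : ∃ i j, i ≠ j ∧ m i ≠ 0 ∧ m j ≠ 0
    · obtain ⟨i, j, hij, hi, hj⟩ := hm
      have hle : Finsupp.single j 1 + Finsupp.single i 1 ≤ m := by
        intro k
        rw [Finsupp.add_apply, Finsupp.single_apply, Finsupp.single_apply]
        split_ifs <;> grind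
      have hmon : monomial m c = monomial (m - (Finsupp.single j 1 + Finsupp.single i 1)) c
          * (X j * X i) := by
        rw [X, X, monomial_mul, monomial_mul, one_mul, mul_one, tsub_add_cancel_of_le hle]
      rw [hmon, pairing, dunklHom_X_mul_X_mul_detector a hij, map_zero, ← hmon,
        Finset.sum_eq_zero]
      intro k _
      rw [coeff_monomial, if_neg, zero_mul]
      rintro rfl
      rw [Finsupp.single_apply_ne_zero] at hi hj
      exact hij (hi.1.trans hj.1.symm)
    · have key : ∀ i k, pairing a s (monomial (Finsupp.single i k) c) (detector a s n)
          = ∑ j ∈ s, coeff (Finsupp.single j n) (monomial (Finsupp.single i k) c)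
            * pairing a s (X j ^ n) (detector a s n) := by
        intro i k
        rw [← mul_one c, ← smul_eq_mul, ← smul_monomial, ← X_pow_eq_monomial, pairing_smul_left]
        simp only [coeff_smul, coeff_X_pow, smul_eq_mul]
        by_cases hk : k = n
        · subst hk
          by_cases hi : i ∈ s
          · rw [Finset.sum_eq_single i]
            · simp
            · intro j _ hj
              rw [if_neg, mul_zero, zero_mul]
              rw [Finsupp.single_left_inj (by omega)]
              exact hj.symm
            · exact fun h => (h hi).elim
          · obtain ⟨k, rfl⟩ := Nat.exists_eq_add_of_le' hn
            rw [pow_succ, pairing, dunklHom_mul_apply, dunklHom_X, dunkl_of_notMem hi,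
              Finset.sum_eq_zero]
            · simp
            · intro j hj
              rw [if_neg, mul_zero, zero_mul]
              rw [Finsupp.single_left_inj (by omega)]
              exact fun h => hi (h ▸ hj)
        · rw [pairing_X_pow_detector_of_ne a i hk, mul_zero, Finset.sum_eq_zero]
          intro j _
          rw [if_neg, mul_zero, zero_mul]
          rw [Finsupp.single_eq_single_iff]
          omega
      push Not at hm
      obtain ⟨i, hi⟩ : ∃ i, ∀ j, i ≠ j → m j = 0 := by
        by_cases h0 : ∃ i, m i ≠ 0
        · exact ⟨h0.choose, fun j hj => hm _ j hj h0.choose_spec⟩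
        · push Not at h0
          exact ⟨hs.choose, fun j _ => h0 j⟩
      rw [show m = Finsupp.single i (m i) from Finsupp.ext fun j => by
        by_cases hj : i = j
        · subst hj; simp
        · rw [hi j hj, Finsupp.single_eq_of_ne (Ne.symm hj)]]
      exact key i (m i)

lemma sum_dunklHom_X_pow_detector (n k : ℕ) :
    dunklHom a s (∑ i ∈ s, X i ^ (k + 1)) (detector a s n)
      = dunklHom a s ((∑ i ∈ s, X i) ^ (k + 1)) (detector a s n) := by
  induction k with
  | zero => simp
  | succ k ih =>
    rw [pow_succ', dunklHom_mul_apply, ← ih, ← dunklHom_mul_apply, Finset.sum_mul_sum,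
      map_sum, map_sum, LinearMap.sum_apply, LinearMap.sum_apply]
    refine Finset.sum_congr rfl fun i hi => ?_
    rw [map_sum, LinearMap.sum_apply, Finset.sum_eq_single i]
    · rw [← pow_succ']
    · intro j _ hj
      rw [show (X i * X j ^ (k + 1) : MvPolynomial ι ℂ) = X j ^ k * (X i * X j) by ring]
      exact dunklHom_X_mul_X_mul_detector a hj _ n
    · exact fun h => (h hi).elim

lemma exists_dunklHom_sum_X_pow_detector (hs : s.Nonempty) (n : ℕ) : ∃ c : ℂ, c ≠ 0 ∧
    dunklHom a s ((∑ i ∈ s, X i) ^ n) (detector a s n) = C c := by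
  induction n with
  | zero => exact ⟨1, one_ne_zero, by simp [detector_zero]⟩
  | succ n ih =>
    obtain ⟨c, hc, h⟩ := ih
    obtain ⟨d, hd, h'⟩ := exists_sum_dunkl_detector a hs n
    refine ⟨d * c, mul_ne_zero hd hc, ?_⟩
    have : dunklHom a s (∑ i ∈ s, X i) (detector a s (n + 1)) = d • detector a s n := by
      rw [← h', map_sum, LinearMap.sum_apply]
      simp
    rw [pow_succ, dunklHom_mul_apply, this, map_smul, h, smul_eq_C_mul, ← C_mul]

lemma sum_pairing_X_pow_detector_ne_zero (hs : s.Nonempty) {n : ℕ} (hn : 1 ≤ n) :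
    ∑ i ∈ s, pairing a s (X i ^ n) (detector a s n) ≠ 0 := by
  obtain ⟨k, rfl⟩ := Nat.exists_eq_add_of_le' hn
  obtain ⟨c, hc, h⟩ := exists_dunklHom_sum_X_pow_detector a hs (k + 1)
  rw [← pairing_sum_left, pairing, sum_dunklHom_X_pow_detector, h, constantCoeff_C]
  exact hc

end Detectors

section Recurrence

variable {ι : Type*} (a : ℕ) (s : Finset ι)

lemma coeff_X_mul_derivative (F : PolySeries ι) (n : ℕ) :
    PowerSeries.coeff n (PowerSeries.X * PowerSeries.derivative (MvPolynomial ι ℂ) F)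
      = (n : ℂ) • PowerSeries.coeff n F := by
  cases n with
  | zero => simp
  | succ n =>
    rw [PowerSeries.coeff_succ_X_mul, PowerSeries.coeff_derivative, Nat.cast_smul_eq_nsmul,
      nsmul_eq_mul, mul_comm]
    simp

/-- The right hand side of the recurrence for `logCoeff`. -/
noncomputable def sourceTerm (n : ℕ) : MvPolynomial ι ℂ :=
  PowerSeries.coeff n (genSeries s ^ a *
    (PowerSeries.X * PowerSeries.derivative (MvPolynomial ι ℂ) (genSeries s)))

lemma coeff_mul_mem {A : Subalgebra ℂ (MvPolynomial ι ℂ)} {F G : PolySeries ι}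
    (hF : ∀ n, PowerSeries.coeff n F ∈ A) (hG : ∀ n, PowerSeries.coeff n G ∈ A) (n : ℕ) :
    PowerSeries.coeff n (F * G) ∈ A := by
  rw [PowerSeries.coeff_mul]
  exact sum_mem fun p _ => mul_mem (hF _) (hG _)

lemma coeff_genSeries_pow_mem (n : ℕ) : PowerSeries.coeff n (genSeries s ^ a) ∈ symAlg s := by
  induction a generalizing n with
  | zero =>
    rw [pow_zero, PowerSeries.coeff_one]
    split_ifs
    exacts [one_mem _, zero_mem _]
  | succ a ih =>
    rw [pow_succ]
    exact coeff_mul_mem ih (fun n => coeff_genSeries s n ▸ elemCoeff_mem_symAlg s n) n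

lemma sourceTerm_mem (n : ℕ) : sourceTerm a s n ∈ symAlg s := by
  refine coeff_mul_mem (coeff_genSeries_pow_mem a s) (fun n => ?_) n
  rw [coeff_X_mul_derivative, coeff_genSeries]
  exact Subalgebra.smul_mem _ (elemCoeff_mem_symAlg s n) _

variable [DecidableEq ι]

lemma sum_elemCoeff_mul_logCoeff (n : ℕ) :
    ∑ p ∈ Finset.HasAntidiagonal.antidiagonal n,
      ((p.2 : ℂ) - a * p.1) • (elemCoeff s p.1 * logCoeff a s p.2) = -sourceTerm a s n := by
  have h : genSeries s * (PowerSeries.X *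
        PowerSeries.derivative (MvPolynomial ι ℂ) (genSeries s ^ a * logSeries s))
      - (a : PolySeries ι) * ((PowerSeries.X *
        PowerSeries.derivative (MvPolynomial ι ℂ) (genSeries s)) * (genSeries s ^ a * logSeries s))
      = -(genSeries s ^ a *
        (PowerSeries.X * PowerSeries.derivative (MvPolynomial ι ℂ) (genSeries s))) := by
    linear_combination PowerSeries.X * genSeries_mul_derivative (s := s) a
  have := congrArg (PowerSeries.coeff n) h
  rw [map_neg, ← sourceTerm] at this
  rw [← this, map_sub, ← nsmul_eq_mul, map_nsmul, PowerSeries.coeff_mul, PowerSeries.coeff_mul,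
    Finset.smul_sum, ← Finset.sum_sub_distrib]
  refine Finset.sum_congr rfl fun p _ => ?_
  rw [coeff_X_mul_derivative, coeff_X_mul_derivative, coeff_genSeries, ← logCoeff, sub_smul,
    mul_smul, mul_smul_comm, smul_mul_assoc, Nat.cast_smul_eq_nsmul ℂ a, logCoeff]

lemma logCoeff_mem_symAlg (n : ℕ) : logCoeff a s n ∈ symAlg s := by
  induction n using Nat.strong_induction_on with
  | _ n ih =>
    cases n with
    | zero =>
      have : logCoeff a s 0 = 0 := by
        rw [logCoeff, PowerSeries.coeff_mul, Finset.HasAntidiagonal.antidiagonal_zero, Finset.sum_singleton, coeff_logSeries]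
        simp
      exact this ▸ zero_mem _
    | succ n =>
      have h := sum_elemCoeff_mul_logCoeff a s (n + 1)
      rw [Finset.Nat.sum_antidiagonal_succ, elemCoeff_zero, one_mul] at h
      have hn : ((n + 1 : ℕ) : ℂ) ≠ 0 := by exact_mod_cast n.succ_ne_zero
      simp only [Nat.cast_zero, mul_zero, sub_zero] at h
      rw [← inv_smul_smul₀ hn (logCoeff a s (n + 1)), eq_sub_of_add_eq h]
      refine Subalgebra.smul_mem _ (sub_mem (neg_mem (sourceTerm_mem _ _ _))
        (sum_mem fun p hp => ?_)) _
      have := Finset.HasAntidiagonal.mem_antidiagonal.1 hp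
      exact Subalgebra.smul_mem _ (mul_mem (elemCoeff_mem_symAlg _ _) (ih _ (by omega))) _

lemma detector_mem_symAlg (n : ℕ) : detector a s n ∈ symAlg s := by
  rw [detector]
  split_ifs
  exacts [coeff_genSeries_pow_mem a s n, logCoeff_mem_symAlg a s n]

end Recurrence

section Nondegenerate

variable {ι : Type*} [DecidableEq ι] (a : ℕ) {s : Finset ι} {N : ℕ}

lemma coeff_single_eq_of_symm {f : MvPolynomial ι ℂ} {i j : ι} (h : swapVar i j f = f) (n : ℕ) :
    coeff (Finsupp.single i n) f = coeff (Finsupp.single j n) f := by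
  have := coeff_rename_mapDomain (Equiv.swap i j) (Equiv.injective _) f (Finsupp.single j n)
  rwa [Finsupp.mapDomain_single, Equiv.swap_apply_right, ← swapVar, h] at this

/-- The Dunkl pairing is nondegenerate on symmetric polynomials. -/
theorem exists_pairing_ne_zero {f : MvPolynomial ι ℂ} (hf : f ∈ symBox s N) (h0 : f ≠ 0) :
    ∃ Q ∈ symAlg s, pairing a s Q f ≠ 0 := by
  have const (s : Finset ι) {f : MvPolynomial ι ℂ} (h0 : f ≠ 0) (hf : f = C (constantCoeff f)) :
      ∃ Q ∈ symAlg s, pairing a s Q f ≠ 0 := by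
    refine ⟨1, one_mem _, fun h => h0 ?_⟩
    rw [pairing, map_one, Module.End.one_apply] at h
    rw [hf, h, C_0]
  induction s using Finset.induction generalizing N f with
  | empty => exact const _ h0 (eq_C_of_mem_symBox_empty hf)
  | insert l s hl ih =>
    have hex : ∃ N, f ∈ symBox (insert l s) N := ⟨N, hf⟩
    classical
    obtain ⟨M, hM, hmin⟩ : ∃ M, f ∈ symBox (insert l s) M ∧
        ∀ m < M, f ∉ symBox (insert l s) m :=
      ⟨Nat.find hex, Nat.find_spec hex, fun m hm => Nat.find_min hex hm⟩
    rcases M with _ | M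
    · exact const _ h0 (eq_C_of_mem_symBox_zero hM)
    have hlc : leadCoeff l (M + 1) f ≠ 0 := fun h => hmin M (Nat.lt_succ_self M)
      (mem_symBox_sub_one_of_leadCoeff (Finset.mem_insert_self l s) hM h)
    obtain ⟨Q₀, hQ₀, hpair⟩ := ih (leadCoeff_mem_symBox hl hM) hlc
    obtain ⟨Q, hQ, hQQ⟩ := exists_lift_symAlg a hl hQ₀
    set h₁ := dunklHom a (insert l s) Q f
    have hh₁ : h₁ ∈ symBox (insert l s) (M + 1) := dunklHom_mem_symBox hQ hM
    have hlead : coeff (Finsupp.single l (M + 1)) h₁ ≠ 0 := by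
      have := leadCoeff_dunklHom (a := a) hl (Nat.succ_pos M) (mem_symBox.1 hM).1 Q
      rw [hQQ] at this
      have h0 := coeff_leadCoeff l (M + 1) 0 h₁
      rw [if_pos (by simp), zero_add] at h0
      rw [← h0, this]
      exact hpair
    refine ⟨detector a (insert l s) (M + 1) * Q,
      mul_mem (detector_mem_symAlg a _ _) hQ, ?_⟩
    have hs : (insert l s).Nonempty := Finset.insert_nonempty l s
    rw [pairing_mul_left, pairing_comm, pairing_detector a hs (Nat.succ_pos M)]
    rw [Finset.sum_congr rfl fun i hi => by
      rw [← coeff_single_eq_of_symm ((mem_symBox.1 hh₁).2 l (Finset.mem_insert_self l s) i hi)],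
      ← Finset.mul_sum]
    exact mul_ne_zero hlead (sum_pairing_X_pow_detector_ne_zero a hs (Nat.succ_pos M))

lemma dunklHom_detector_eq_zero (hs : s.Nonempty) {n : ℕ} (hn : N < n) {f : MvPolynomial ι ℂ}
    (hf : f ∈ symBox s N) : dunklHom a s (detector a s n) f = 0 := by
  by_contra h
  obtain ⟨Q, hQ, hne⟩ := exists_pairing_ne_zero a
    (dunklHom_mem_symBox (detector_mem_symAlg a s n) hf) h
  apply hne
  rw [← pairing_mul_left, mul_comm, pairing_mul_left, pairing_comm,
    pairing_detector a hs (by omega)]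
  refine Finset.sum_eq_zero fun i hi => ?_
  have hbox := (mem_symBox.1 (dunklHom_mem_symBox (a := a) hQ hf)).1
  have : coeff (Finsupp.single i n) (dunklHom a s Q f) = 0 := by
    by_contra h
    have h1 := le_degreeOf_of_mem_support i (mem_support_iff.2 h)
    have h2 := degreeOf_le_of_mem_box hbox i
    rw [Finsupp.single_eq_same] at h1
    omega
  rw [this, zero_mul]

end Nondegenerate

section DimensionBound

variable {ι : Type*} (a : ℕ) (s : Finset ι)

lemma quotientMap_sourceTerm (J : Ideal (MvPolynomial ι ℂ)) (n : ℕ) :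
    Ideal.Quotient.mk J (sourceTerm a s n)
      = ((genPoly s).map (Ideal.Quotient.mk J) ^ a * (Polynomial.X *
        Polynomial.derivative ((genPoly s).map (Ideal.Quotient.mk J)))).coeff n := by
  rw [sourceTerm, genSeries, PowerSeries.derivative_coe, ← Polynomial.coe_X, ← Polynomial.coe_pow,
    ← Polynomial.coe_mul, ← Polynomial.coe_mul, Polynomial.coeff_coe, ← Polynomial.coeff_map]
  simp [Polynomial.derivative_map]

variable {s} {r : ℕ}

lemma natDegree_map_genPoly_le {J : Ideal (MvPolynomial ι ℂ)}
    (hJ : ∀ i, r < i → elemCoeff s i ∈ J) :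
    ((genPoly s).map (Ideal.Quotient.mk J)).natDegree ≤ r := by
  rw [Polynomial.natDegree_le_iff_coeff_eq_zero]
  intro i hi
  rw [Polynomial.coeff_map]
  exact Ideal.Quotient.eq_zero_iff_mem.2 (hJ i hi)

lemma natDegree_X_mul_derivative_le {A : Type*} [CommRing A] {p : Polynomial A}
    (hp : p.natDegree ≤ r) : (Polynomial.X * Polynomial.derivative p).natDegree ≤ r := by
  rw [Polynomial.natDegree_le_iff_coeff_eq_zero]
  intro i hi
  obtain ⟨i, rfl⟩ := Nat.exists_eq_add_of_le' (Nat.one_le_of_lt hi)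
  rw [Polynomial.coeff_X_mul, Polynomial.coeff_derivative,
    Polynomial.coeff_eq_zero_of_natDegree_lt (hp.trans_lt hi), zero_mul]

lemma sourceTerm_mem_ideal {J : Ideal (MvPolynomial ι ℂ)} (hJ : ∀ i, r < i → elemCoeff s i ∈ J)
    {n : ℕ} (hn : a * r + r < n) : sourceTerm a s n ∈ J := by
  rw [← Ideal.Quotient.eq_zero_iff_mem, quotientMap_sourceTerm]
  have h := natDegree_map_genPoly_le hJ
  exact Polynomial.coeff_eq_zero_of_natDegree_lt ((Polynomial.natDegree_mul_le_of_le
    (Polynomial.natDegree_pow_le_of_le a h) (natDegree_X_mul_derivative_le h)).trans_lt hn)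

lemma elemCoeff_pow_mem_ideal {J : Ideal (MvPolynomial ι ℂ)} (hr : 1 ≤ r)
    (hJ : ∀ i, r < i → elemCoeff s i ∈ J) (hn : sourceTerm a s (a * r + r) ∈ J) :
    elemCoeff s r ^ (a + 1) ∈ J := by
  rw [← Ideal.Quotient.eq_zero_iff_mem, quotientMap_sourceTerm] at hn
  have h := natDegree_map_genPoly_le hJ
  rw [Polynomial.coeff_mul_add_eq_of_natDegree_le (Polynomial.natDegree_pow_le_of_le a h)
    (natDegree_X_mul_derivative_le h), Polynomial.coeff_pow_of_natDegree_le h] at hn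
  obtain ⟨r, rfl⟩ := Nat.exists_eq_add_of_le' hr
  rw [Polynomial.coeff_X_mul, Polynomial.coeff_derivative, Polynomial.coeff_map,
    ← mul_assoc, ← pow_succ] at hn
  have h1 : (r + 1 : ℂ) ≠ 0 := by exact_mod_cast r.succ_ne_zero
  have h2 : (elemCoeff s (r + 1) ^ (a + 1)) * C (r + 1 : ℂ) ∈ J := by
    rw [← Ideal.Quotient.eq_zero_iff_mem]
    simpa [elemCoeff] using hn
  have h3 := J.mul_mem_right (C (r + 1 : ℂ)⁻¹) h2
  rwa [mul_assoc, ← C_mul, mul_inv_cancel₀ h1, C_1, mul_one] at h3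

variable [DecidableEq ι] (s)

/-- The polynomials whose Dunkl operators vanish on `M`. -/
noncomputable def dunklAnn (M : Submodule ℂ (MvPolynomial ι ℂ)) : Ideal (MvPolynomial ι ℂ) where
  carrier := {Q | ∀ f ∈ M, dunklHom a s Q f = 0}
  add_mem' hp hq f hf := by rw [map_add, LinearMap.add_apply, hp f hf, hq f hf, add_zero]
  zero_mem' f _ := by simp
  smul_mem' c Q hQ f hf := by rw [smul_eq_mul, dunklHom_mul_apply, hQ f hf, map_zero]

variable {s} {a} {M : Submodule ℂ (MvPolynomial ι ℂ)}

lemma mem_dunklAnn {Q : MvPolynomial ι ℂ} :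
    Q ∈ dunklAnn a s M ↔ ∀ f ∈ M, dunklHom a s Q f = 0 := Iff.rfl

lemma dunklAnn_mono {M' : Submodule ℂ (MvPolynomial ι ℂ)} (h : M' ≤ M) :
    dunklAnn a s M ≤ dunklAnn a s M' := fun _ hQ f hf => hQ f (h hf)

lemma mem_dunklAnn_map {p q : MvPolynomial ι ℂ} :
    q ∈ dunklAnn a s (M.map (dunklHom a s p)) ↔ p * q ∈ dunklAnn a s M := by
  simp [mem_dunklAnn, mul_comm p q]

lemma elemCoeff_mul_logCoeff_mem {N : ℕ} (hu : ∀ i, r < i → elemCoeff s i ∈ dunklAnn a s M)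
    (hg : ∀ n, N < n → logCoeff a s n ∈ dunklAnn a s M) :
    ((N : ℂ) - a * r) • (elemCoeff s r * logCoeff a s N) + sourceTerm a s (N + r)
      ∈ dunklAnn a s M := by
  have h := sum_elemCoeff_mul_logCoeff a s (N + r)
  have hmem : (r, N) ∈ Finset.HasAntidiagonal.antidiagonal (N + r) :=
    Finset.HasAntidiagonal.mem_antidiagonal.2 (add_comm _ _)
  rw [← Finset.add_sum_erase _ _ hmem] at h
  rw [show ((N : ℂ) - a * r) • (elemCoeff s r * logCoeff a s N) + sourceTerm a s (N + r)
    = -∑ p ∈ (Finset.HasAntidiagonal.antidiagonal (N + r)).erase (r, N),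
      ((p.2 : ℂ) - a * p.1) • (elemCoeff s p.1 * logCoeff a s p.2) by linear_combination h]
  refine neg_mem (sum_mem fun p hp => ?_)
  obtain ⟨hne, hp⟩ := Finset.mem_erase.1 hp
  rw [Finset.HasAntidiagonal.mem_antidiagonal] at hp
  rw [smul_eq_C_mul]
  refine Ideal.mul_mem_left _ _ ?_
  by_cases h1 : r < p.1
  · exact Ideal.mul_mem_right _ _ (hu _ h1)
  · refine Ideal.mul_mem_left _ _ (hg _ ?_)
    have : p.1 ≠ r := fun h => hne (Prod.ext h (by omega))
    omega

lemma finrank_le_one_of_elemCoeff_mem {K : ℕ} (hM : M ≤ symBox s K)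
    (hu : ∀ i, 0 < i → elemCoeff s i ∈ dunklAnn a s M) : Module.finrank ℂ M ≤ 1 := by
  have hsmul : ∀ Q ∈ symAlg s, ∃ c : ℂ, ∀ f ∈ M, dunklHom a s Q f = c • f := by
    intro Q hQ
    induction hQ using Algebra.adjoin_induction with
    | mem x hx =>
      obtain ⟨r, rfl⟩ := hx
      rcases Nat.eq_zero_or_pos r with rfl | hr
      · exact ⟨1, fun f _ => by simp [elemCoeff_zero]⟩
      · exact ⟨0, fun f hf => by rw [hu r hr f hf, zero_smul]⟩
    | algebraMap c => exact ⟨c, fun f _ => by simp⟩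
    | add p q _ _ hp hq =>
      obtain ⟨c, hc⟩ := hp
      obtain ⟨d, hd⟩ := hq
      exact ⟨c + d, fun f hf => by rw [map_add, LinearMap.add_apply, hc f hf, hd f hf, add_smul]⟩
    | mul p q _ _ hp hq =>
      obtain ⟨c, hc⟩ := hp
      obtain ⟨d, hd⟩ := hq
      exact ⟨d * c, fun f hf => by
        rw [dunklHom_mul_apply, hd f hf, map_smul, hc f hf, smul_smul]⟩
  have hinj : Function.Injective ((aeval (0 : ι → ℂ)).toLinearMap.domRestrict M) := by
    rw [← LinearMap.ker_eq_bot, LinearMap.ker_eq_bot']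
    rintro ⟨f, hf⟩ h0
    by_contra hne
    obtain ⟨Q, hQ, hp⟩ := exists_pairing_ne_zero a (hM hf) (fun h => hne (Subtype.ext h))
    obtain ⟨c, hc⟩ := hsmul Q hQ
    apply hp
    have h1 : constantCoeff f = 0 := by
      simpa [constantCoeff_eq] using h0
    rw [pairing, hc f hf, constantCoeff_smul, h1, smul_zero]
  simpa using LinearMap.finrank_le_finrank_of_injective hinj

theorem finrank_le_choose (r k : ℕ) {K : ℕ} (hM : M ≤ symBox s K)
    (hst : ∀ i, M.map (dunklHom a s (elemCoeff s i)) ≤ M)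
    (hu : ∀ i, r < i → elemCoeff s i ∈ dunklAnn a s M)
    (hg : ∀ n, a * r + k < n → logCoeff a s n ∈ dunklAnn a s M) :
    Module.finrank ℂ M ≤ (a * r + k + r).choose r := by
  induction r generalizing k M with
  | zero => simpa using finrank_le_one_of_elemCoeff_mem hM hu
  | succ r ihr =>
    have hker (k : ℕ) (M : Submodule ℂ (MvPolynomial ι ℂ)) (hM : M ≤ symBox s K)
        (hst : ∀ i, M.map (dunklHom a s (elemCoeff s i)) ≤ M)
        (hu : ∀ i, r + 1 < i → elemCoeff s i ∈ dunklAnn a s M)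
        (hg : ∀ n, a * (r + 1) + k < n → logCoeff a s n ∈ dunklAnn a s M) :
        Module.finrank ℂ (M ⊓ LinearMap.ker (dunklHom a s (elemCoeff s (r + 1))) :
          Submodule ℂ (MvPolynomial ι ℂ)) ≤ (a * (r + 1) + k + r).choose r := by
      have := ihr (M := M ⊓ LinearMap.ker (dunklHom a s (elemCoeff s (r + 1)))) (a + k)
        (inf_le_left.trans hM) (fun i => ?_) (fun i hi => ?_) fun n hn => ?_
      · rwa [← add_assoc, ← Nat.mul_succ] at this
      · rintro _ ⟨f, ⟨hf, hf0⟩, rfl⟩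
        refine ⟨hst i ⟨f, hf, rfl⟩, ?_⟩
        rw [SetLike.mem_coe, LinearMap.mem_ker] at hf0 ⊢
        rw [← dunklHom_mul_apply, mul_comm, dunklHom_mul_apply, hf0, map_zero]
      · rcases Nat.eq_or_lt_of_le (Nat.succ_le_of_lt hi) with rfl | hi
        · exact fun f hf => hf.2
        · exact dunklAnn_mono inf_le_left (hu i hi)
      · exact dunklAnn_mono inf_le_left (hg n (by rwa [Nat.mul_succ, add_assoc]))
    induction k generalizing M with
    | zero =>
      have := Submodule.finiteDimensional_of_le hM
      have hsrc : sourceTerm a s (a * (r + 1) + (r + 1)) ∈ dunklAnn a s M := by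
        have := elemCoeff_mul_logCoeff_mem hu hg
        simpa using this
      have hpow := elemCoeff_pow_mem_ideal a (Nat.succ_pos r) hu hsrc
      have hbot : M.map (dunklHom a s (elemCoeff s (r + 1)) ^ (a + 1)) = ⊥ := by
        rw [← map_pow, eq_bot_iff]
        rintro _ ⟨f, hf, rfl⟩
        exact (Submodule.mem_bot ℂ).2 (hpow f hf)
      refine (finrank_le_mul_of_map_pow_eq_bot M _ (hst (r + 1)) (a + 1) hbot).trans
        ((Nat.mul_le_mul_left _ (hker 0 M hM hst hu hg)).trans_eq ?_)
      refine Nat.eq_of_mul_eq_mul_right (Nat.succ_pos r) ?_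
      have := Nat.add_one_mul_choose_eq (a * (r + 1) + 0 + r) r
      simp only [Nat.succ_eq_add_one] at this ⊢
      rw [show a * (r + 1) + 0 + (r + 1) = a * (r + 1) + 0 + r + 1 by ring, ← this]
      ring
    | succ k ihk =>
      have := Submodule.finiteDimensional_of_le hM
      rw [← finrank_map_add_finrank_inf_ker M (dunklHom a s (elemCoeff s (r + 1)))]
      have himg := ihk (M := M.map (dunklHom a s (elemCoeff s (r + 1)))) ((hst _).trans hM)
        (fun i => ?_) (fun i hi => dunklAnn_mono (hst _) (hu i hi)) (fun n hn => ?_)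
      · have := hker (k + 1) M hM hst hu hg
        rw [show a * (r + 1) + (k + 1) + (r + 1) = (a * (r + 1) + k + (r + 1)) + 1 by ring,
          Nat.choose_succ_succ', add_comm]
        refine Nat.add_le_add ?_ himg
        convert this using 2
        ring
      · rintro _ ⟨_, ⟨f, hf, rfl⟩, rfl⟩
        refine ⟨dunklHom a s (elemCoeff s i) f, hst i ⟨f, hf, rfl⟩, ?_⟩
        rw [← dunklHom_mul_apply, mul_comm, dunklHom_mul_apply]
      · rw [mem_dunklAnn_map]
        rcases Nat.eq_or_lt_of_le (Nat.succ_le_of_lt hn) with rfl | hn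
        · have hmem := elemCoeff_mul_logCoeff_mem (N := a * (r + 1) + (k + 1)) hu hg
          have hsrc : sourceTerm a s (a * (r + 1) + (k + 1) + (r + 1)) ∈ dunklAnn a s M :=
            sourceTerm_mem_ideal a hu (by omega)
          rw [Ideal.add_mem_iff_left _ hsrc] at hmem
          have hk : (((a * (r + 1) + (k + 1) : ℕ) : ℂ) - a * (r + 1 : ℕ)) ≠ 0 := by
            push_cast
            rw [add_sub_cancel_left]
            exact_mod_cast k.succ_ne_zero
          have := Ideal.mul_mem_left _ (C (((a * (r + 1) + (k + 1) : ℕ) : ℂ)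
            - a * (r + 1 : ℕ))⁻¹) hmem
          rwa [← smul_eq_C_mul, inv_smul_smul₀ hk] at this
        · exact Ideal.mul_mem_left _ _ (hg n hn)

end DimensionBound

section Generation

variable {ι : Type*} [DecidableEq ι] {a : ℕ} {s : Finset ι} {N : ℕ}

lemma finrank_symBox_inf_ker_le (hs : s.Nonempty) (hN : a * s.card ≤ N) :
    Module.finrank ℂ (symBox s N ⊓ LinearMap.ker (dunklHom a s (elemCoeff s s.card)) :
      Submodule ℂ (MvPolynomial ι ℂ)) ≤ (N + (s.card - 1)).choose (s.card - 1) := by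
  obtain ⟨r, hr⟩ := Nat.exists_eq_add_of_le' hs.card_pos
  have hNr : a * r + (N - a * r) = N := Nat.add_sub_cancel'
    ((Nat.mul_le_mul_left a (by omega)).trans hN)
  have := finrank_le_choose (a := a) (s := s) (M := symBox s N ⊓ LinearMap.ker
    (dunklHom a s (elemCoeff s s.card))) r (N - a * r) inf_le_left (fun i => ?_)
    (fun i hi f hf => ?_) fun n hn f hf => ?_
  · rwa [hNr, show r = s.card - 1 by omega] at this
  · rintro _ ⟨f, ⟨hf, hf0⟩, rfl⟩
    refine ⟨dunklHom_mem_symBox (elemCoeff_mem_symAlg s i) hf, ?_⟩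
    rw [SetLike.mem_coe, LinearMap.mem_ker] at hf0 ⊢
    rw [← dunklHom_mul_apply, mul_comm, dunklHom_mul_apply, hf0, map_zero]
  · rcases Nat.eq_or_lt_of_le (show s.card ≤ i by omega) with rfl | hi
    · exact hf.2
    · rw [elemCoeff_eq_zero hi, map_zero, LinearMap.zero_apply]
  · rw [hNr] at hn
    rw [← detector_of_lt a s (hN.trans_lt hn)]
    exact dunklHom_detector_eq_zero a hs hn hf.1

lemma map_elemCoeff_card_symBox (hs : s.Nonempty) (hN : a * s.card ≤ N) (hN1 : 1 ≤ N) :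
    (symBox s N).map (dunklHom a s (elemCoeff s s.card)) = symBox s (N - 1) := by
  refine Submodule.eq_of_le_of_finrank_le ?_ ?_
  · rintro _ ⟨f, hf, rfl⟩
    exact dunklHom_elemCoeff_card_mem hs hf
  · have h1 := finrank_map_add_finrank_inf_ker (symBox s N)
      (dunklHom a s (elemCoeff s s.card))
    have h2 := finrank_symBox_inf_ker_le hs hN
    rw [finrank_symBox] at h1 ⊢
    obtain ⟨r, hr⟩ := Nat.exists_eq_add_of_le' hs.card_pos
    obtain ⟨n, rfl⟩ := Nat.exists_eq_add_of_le' hN1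
    rw [hr] at h1 h2 ⊢
    simp only [Nat.succ_eq_add_one, zero_add] at h1 h2 ⊢
    have h3 := Nat.choose_succ_succ' (n + (r + 1)) r
    rw [show n + 1 + (r + 1) = n + (r + 1) + 1 by ring] at h1
    rw [show n + 1 + (r + 1 - 1) = n + (r + 1) by omega, Nat.add_sub_cancel] at h2
    rw [Nat.add_sub_cancel]
    omega

lemma leadCoeff_X_pow (l : ι) (N : ℕ) : leadCoeff l N (X l ^ N) = 1 := by
  induction N with
  | zero =>
    ext m
    rw [coeff_leadCoeff]
    by_cases h : m = 0
    · simp [h]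
    · simp [coeff_one, Ne.symm h]
  | succ N ih => rw [pow_succ', leadCoeff_X_mul_self, ih]

lemma prod_X_pow_mem_symBox (s : Finset ι) (N : ℕ) : ∏ i ∈ s, X i ^ N ∈ symBox (ι := ι) s N := by
  rw [Finset.prod_pow]
  have h : (∏ i ∈ s, X i : MvPolynomial ι ℂ) = C ((-1) ^ s.card) * elemCoeff s s.card := by
    rw [elemCoeff_card, Finset.prod_neg, ← mul_assoc]
    simp [← mul_pow]
  rw [h, mul_pow, symBox_eq, ← C_pow, ← smul_eq_C_mul]
  exact Submodule.smul_mem _ _ (Submodule.pow_mem_pow _ (Submodule.subset_span (Set.mem_range_self s.card)) N)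

lemma dunklHom_pow_mem_symBox (hs : s.Nonempty) {f : MvPolynomial ι ℂ} (hf : f ∈ symBox s N)
    (m : ℕ) : dunklHom a s (elemCoeff s s.card ^ m) f ∈ symBox s (N - m) := by
  induction m with
  | zero => simpa using hf
  | succ m ih =>
    rw [pow_succ', dunklHom_mul_apply]
    exact dunklHom_elemCoeff_card_mem hs ih

lemma dunklHom_pow_succ_eq_zero (hs : s.Nonempty) {f : MvPolynomial ι ℂ} (hf : f ∈ symBox s N) :
    dunklHom a s (elemCoeff s s.card ^ (N + 1)) f = 0 := by
  have h := dunklHom_pow_mem_symBox (a := a) hs hf N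
  rw [Nat.sub_self] at h
  obtain ⟨i, hi⟩ := hs
  rw [pow_succ', dunklHom_mul_apply, eq_C_of_mem_symBox_zero h, ← mul_one (C _), ← smul_eq_C_mul,
    map_smul, dunklHom_one, elemCoeff_card, map_prod,
    Finset.prod_eq_zero (f := fun j => constantCoeff (-X j : MvPolynomial ι ℂ)) hi (by simp),
    C_0, smul_zero]

/-- Symmetric polynomials of degree at most `N` in each variable form a cyclic module over the
symmetric Dunkl operators, generated by the top monomial. -/
theorem exists_dunklHom_prod_X_pow (hN : a * s.card ≤ N) (hN1 : 1 ≤ N) {f : MvPolynomial ι ℂ}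
    (hf : f ∈ symBox s N) : ∃ Q ∈ symAlg s, dunklHom a s Q (∏ i ∈ s, X i ^ N) = f := by
  induction s using Finset.induction generalizing f with
  | empty =>
    exact ⟨C (constantCoeff f), Subalgebra.algebraMap_mem _ _, by
      rw [dunklHom_C, Finset.prod_empty, smul_eq_C_mul, mul_one, ← eq_C_of_mem_symBox_empty hf]⟩
  | insert l s hl ih =>
    have hs := Finset.insert_nonempty l s
    have htop : leadCoeff l N (∏ i ∈ insert l s, X i ^ N) = (∏ i ∈ s, X i ^ N : MvPolynomial ι ℂ) := by
      have h0 : degreeOf l (∏ i ∈ s, X i ^ N : MvPolynomial ι ℂ) = 0 :=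
        degreeOf_eq_zero_of_mem_box (mem_symBox.1 (prod_X_pow_mem_symBox s N)).1 hl
      rw [Finset.prod_insert hl, mul_comm, leadCoeff_mul _ h0, leadCoeff_X_pow, mul_one]
    have step : ∀ g ∈ symBox (insert l s) N, ∃ Q ∈ symAlg (insert l s),
        ∃ h ∈ symBox (insert l s) N, g = dunklHom a (insert l s) Q (∏ i ∈ insert l s, X i ^ N)
          + dunklHom a (insert l s) (elemCoeff (insert l s) (insert l s).card) h := by
      intro g hg
      obtain ⟨p, hp, hpg⟩ := ih
        ((Nat.mul_le_mul_left a (Finset.card_le_card (Finset.subset_insert l s))).trans hN)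
        (leadCoeff_mem_symBox hl hg)
      obtain ⟨q, hq, hqp⟩ := exists_lift_symAlg a hl hp
      have hmem := dunklHom_mem_symBox (a := a) hq (prod_X_pow_mem_symBox (insert l s) N)
      have hsub := mem_symBox_sub_one_of_leadCoeff (Finset.mem_insert_self l s)
        (Submodule.sub_mem _ hg hmem) (by
          rw [map_sub, leadCoeff_dunklHom hl hN1
            (mem_symBox.1 (prod_X_pow_mem_symBox (insert l s) N)).1, htop, hqp, hpg, sub_self])
      rw [← map_elemCoeff_card_symBox hs hN hN1] at hsub
      obtain ⟨h, hh, heq⟩ := hsub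
      exact ⟨q, hq, h, hh, by rw [heq, add_sub_cancel]⟩
    have iter : ∀ m, ∃ Q ∈ symAlg (insert l s), ∃ h ∈ symBox (insert l s) N,
        f = dunklHom a (insert l s) Q (∏ i ∈ insert l s, X i ^ N)
          + dunklHom a (insert l s) (elemCoeff (insert l s) (insert l s).card ^ m) h := by
      intro m
      induction m with
      | zero => exact ⟨0, Subalgebra.zero_mem _, f, hf, by simp⟩
      | succ m ihm =>
        obtain ⟨Q, hQ, h, hh, hfe⟩ := ihm
        obtain ⟨Q', hQ', h', hh', hhe⟩ := step h hh
        refine ⟨Q + elemCoeff (insert l s) (insert l s).card ^ m * Q', Subalgebra.add_mem _ hQ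
          (Subalgebra.mul_mem _ (Subalgebra.pow_mem _ (elemCoeff_mem_symAlg _ _) m) hQ'),
          h', hh', ?_⟩
        rw [map_add, LinearMap.add_apply, dunklHom_mul_apply, pow_succ, dunklHom_mul_apply,
          add_assoc, ← map_add, ← hhe, ← hfe]
    obtain ⟨Q, hQ, h, hh, hfe⟩ := iter (N + 1)
    exact ⟨Q, hQ, by rw [hfe, dunklHom_pow_succ_eq_zero hs hh, add_zero]⟩

end Generation

section CauchyKernel

variable {ι : Type*} [DecidableEq ι]

/-- No two distinct pairs of `m` share a coordinate. -/
abbrev IsMatching (m : Finset (ι × ι)) : Prop :=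
  ∀ p ∈ m, ∀ q ∈ m, p.1 = q.1 ∨ p.2 = q.2 → p = q

/-- The product of all `(X i - X k) ^ a`, with one factor omitted for each pair in `m`. -/
noncomputable def cauchyKernel (a : ℕ) (s t : Finset ι) (m : Finset (ι × ι)) : MvPolynomial ι ℂ :=
  ∏ p ∈ s ×ˢ t, (X p.1 - X p.2) ^ (a - if p ∈ m then 1 else 0)

variable {a : ℕ} {s t : Finset ι} {m : Finset (ι × ι)}

lemma swapVar_cauchyKernel {i j : ι} (hi : i ∈ s) (hj : j ∈ s) (hst : Disjoint s t)
    (hm : ∀ p, (Equiv.swap i j p.1, p.2) ∈ m ↔ p ∈ m) :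
    swapVar i j (cauchyKernel a s t m) = cauchyKernel a s t m := by
  rw [cauchyKernel, map_prod]
  refine Finset.prod_equiv ((Equiv.swap i j).prodCongr (Equiv.refl ι)) (fun p => ?_) fun p hp => ?_
  · simp [swap_mem_iff hi hj]
  · have h2 := (Finset.mem_product.1 hp).2
    have hi2 : p.2 ≠ i := fun h => Finset.disjoint_left.1 hst hi (h ▸ h2)
    have hj2 : p.2 ≠ j := fun h => Finset.disjoint_left.1 hst hj (h ▸ h2)
    simp only [map_pow, map_sub, swapVar_X, Equiv.prodCongr_apply,
      Equiv.coe_refl, id, Equiv.swap_apply_of_ne_of_ne hi2 hj2, Prod.map]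
    simp only [hm p]

lemma cauchyKernel_eq_mul (ha : 1 ≤ a) {p : ι × ι} (hp : p ∈ s ×ˢ t) (hpm : p ∉ m) :
    cauchyKernel a s t m = (X p.1 - X p.2) * cauchyKernel a s t (insert p m) := by
  rw [cauchyKernel, cauchyKernel, ← Finset.mul_prod_erase _ _ hp, ← Finset.mul_prod_erase _ _ hp,
    ← mul_assoc, if_neg hpm, if_pos (Finset.mem_insert_self p m), ← pow_succ',
    Nat.sub_zero, Nat.sub_add_cancel ha]
  congr 1
  refine Finset.prod_congr rfl fun q hq => ?_
  simp [(Finset.mem_erase.1 hq).1]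

lemma pderiv_prod_pow {κ : Type*} [DecidableEq κ] (j : ι) (u : Finset κ)
    (L : κ → MvPolynomial ι ℂ) (e : κ → ℕ) :
    pderiv j (∏ p ∈ u, L p ^ e p) = ∑ p ∈ u, (e p : MvPolynomial ι ℂ) *
      (pderiv j (L p) * (L p ^ (e p - 1) * ∏ q ∈ u.erase p, L q ^ e q)) := by
  induction u using Finset.induction with
  | empty => simp
  | insert q u hq ih =>
    have h1 : ∀ p ∈ u, L q ^ e q * ((e p : MvPolynomial ι ℂ) *
        (pderiv j (L p) * (L p ^ (e p - 1) * ∏ q ∈ u.erase p, L q ^ e q)))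
        = (e p : MvPolynomial ι ℂ) * (pderiv j (L p) * (L p ^ (e p - 1) *
          ∏ q ∈ (insert q u).erase p, L q ^ e q)) := by
      intro p hp
      have hpq : p ≠ q := fun h => hq (h ▸ hp)
      rw [Finset.erase_insert_of_ne hpq.symm,
        Finset.prod_insert fun h => hq (Finset.mem_of_mem_erase h)]
      ring
    rw [Finset.prod_insert hq, Finset.sum_insert hq, Finset.erase_insert hq, pderiv_mul, ih,
      pderiv_pow, Finset.mul_sum, Finset.sum_congr rfl h1]
    ring

lemma pderiv_cauchyKernel {j : ι} (hj : j ∈ s) (hst : Disjoint s t) (hjm : ∀ k, (j, k) ∉ m) :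
    pderiv j (cauchyKernel a s t m) = (a : ℂ) • ∑ k ∈ t, cauchyKernel a s t (insert (j, k) m) := by
  rw [cauchyKernel, pderiv_prod_pow, Finset.sum_product, Finset.sum_eq_single j, Finset.smul_sum]
  · refine Finset.sum_congr rfl fun k hk => ?_
    have hjk : j ≠ k := fun h => Finset.disjoint_left.1 hst hj (h ▸ hk)
    have hmem : (j, k) ∈ s ×ˢ t := Finset.mem_product.2 ⟨hj, hk⟩
    rw [if_neg (hjm k), Nat.sub_zero, cauchyKernel, ← Finset.mul_prod_erase _ _ hmem,
      if_pos (Finset.mem_insert_self _ m), map_sub, pderiv_X_self, pderiv_X_of_ne hjk.symm, sub_zero,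
      one_mul, smul_eq_C_mul, map_natCast]
    congr 2
    refine Finset.prod_congr rfl fun q hq => ?_
    simp [(Finset.mem_erase.1 hq).1]
  · intro i hi hij
    refine Finset.sum_eq_zero fun k hk => ?_
    have hjk : k ≠ j := fun h => Finset.disjoint_left.1 hst hj (h ▸ hk)
    rw [map_sub, pderiv_X_of_ne hij, pderiv_X_of_ne hjk, sub_zero, zero_mul, mul_zero]
  · exact fun h => absurd hj h

lemma divDiff_cauchyKernel_of_unmatched {i j : ι} (hi : i ∈ s) (hj : j ∈ s) (hst : Disjoint s t)
    (him : ∀ k, (i, k) ∉ m) (hjm : ∀ k, (j, k) ∉ m) : divDiff j i (cauchyKernel a s t m) = 0 := by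
  refine divDiff_of_swapVar_eq j i (swapVar_cauchyKernel hj hi hst fun p => ?_)
  obtain ⟨p, k⟩ := p
  by_cases h1 : p = j
  · simp [h1, him, hjm]
  by_cases h2 : p = i
  · simp [h2, him, hjm]
  rw [Equiv.swap_apply_of_ne_of_ne h1 h2]

lemma divDiff_cauchyKernel_of_matched (ha : 1 ≤ a) (hm : IsMatching m) {i j k : ι} (hi : i ∈ s)
    (hj : j ∈ s) (hk : k ∈ t) (hst : Disjoint s t) (hik : (i, k) ∈ m) (hjm : ∀ k, (j, k) ∉ m) :
    divDiff j i (cauchyKernel a s t m) = cauchyKernel a s t (insert (j, k) m) := by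
  have hij : j ≠ i := fun h => hjm k (h ▸ hik)
  have hki : k ≠ i := fun h => Finset.disjoint_left.1 hst hi (h ▸ hk)
  have hkj : k ≠ j := fun h => Finset.disjoint_left.1 hst hj (h ▸ hk)
  refine divDiff_eq hij ?_
  have hsym : swapVar j i (cauchyKernel a s t (insert (j, k) m))
      = cauchyKernel a s t (insert (j, k) m) := by
    refine swapVar_cauchyKernel hj hi hst fun p => ?_
    obtain ⟨p, l⟩ := p
    have huniq : ∀ l, (i, l) ∈ m ↔ l = k := fun l =>
      ⟨fun h => congrArg Prod.snd (hm _ h _ hik (Or.inl rfl)), fun h => h ▸ hik⟩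
    by_cases h1 : p = j
    · subst h1
      simp [huniq, hjm, hij.symm]
    by_cases h2 : p = i
    · subst h2
      simp [huniq, hjm, hij.symm]
    simp [Equiv.swap_apply_of_ne_of_ne h1 h2]
  rw [cauchyKernel_eq_mul ha (Finset.mem_product.2 ⟨hj, hk⟩ : (j, k) ∈ s ×ˢ t) (hjm k), map_mul,
    hsym, map_sub, swapVar_X, swapVar_X, Equiv.swap_apply_left,
    Equiv.swap_apply_of_ne_of_ne hkj hki]
  ring

lemma dunkl_cauchyKernel (ha : 1 ≤ a) (hst : Disjoint s t) (hmst : m ⊆ s ×ˢ t) (hm : IsMatching m)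
    {j : ι} (hj : j ∈ s) (hjm : ∀ k, (j, k) ∉ m) :
    dunkl a s j (cauchyKernel a s t m)
      = (a : ℂ) • ∑ k ∈ t \ m.image Prod.snd, cauchyKernel a s t (insert (j, k) m) := by
  have himg : m.image Prod.snd ⊆ t := Finset.image_subset_iff.2 fun p hp =>
    (Finset.mem_product.1 (hmst hp)).2
  have himg' : m.image Prod.fst ⊆ s := Finset.image_subset_iff.2 fun p hp =>
    (Finset.mem_product.1 (hmst hp)).1
  rw [dunkl_apply hj, pderiv_cauchyKernel hj hst hjm, ← smul_sub, ← Finset.sum_sdiff himg,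
    Finset.sum_image fun p hp q hq h => hm p hp q hq (Or.inr h), ← Finset.sum_subset himg',
    Finset.sum_image fun p hp q hq h => hm p hp q hq (Or.inl h), Finset.sum_congr rfl fun p hp =>
      divDiff_cauchyKernel_of_matched ha hm (Finset.mem_product.1 (hmst hp)).1 hj
        (Finset.mem_product.1 (hmst hp)).2 hst hp hjm, add_sub_cancel_right]
  intro i hi hi'
  exact divDiff_cauchyKernel_of_unmatched hi hj hst
    (fun k hk => hi' (Finset.mem_image.2 ⟨_, hk, rfl⟩)) hjm

lemma IsMatching.insert (hm : IsMatching m) {j k : ι} (hj : ∀ k, (j, k) ∉ m)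
    (hk : k ∉ m.image Prod.snd) : IsMatching (insert (j, k) m) := by
  have hk' : ∀ i, (i, k) ∉ m := fun i hi => hk (Finset.mem_image.2 ⟨_, hi, rfl⟩)
  have key : ∀ q ∈ m, ¬(j = q.1 ∨ k = q.2) := by
    rintro ⟨x, y⟩ hq (rfl | rfl)
    · exact hj _ hq
    · exact hk' _ hq
  intro p hp q hq h
  rcases Finset.mem_insert.1 hp with rfl | hp <;> rcases Finset.mem_insert.1 hq with rfl | hq
  · rfl
  · exact absurd h (key q hq)
  · exact absurd (h.imp Eq.symm Eq.symm) (key p hp)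
  · exact hm p hp q hq h

/-- The matchings of `A` into `t`. -/
def matchings (A t : Finset ι) : Finset (Finset (ι × ι)) :=
  (A ×ˢ t).powerset.filter fun m => IsMatching m ∧ m.image Prod.fst = A

lemma mem_matchings {A : Finset ι} : m ∈ matchings A t ↔
    m ⊆ A ×ˢ t ∧ IsMatching m ∧ m.image Prod.fst = A := by
  rw [matchings, Finset.mem_filter, Finset.mem_powerset]

lemma matchings_empty (t : Finset ι) : matchings ∅ t = {∅} := by
  ext m
  rw [mem_matchings, Finset.empty_product, Finset.subset_empty, Finset.mem_singleton]
  exact ⟨fun h => h.1, fun h => by simp [h]⟩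

lemma sum_matchings_insert {M : Type*} [AddCommMonoid M] {A : Finset ι} {j : ι} (hj : j ∉ A)
    (t : Finset ι) (F : Finset (ι × ι) → M) :
    ∑ m ∈ matchings (insert j A) t, F m
      = ∑ m ∈ matchings A t, ∑ k ∈ t \ m.image Prod.snd, F (insert (j, k) m) := by
  have hjm : ∀ m ∈ matchings A t, ∀ k, (j, k) ∉ m := fun m hm k h =>
    hj (Finset.mem_product.1 ((mem_matchings.1 hm).1 h)).1
  rw [Finset.sum_sigma']
  symm
  refine Finset.sum_bij (fun x _ => insert (j, x.2) x.1) ?_ ?_ ?_ fun _ _ => rfl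
  · rintro ⟨m, k⟩ hx
    obtain ⟨hm, hk⟩ := Finset.mem_sigma.1 hx
    obtain ⟨h1, h2, h3⟩ := mem_matchings.1 hm
    obtain ⟨hkt, hkm⟩ := Finset.mem_sdiff.1 hk
    refine mem_matchings.2 ⟨Finset.insert_subset (by simp [hkt]) (h1.trans
      (Finset.product_subset_product_left (Finset.subset_insert j A))),
      h2.insert (hjm m hm) hkm, by rw [Finset.image_insert, h3]⟩
  · rintro ⟨m, k⟩ hx ⟨m', k'⟩ hx' h
    obtain ⟨hm, hk⟩ := Finset.mem_sigma.1 hx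
    obtain ⟨hm', hk'⟩ := Finset.mem_sigma.1 hx'
    dsimp only at h hm hm'
    have hkk : k = k' := by
      have : (j, k) ∈ insert (j, k') m' := h ▸ Finset.mem_insert_self _ _
      rcases Finset.mem_insert.1 this with h | h
      · exact congrArg Prod.snd h
      · exact absurd h (hjm m' hm' k)
    subst hkk
    have := congrArg (fun u => u.erase (j, k)) h
    simp only [Finset.erase_insert (hjm m hm k), Finset.erase_insert (hjm m' hm' k)] at this
    rw [this]
  · intro m hm
    obtain ⟨h1, h2, h3⟩ := mem_matchings.1 hm
    obtain ⟨⟨j', k⟩, hjk, rfl⟩ := Finset.mem_image.1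
      (h3.symm ▸ Finset.mem_insert_self j A : j ∈ m.image Prod.fst)
    have huniq : ∀ q ∈ m.erase (j', k), q.1 ≠ j' ∧ q.2 ≠ k := fun q hq => by
      obtain ⟨hne, hq⟩ := Finset.mem_erase.1 hq
      exact ⟨fun h => hne (h2 q hq _ hjk (Or.inl h)), fun h => hne (h2 q hq _ hjk (Or.inr h))⟩
    have hA : ∀ q ∈ m.erase (j', k), q.1 ∈ A := fun q hq =>
      Finset.mem_of_mem_insert_of_ne (Finset.mem_product.1 (h1 (Finset.mem_of_mem_erase hq))).1
        (huniq q hq).1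
    refine ⟨⟨m.erase (j', k), k⟩, Finset.mem_sigma.2 ⟨mem_matchings.2 ⟨fun q hq =>
      Finset.mem_product.2 ⟨hA q hq, (Finset.mem_product.1 (h1 (Finset.mem_of_mem_erase hq))).2⟩,
      fun p hp q hq => h2 p (Finset.mem_of_mem_erase hp) q (Finset.mem_of_mem_erase hq), ?_⟩,
      Finset.mem_sdiff.2 ⟨(Finset.mem_product.1 (h1 hjk)).2, fun h => ?_⟩⟩,
      Finset.insert_erase hjk⟩
    · refine Finset.Subset.antisymm (Finset.image_subset_iff.2 hA) fun i hi => ?_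
      obtain ⟨q, hq, rfl⟩ := Finset.mem_image.1
        (h3.symm ▸ Finset.mem_insert_of_mem hi : i ∈ m.image Prod.fst)
      exact Finset.mem_image.2 ⟨q, Finset.mem_erase.2 ⟨fun h => hj (h ▸ hi), hq⟩, rfl⟩
    · obtain ⟨q, hq, hqk⟩ := Finset.mem_image.1 h
      exact (huniq q hq).2 hqk

lemma dunklHom_prod_X_cauchyKernel (ha : 1 ≤ a) (hst : Disjoint s t) {A : Finset ι} (hA : A ⊆ s) :
    dunklHom a s (∏ i ∈ A, X i) (cauchyKernel a s t ∅)
      = (a : ℂ) ^ A.card • ∑ m ∈ matchings A t, cauchyKernel a s t m := by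
  induction A using Finset.induction with
  | empty => simp [matchings_empty]
  | insert j A hj ih =>
    obtain ⟨hjs, hA⟩ := Finset.insert_subset_iff.1 hA
    rw [Finset.prod_insert hj, dunklHom_mul_apply, ih hA, dunklHom_X, map_smul, map_sum,
      Finset.sum_congr rfl fun m hm => dunkl_cauchyKernel ha hst ((mem_matchings.1 hm).1.trans
        (Finset.product_subset_product_left hA)) (mem_matchings.1 hm).2.1 hjs fun k h =>
        hj (Finset.mem_product.1 ((mem_matchings.1 hm).1 h)).1,
      ← Finset.smul_sum, smul_smul, ← pow_succ, Finset.card_insert_of_notMem hj,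
      sum_matchings_insert hj]

/-- The matchings with `r` edges between `s` and `t`. -/
def matchingsOfCard (s t : Finset ι) (r : ℕ) : Finset (Finset (ι × ι)) :=
  ((s ×ˢ t).powersetCard r).filter fun m => IsMatching m

lemma mem_matchingsOfCard {r : ℕ} : m ∈ matchingsOfCard s t r ↔
    m ⊆ s ×ˢ t ∧ m.card = r ∧ IsMatching m := by
  rw [matchingsOfCard, Finset.mem_filter, Finset.mem_powersetCard, and_assoc]

lemma sum_sum_matchings {M : Type*} [AddCommMonoid M] (s t : Finset ι) (r : ℕ)
    (F : Finset (ι × ι) → M) :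
    ∑ A ∈ s.powersetCard r, ∑ m ∈ matchings A t, F m = ∑ m ∈ matchingsOfCard s t r, F m := by
  have hcard : ∀ {m : Finset (ι × ι)}, IsMatching m → (m.image Prod.fst).card = m.card :=
    fun hm => Finset.card_image_of_injOn fun p hp q hq h => hm p hp q hq (Or.inl h)
  rw [← Finset.sum_fiberwise_of_maps_to (g := fun m : Finset (ι × ι) => m.image Prod.fst)
    (t := s.powersetCard r)]
  · refine Finset.sum_congr rfl fun A hA => Finset.sum_congr ?_ fun _ _ => rfl
    obtain ⟨hAs, hAr⟩ := Finset.mem_powersetCard.1 hA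
    ext m
    rw [mem_matchings, Finset.mem_filter, mem_matchingsOfCard]
    constructor
    · rintro ⟨h1, h2, h3⟩
      exact ⟨⟨h1.trans (Finset.product_subset_product_left hAs), by rw [← hcard h2, h3, hAr], h2⟩,
        h3⟩
    · rintro ⟨⟨h1, -, h2⟩, h3⟩
      exact ⟨fun p hp => Finset.mem_product.2 ⟨h3 ▸ Finset.mem_image_of_mem _ hp,
        (Finset.mem_product.1 (h1 hp)).2⟩, h2, h3⟩
  · intro m hm
    obtain ⟨h1, h2, h3⟩ := mem_matchingsOfCard.1 hm
    exact Finset.mem_powersetCard.2 ⟨Finset.image_subset_iff.2 fun p hp =>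
      (Finset.mem_product.1 (h1 hp)).1, by rw [hcard h3, h2]⟩

lemma dunklHom_elemCoeff_cauchyKernel (ha : 1 ≤ a) (hst : Disjoint s t) (r : ℕ) :
    dunklHom a s (elemCoeff s r) (cauchyKernel a s t ∅)
      = (-a : ℂ) ^ r • ∑ m ∈ matchingsOfCard s t r, cauchyKernel a s t m := by
  rw [elemCoeff_eq_sum, map_sum, LinearMap.sum_apply, ← sum_sum_matchings, Finset.smul_sum]
  refine Finset.sum_congr rfl fun A hA => ?_
  obtain ⟨hAs, hAr⟩ := Finset.mem_powersetCard.1 hA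
  have : (∏ i ∈ A, -X i : MvPolynomial ι ℂ) = (-1 : ℂ) ^ r • ∏ i ∈ A, X i := by
    rw [Finset.prod_neg, hAr, smul_eq_C_mul]
    simp
  rw [this, map_smul, LinearMap.smul_apply, dunklHom_prod_X_cauchyKernel ha hst hAs, hAr, smul_smul,
    ← mul_pow, neg_one_mul]

lemma cauchyKernel_swap (ha : 1 ≤ a) (hm : m ⊆ s ×ˢ t) :
    cauchyKernel a t s (m.image Prod.swap)
      = (-1 : ℂ) ^ (a * (s ×ˢ t).card + m.card) • cauchyKernel a s t m := by
  have h1 : cauchyKernel a t s (m.image Prod.swap)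
      = ∏ p ∈ s ×ˢ t, (X p.2 - X p.1) ^ (a - if p ∈ m then 1 else 0) := by
    rw [cauchyKernel]
    refine Finset.prod_equiv (Equiv.prodComm ι ι) (fun p => ?_) fun p hp => ?_
    · simp [and_comm]
    · have : p ∈ m.image Prod.swap ↔ p.swap ∈ m := by
        rw [Finset.mem_image]
        exact ⟨by rintro ⟨q, hq, rfl⟩; simpa using hq, fun h => ⟨_, h, Prod.swap_swap p⟩⟩
      by_cases h : p.swap ∈ m <;> simp [this, h]
  have h2 : ∀ p ∈ s ×ˢ t, (X p.2 - X p.1 : MvPolynomial ι ℂ) ^ (a - if p ∈ m then 1 else 0)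
      = (-1) ^ (a + if p ∈ m then 1 else 0) * (X p.1 - X p.2) ^ (a - if p ∈ m then 1 else 0) := by
    intro p _
    rw [← neg_sub, neg_pow]
    congr 1
    split_ifs
    · obtain ⟨c, rfl⟩ := Nat.exists_eq_add_of_le' ha
      simp [pow_succ]
    · simp
  rw [h1, Finset.prod_congr rfl h2, Finset.prod_mul_distrib, Finset.prod_pow_eq_pow_sum,
    Finset.sum_add_distrib, Finset.sum_const, Finset.sum_boole, Finset.filter_mem_eq_inter,
    Finset.inter_eq_right.2 hm, smul_eq_C_mul, cauchyKernel]
  simp [mul_comm]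

/-- The symmetric Dunkl operators in the two groups of variables agree, up to sign, on the
kernel `∏ (X i - X k) ^ a`. -/
theorem dunklHom_elemCoeff_cauchyKernel_comm (ha : 1 ≤ a) (hst : Disjoint s t) (r : ℕ) :
    dunklHom a s (elemCoeff s r) (cauchyKernel a s t ∅)
      = (-1 : ℂ) ^ r • dunklHom a t (elemCoeff t r) (cauchyKernel a s t ∅) := by
  have h0 : cauchyKernel a s t ∅ = (-1 : ℂ) ^ (a * (s ×ˢ t).card) • cauchyKernel a t s ∅ := by
    have := cauchyKernel_swap ha (Finset.empty_subset (s ×ˢ t))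
    rw [Finset.image_empty, Finset.card_empty, add_zero] at this
    rw [this, smul_smul, ← mul_pow]
    simp
  have h1 : ∑ m ∈ matchingsOfCard t s r, cauchyKernel a t s m
      = ∑ m ∈ matchingsOfCard s t r, cauchyKernel a t s (m.image Prod.swap) := by
    have hmem : ∀ {s t : Finset ι}, ∀ m ∈ matchingsOfCard s t r,
        m.image Prod.swap ∈ matchingsOfCard t s r := by
      intro s t m hm
      obtain ⟨h1, h2, h3⟩ := mem_matchingsOfCard.1 hm
      refine mem_matchingsOfCard.2 ⟨Finset.image_subset_iff.2 fun p hp => ?_, ?_, ?_⟩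
      · have := Finset.mem_product.1 (h1 hp)
        exact Finset.mem_product.2 ⟨this.2, this.1⟩
      · rw [Finset.card_image_of_injective _ Prod.swap_injective, h2]
      · intro p hp q hq h
        obtain ⟨p', hp', rfl⟩ := Finset.mem_image.1 hp
        obtain ⟨q', hq', rfl⟩ := Finset.mem_image.1 hq
        rw [h3 p' hp' q' hq' h.symm]
    have hinv : ∀ m : Finset (ι × ι), (m.image Prod.swap).image Prod.swap = m := fun m => by
      simp [Finset.image_image]
    exact Finset.sum_nbij' (fun m => m.image Prod.swap) (fun m => m.image Prod.swap) hmem hmem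
      (fun m _ => hinv m) (fun m _ => hinv m) fun m _ => by rw [hinv]
  have h4 : ∑ m ∈ matchingsOfCard s t r, cauchyKernel a t s (m.image Prod.swap)
      = ((-1 : ℂ) ^ (a * (s ×ˢ t).card) * (-1) ^ r) •
        ∑ m ∈ matchingsOfCard s t r, cauchyKernel a s t m := by
    rw [Finset.smul_sum]
    refine Finset.sum_congr rfl fun m hm => ?_
    rw [cauchyKernel_swap ha (mem_matchingsOfCard.1 hm).1, (mem_matchingsOfCard.1 hm).2.1, pow_add]
  rw [dunklHom_elemCoeff_cauchyKernel ha hst, h0, map_smul,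
    dunklHom_elemCoeff_cauchyKernel ha hst.symm, h1, h4, smul_smul, smul_smul, smul_smul]
  congr 1
  have h2 : ((-1 : ℂ) ^ (a * (s ×ˢ t).card)) * (-1 : ℂ) ^ (a * (s ×ˢ t).card) = 1 := by
    rw [← mul_pow]
    simp
  have h3 : (-1 : ℂ) ^ r * (-1 : ℂ) ^ r = 1 := by
    rw [← mul_pow]
    simp
  linear_combination (-(-a : ℂ) ^ r * ((-1 : ℂ) ^ r * (-1 : ℂ) ^ r)) * h2 - (-a : ℂ) ^ r * h3

end CauchyKernel

section SeparatedVariables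

variable {ι : Type*} {t : Finset ι}

/-- The polynomials involving only the variables in `u`, as a subspace. -/
noncomputable abbrev polysIn (u : Set ι) : Submodule ℂ (MvPolynomial ι ℂ) :=
  Subalgebra.toSubmodule (supported ℂ u)

lemma mem_polysIn {u : Set ι} {f : MvPolynomial ι ℂ} :
    f ∈ polysIn u ↔ ∀ k ∉ u, degreeOf k f = 0 := by
  rw [Subalgebra.mem_toSubmodule, mem_supported]
  refine ⟨fun h k hk => ?_, fun h k hk => ?_⟩
  · by_contra hne
    exact hk (h (mem_vars_iff_degreeOf_ne_zero.2 hne))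
  · by_contra hne
    exact mem_vars_iff_degreeOf_ne_zero.1 hk (h k hne)

lemma polysIn_pow_le (u : Set ι) (n : ℕ) : polysIn u ^ n ≤ polysIn u := by
  induction n with
  | zero => exact Submodule.one_le.2 (Subalgebra.one_mem _)
  | succ n ih =>
    rw [pow_succ]
    exact (mul_le_mul' ih le_rfl).trans (Subalgebra.isIdempotentElem_toSubmodule _).le

lemma prod_mem_pow {κ : Type*} {A : Submodule ℂ (MvPolynomial ι ℂ)} (u : Finset κ)
    {g : κ → MvPolynomial ι ℂ} (h : ∀ k ∈ u, g k ∈ A) : ∏ k ∈ u, g k ∈ A ^ u.card := by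
  classical
  induction u using Finset.induction with
  | empty => simpa using Submodule.one_le.1 (le_refl (1 : Submodule ℂ (MvPolynomial ι ℂ)))
  | insert k u hk ih =>
    rw [Finset.prod_insert hk, Finset.card_insert_of_notMem hk, pow_succ']
    exact Submodule.mul_mem_mul (h k (Finset.mem_insert_self k u))
      (ih fun i hi => h i (Finset.mem_insert_of_mem hi))

variable [DecidableEq ι] {J : ι →₀ ℕ}

lemma extract_mem_of_mem_mul {A : Submodule ℂ (MvPolynomial ι ℂ)} (hA : A ≤ polysIn (↑t)ᶜ)
    (hJ : ∀ i ∉ t, J i = 0) {f : MvPolynomial ι ℂ} (hf : f ∈ A * polysIn ↑t) :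
    extract t J f ∈ A := by
  induction hf using Submodule.mul_induction_on' with
  | mem_mul_mem w hw q hq =>
    have hconst := eq_C_of_degreeOf_eq_zero (f := extract t J q) fun k => by
      by_cases hk : k ∈ t
      · exact degreeOf_extract_eq_zero hJ hk q
      · exact Nat.le_zero.1 ((degreeOf_extract_le hJ k q).trans
          (mem_polysIn.1 hq k (by simpa using hk)).le)
    rw [extract_mul_of_degreeOf_eq_zero fun i hi => mem_polysIn.1 (hA hw) i (by simpa using hi),
      hconst, mul_comm, ← smul_eq_C_mul]
    exact A.smul_mem _ hw
  | add x _ y _ hx hy => rw [map_add]; exact A.add_mem hx hy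

lemma dunklHom_mul_of_mem_polysIn (a : ℕ) {w : MvPolynomial ι ℂ} (hw : w ∈ polysIn (↑t)ᶜ)
    (p f : MvPolynomial ι ℂ) : dunklHom a t p (w * f) = w * dunklHom a t p f := by
  rw [Subalgebra.mem_toSubmodule, supported_eq_adjoin_X] at hw
  induction hw using Algebra.adjoin_induction generalizing f with
  | mem x hx =>
    obtain ⟨i, hi, rfl⟩ := hx
    exact dunklHom_X_mul_of_notMem (by simpa using hi) p f
  | algebraMap c => rw [← Algebra.smul_def, ← Algebra.smul_def, map_smul]
  | add x y _ _ hx hy => rw [add_mul, map_add, hx, hy, add_mul]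
  | mul x y _ _ hx hy => rw [mul_assoc, hx, hy, mul_assoc]

lemma dunklHom_mem_polysIn (a : ℕ) (p : MvPolynomial ι ℂ) {q : MvPolynomial ι ℂ}
    (hq : q ∈ polysIn ↑t) : dunklHom a t p q ∈ polysIn ↑t := by
  have hbox : q ∈ box t q.totalDegree := mem_box_of_bounds
    (fun k _ => degreeOf_le_totalDegree q k) fun k hk => mem_polysIn.1 hq k (by simpa using hk)
  exact mem_polysIn.2 fun k hk =>
    degreeOf_eq_zero_of_mem_box (dunklHom_mem_box hbox p) (by simpa using hk)

lemma dunklHom_mem_mul_polysIn (a : ℕ) {A : Submodule ℂ (MvPolynomial ι ℂ)}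
    (hA : A ≤ polysIn (↑t)ᶜ) (p : MvPolynomial ι ℂ) {f : MvPolynomial ι ℂ}
    (hf : f ∈ A * polysIn ↑t) : dunklHom a t p f ∈ A * polysIn ↑t := by
  induction hf using Submodule.mul_induction_on' with
  | mem_mul_mem w hw q hq =>
    rw [dunklHom_mul_of_mem_polysIn a (hA hw)]
    exact Submodule.mul_mem_mul hw (dunklHom_mem_polysIn a p hq)
  | add x _ y _ hx hy => rw [map_add]; exact Submodule.add_mem _ hx hy

/-- The span of the coefficients of `f` as a polynomial in the variables `t`. -/
noncomputable def coeffSpan (t : Finset ι) (f : MvPolynomial ι ℂ) :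
    Submodule ℂ (MvPolynomial ι ℂ) :=
  Submodule.span ℂ ((fun J => extract t J f) '' {J | ∀ i ∉ t, J i = 0})

lemma coeffSpan_le_polysIn (t : Finset ι) (f : MvPolynomial ι ℂ) :
    coeffSpan t f ≤ polysIn (↑t)ᶜ := by
  refine Submodule.span_le.2 ?_
  rintro _ ⟨J, hJ, rfl⟩
  exact mem_polysIn.2 fun k hk => degreeOf_extract_eq_zero hJ (by simpa using hk) f

lemma mem_coeffSpan_mul_polysIn (t : Finset ι) (f : MvPolynomial ι ℂ) :
    f ∈ coeffSpan t f * polysIn ↑t := by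
  suffices h : ∑ J ∈ f.support.image (Finsupp.filter (· ∈ t)), extract t J f * monomial J 1 ∈
      coeffSpan t f * polysIn ↑t by rwa [← eq_sum_extract f t] at h
  refine Submodule.sum_mem _ fun J hJ => ?_
  obtain ⟨m, -, rfl⟩ := Finset.mem_image.1 hJ
  have h0 : ∀ i ∉ t, (Finsupp.filter (fun x => x ∈ t) m : ι →₀ ℕ) i = 0 := fun i hi => Finsupp.filter_apply_neg _ _ hi
  refine Submodule.mul_mem_mul (Submodule.subset_span ⟨_, h0, rfl⟩) (mem_polysIn.2 fun k hk => ?_)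
  rw [← Nat.le_zero, degreeOf_le_iff]
  intro m' hm'
  rw [Finset.mem_singleton.1 (support_monomial_subset hm'), h0 k (by simpa using hk)]

lemma coeffSpan_le {A : Submodule ℂ (MvPolynomial ι ℂ)} (hA : A ≤ polysIn (↑t)ᶜ)
    {f : MvPolynomial ι ℂ} (hf : f ∈ A * polysIn ↑t) : coeffSpan t f ≤ A := by
  refine Submodule.span_le.2 ?_
  rintro _ ⟨J, hJ, rfl⟩
  exact extract_mem_of_mem_mul hA hJ hf

lemma extract_zero_eq_aeval (t : Finset ι) (f : MvPolynomial ι ℂ) :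
    extract t 0 f = aeval (fun i => if i ∈ t then 0 else (X i : MvPolynomial ι ℂ)) f := by
  refine linearMap_ext_monomial (f := extract t 0)
    (g := (aeval fun i => if i ∈ t then 0 else (X i : MvPolynomial ι ℂ)).toLinearMap)
    (fun m c => ?_) f
  rw [extract_monomial, AlgHom.toLinearMap_apply, aeval_monomial]
  split_ifs with h
  · have hm : ∀ i ∈ t, m i = 0 := fun i hi => by
      rw [← Finsupp.filter_apply_pos (fun x => x ∈ t) m hi, h, Finsupp.coe_zero, Pi.zero_apply]
    have hfilter : m.filter (fun x => x ∉ t) = m := by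
      ext i
      by_cases hi : i ∈ t <;> simp [hi, hm]
    rw [hfilter, monomial_eq, algebraMap_eq]
    congr 1
    refine Finsupp.prod_congr fun i hi => ?_
    rw [if_neg fun hit => Finsupp.mem_support_iff.1 hi (hm i hit)]
  · obtain ⟨i, hi⟩ := Finsupp.ne_iff.1 h
    have hit : i ∈ t := by
      by_contra hit
      exact hi (Finsupp.filter_apply_neg _ _ hit)
    rw [Finsupp.filter_apply_pos (fun x => x ∈ t) m hit] at hi
    rw [Finsupp.prod, Finset.prod_eq_zero (Finsupp.mem_support_iff.2 hi), mul_zero]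
    rw [if_pos hit, zero_pow hi]

end SeparatedVariables

section KernelCoefficients

variable {ι : Type*} [DecidableEq ι] {a : ℕ} {s t : Finset ι}

lemma prod_X_pow_mem_coeffSpan (hst : Disjoint s t) :
    ∏ i ∈ s, X i ^ (a * t.card) ∈ coeffSpan t (cauchyKernel a s t ∅) := by
  have h : extract t 0 (cauchyKernel a s t ∅) = ∏ i ∈ s, X i ^ (a * t.card) := by
    rw [extract_zero_eq_aeval, cauchyKernel, map_prod, Finset.prod_product]
    refine Finset.prod_congr rfl fun i hi => ?_
    have hit : i ∉ t := Finset.disjoint_left.1 hst hi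
    rw [pow_mul, ← Finset.prod_const]
    refine Finset.prod_congr rfl fun k hk => ?_
    simp [hit, hk]
  rw [← h]
  exact Submodule.subset_span ⟨0, fun _ _ => rfl, rfl⟩

lemma dunklHom_mem_coeffSpan (ha : 1 ≤ a) (hst : Disjoint s t) {Q f : MvPolynomial ι ℂ}
    (hQ : Q ∈ symAlg s) (hf : f ∈ coeffSpan t (cauchyKernel a s t ∅)) :
    dunklHom a s Q f ∈ coeffSpan t (cauchyKernel a s t ∅) := by
  induction hQ using Algebra.adjoin_induction generalizing f with
  | mem x hx =>
    obtain ⟨r, rfl⟩ := hx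
    refine (Submodule.span_le.2 ?_ : _ ≤ (coeffSpan t (cauchyKernel a s t ∅)).comap
      (dunklHom a s (elemCoeff s r))) hf
    rintro _ ⟨J, hJ, rfl⟩
    rw [SetLike.mem_coe, Submodule.mem_comap, ← extract_dunklHom hJ hst,
      dunklHom_elemCoeff_cauchyKernel_comm ha hst, map_smul]
    exact Submodule.smul_mem _ _ (extract_mem_of_mem_mul (coeffSpan_le_polysIn _ _) hJ
      (dunklHom_mem_mul_polysIn a (coeffSpan_le_polysIn _ _) _ (mem_coeffSpan_mul_polysIn _ _)))
  | algebraMap c => simpa using Submodule.smul_mem _ c hf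
  | add p q _ _ hp hq => rw [map_add]; exact Submodule.add_mem _ (hp hf) (hq hf)
  | mul p q _ _ hp hq => rw [dunklHom_mul_apply]; exact hp (hq hf)

/-- The coefficients of the kernel span all symmetric polynomials of bounded degree. -/
theorem symBox_le_coeffSpan (ha : 1 ≤ a) (hst : Disjoint s t) (hcard : s.card ≤ t.card)
    (ht : 1 ≤ t.card) :
    symBox s (a * t.card) ≤ coeffSpan t (cauchyKernel a s t ∅) := by
  intro f hf
  obtain ⟨Q, hQ, rfl⟩ := exists_dunklHom_prod_X_pow (Nat.mul_le_mul_left a hcard)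
    (Nat.mul_pos ha ht) hf
  exact dunklHom_mem_coeffSpan ha hst hQ (prod_X_pow_mem_coeffSpan hst)

end KernelCoefficients

lemma degree_eq_of_mem_support {σ R : Type*} [CommSemiring R] {f : MvPolynomial σ R} {n : ℕ}
    (hf : f.IsHomogeneous n) {m : σ →₀ ℕ} (hm : m ∈ f.support) : m.degree = n := by
  rw [Finsupp.degree_eq_weight_one]
  exact hf (mem_support_iff.1 hm)

section Comparison

variable {ι : Type*} [DecidableEq ι]

lemma prod_sub_X_eq_sum (s : Finset ι) (Y : MvPolynomial ι ℂ) :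
    ∏ i ∈ s, (Y - X i) = ∑ r ∈ Finset.range (s.card + 1), elemCoeff s r * Y ^ (s.card - r) := by
  calc ∏ i ∈ s, (Y - X i) = ∏ i ∈ s, (-X i + Y) :=
        Finset.prod_congr rfl fun i _ => by ring
    _ = ∑ r ∈ Finset.range (s.card + 1), ∑ A ∈ s.powersetCard r,
          (∏ i ∈ A, (-X i)) * ∏ i ∈ s \ A, Y := by
        rw [Finset.prod_add, Finset.sum_powerset]
    _ = _ := by
        refine Finset.sum_congr rfl fun r _ => ?_
        rw [elemCoeff_eq_sum, Finset.sum_mul]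
        refine Finset.sum_congr rfl fun A hA => ?_
        obtain ⟨hAs, hAr⟩ := Finset.mem_powersetCard.1 hA
        rw [Finset.prod_const, Finset.card_sdiff_of_subset hAs, hAr]

lemma elemCoeff_mem_supported (s : Finset ι) (r : ℕ) : elemCoeff s r ∈ supported ℂ (s : Set ι) := by
  rw [elemCoeff_eq_sum]
  refine Subalgebra.sum_mem _ fun A hA => Subalgebra.prod_mem _ fun i hi => ?_
  exact Subalgebra.neg_mem _ (X_mem_supported.2 ((Finset.mem_powersetCard.1 hA).1 hi))

/-- The substitution of the signed elementary symmetric polynomials for the coefficients of the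
generic form. -/
noncomputable def elemHom (b : ℕ) (s : Finset ι) :
    MvPolynomial (Fin (b + 1)) ℂ →ₐ[ℂ] MvPolynomial ι ℂ :=
  aeval fun i => elemCoeff s i

lemma elemHom_mem_supported {b : ℕ} (s : Finset ι) (f : MvPolynomial (Fin (b + 1)) ℂ) :
    elemHom b s f ∈ supported ℂ (s : Set ι) := by
  induction f using MvPolynomial.induction_on with
  | C c => rw [elemHom, algHom_C]; exact Subalgebra.algebraMap_mem _ c
  | add p q hp hq => rw [map_add]; exact Subalgebra.add_mem _ hp hq
  | mul_X p i hp =>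
    rw [map_mul, elemHom, aeval_X]
    exact Subalgebra.mul_mem _ hp (elemCoeff_mem_supported s i)

lemma isHomogeneous_genForm (b : ℕ) : (genForm b).IsHomogeneous b := by
  refine IsHomogeneous.sum _ _ _ fun i _ => ?_
  have h := ((isHomogeneous_C (Fin 2) (X i : MvPolynomial (Fin (b + 1)) ℂ)).mul
    (isHomogeneous_X_pow (0 : Fin 2) (i : ℕ))).mul (isHomogeneous_X_pow (1 : Fin 2) (b - (i : ℕ)))
  rwa [show 0 + (i : ℕ) + (b - (i : ℕ)) = b by omega] at h

lemma coeff_genForm_pow {a b : ℕ} {m : Fin 2 →₀ ℕ} (hm : m ∈ (genForm b ^ a).support) :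
    m 0 ≤ a * b ∧ coeff m (genForm b ^ a) = coeffC a b (m 0) := by
  have hdeg := degree_eq_of_mem_support ((isHomogeneous_genForm b).pow a) hm
  rw [Finsupp.degree_eq_sum, Fin.sum_univ_two, mul_comm] at hdeg
  refine ⟨by omega, ?_⟩
  rw [coeffC]
  congr 1
  ext i
  fin_cases i
  · simp
  · simp
    omega

/-- The span of the coefficients of the `a`-th power of the generic form. -/
noncomputable def formSpan (a b : ℕ) : Submodule ℂ (MvPolynomial (Fin (b + 1)) ℂ) :=
  Submodule.span ℂ (Set.range fun j : Fin (a * b + 1) => coeffC a b (j : ℕ))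

lemma eval_genForm {s : Finset ι} {b : ℕ} (hs : s.card = b) (k : ι) :
    eval₂Hom (elemHom b s : MvPolynomial (Fin (b + 1)) ℂ →+* MvPolynomial ι ℂ) ![1, X k]
      (genForm b) = ∏ i ∈ s, (X k - X i) := by
  subst hs
  rw [prod_sub_X_eq_sum, Finset.sum_range, genForm, map_sum]
  refine Finset.sum_congr rfl fun i _ => ?_
  simp [elemHom]

lemma prod_sub_pow_mem (a : ℕ) {b : ℕ} {s t : Finset ι} (hs : s.card = b) {k : ι} (hk : k ∈ t) :
    ∏ i ∈ s, (X i - X k) ^ a ∈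
      (formSpan a b).map (elemHom b s).toLinearMap * polysIn (t : Set ι) := by
  have hneg : ∏ i ∈ s, (X i - X k : MvPolynomial ι ℂ) ^ a =
      ((-1 : ℂ) ^ (a * s.card)) • (∏ i ∈ s, (X k - X i)) ^ a := by
    rw [← Finset.prod_pow, smul_eq_C_mul, C_pow, C_neg, C_1, pow_mul, ← Finset.prod_const,
      ← Finset.prod_mul_distrib]
    refine Finset.prod_congr rfl fun i _ => ?_
    rw [← mul_pow]
    ring
  rw [hneg, ← eval_genForm hs, ← map_pow, coe_eval₂Hom, eval₂_eq']
  refine Submodule.smul_mem _ _ (Submodule.sum_mem _ fun m hm => ?_)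
  obtain ⟨hle, hcoeff⟩ := coeff_genForm_pow hm
  rw [hcoeff, Fin.prod_univ_two]
  refine Submodule.mul_mem_mul (Submodule.mem_map_of_mem
    (Submodule.subset_span ⟨⟨m 0, by omega⟩, rfl⟩)) ?_
  simpa using Subalgebra.pow_mem _ (X_mem_supported.2 (Finset.mem_coe.2 hk)) (m 1)

lemma cauchyKernel_mem {a b : ℕ} {s t : Finset ι} (hs : s.card = b) (ht : t.card = b) :
    cauchyKernel a s t ∅ ∈
      ((formSpan a b) ^ b).map (elemHom b s).toLinearMap * polysIn (t : Set ι) := by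
  have h := prod_mem_pow t fun k hk => prod_sub_pow_mem a hs hk
  rw [ht, mul_pow, ← Submodule.map_pow] at h
  have h' := mul_le_mul' le_rfl (polysIn_pow_le (t : Set ι) b) h
  convert h' using 1
  rw [cauchyKernel, Finset.prod_product_right]
  simp

lemma symBox_le_map_formSpan {a b : ℕ} (ha : 1 ≤ a) (hb : 1 ≤ b) {s t : Finset ι}
    (hs : s.card = b) (ht : t.card = b) (hst : Disjoint s t) :
    symBox s (a * b) ≤ ((formSpan a b) ^ b).map (elemHom b s).toLinearMap := by
  have h := symBox_le_coeffSpan ha hst (hs.trans ht.symm).le (hb.trans ht.symm.le)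
  rw [ht] at h
  refine h.trans (coeffSpan_le ?_ (cauchyKernel_mem hs ht))
  rintro _ ⟨f, -, rfl⟩
  refine supported_mono ?_ (elemHom_mem_supported s f)
  exact fun i hi => Finset.disjoint_left.1 hst hi

lemma isHomogeneous_coeff_genForm_pow (b n : ℕ) (m : Fin 2 →₀ ℕ) :
    (coeff m (genForm b ^ n)).IsHomogeneous n := by
  induction n generalizing m with
  | zero =>
    classical
    rw [pow_zero, coeff_one]
    split_ifs
    · exact isHomogeneous_one _ _
    · exact isHomogeneous_zero _ _ _
  | succ n ih =>
    rw [pow_succ, coeff_mul]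
    refine IsHomogeneous.sum _ _ _ fun p _ => (ih p.1).mul ?_
    rw [genForm, coeff_sum]
    refine IsHomogeneous.sum _ _ _ fun i _ => ?_
    rw [mul_assoc, coeff_C_mul, X_pow_eq_monomial, X_pow_eq_monomial, monomial_mul, one_mul,
      coeff_monomial]
    split_ifs
    · rw [mul_one]
      exact isHomogeneous_X _ _
    · rw [mul_zero]
      exact isHomogeneous_zero _ _ _

lemma formSpan_pow_le (a b n : ℕ) :
    formSpan a b ^ n ≤ homogeneousSubmodule (Fin (b + 1)) ℂ (a * n) := by
  have h1 : formSpan a b ≤ homogeneousSubmodule (Fin (b + 1)) ℂ a := by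
    refine Submodule.span_le.2 ?_
    rintro _ ⟨j, rfl⟩
    exact isHomogeneous_coeff_genForm_pow b a _
  induction n with
  | zero => exact Submodule.one_le.2 (isHomogeneous_one _ _)
  | succ n ih => exact (mul_le_mul' ih h1).trans (homogeneousSubmodule_mul _ _)

lemma finrank_homogeneousSubmodule_le (b n : ℕ) :
    Module.finrank ℂ (homogeneousSubmodule (Fin (b + 1)) ℂ n) ≤ (n + b).choose b := by
  classical
  set S : Finset (MvPolynomial (Fin (b + 1)) ℂ) :=
    (Finset.univ.finsuppAntidiag n).image fun m => monomial m 1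
  have hle : homogeneousSubmodule (Fin (b + 1)) ℂ n ≤ Submodule.span ℂ (S : Set _) := by
    intro f hf
    rw [f.as_sum]
    refine Submodule.sum_mem _ fun m hm => ?_
    rw [← mul_one (coeff m f), ← smul_eq_mul, ← smul_monomial]
    refine Submodule.smul_mem _ _ (Submodule.subset_span (Finset.mem_coe.2
      (Finset.mem_image_of_mem _ ?_)))
    have hdeg := degree_eq_of_mem_support hf hm
    rw [Finsupp.degree_eq_sum] at hdeg
    simpa [Finset.mem_finsuppAntidiag] using hdeg
  have hcard : S.card ≤ (n + b).choose b := by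
    refine Finset.card_image_le.trans ?_
    rw [Finset.card_finsuppAntidiag_nat_eq_choose, Finset.card_univ, Fintype.card_fin,
      show b + 1 + n - 1 = n + b by omega, Nat.choose_symm_add]
  exact (Submodule.finrank_mono hle).trans ((finrank_span_finset_le_card S).trans hcard)

/-- The `b`-fold products of the coefficients of `G ^ a` span all forms of degree `a * b`. -/
theorem formSpan_pow_eq {a b : ℕ} (ha : 1 ≤ a) (hb : 1 ≤ b) :
    formSpan a b ^ b = homogeneousSubmodule (Fin (b + 1)) ℂ (a * b) := by
  have hfin : FiniteDimensional ℂ (homogeneousSubmodule (Fin (b + 1)) ℂ (a * b)) :=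
    Module.Finite.iff_fg.2 (homogeneousSubmodule_fg _ _ _)
  have hle := formSpan_pow_le a b b
  have hfin' : FiniteDimensional ℂ (formSpan a b ^ b : Submodule ℂ _) :=
    Submodule.finiteDimensional_of_le hle
  refine Submodule.eq_of_le_of_finrank_le hle ((finrank_homogeneousSubmodule_le b (a * b)).trans ?_)
  have hs : (Finset.range b).card = b := Finset.card_range b
  have ht : (Finset.Ico b (2 * b)).card = b := by rw [Nat.card_Ico]; omega
  have hst : Disjoint (Finset.range b) (Finset.Ico b (2 * b)) :=
    Finset.disjoint_left.2 fun i hi hi' => by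
      rw [Finset.mem_range] at hi
      rw [Finset.mem_Ico] at hi'
      omega
  calc (a * b + b).choose b = Module.finrank ℂ (symBox (Finset.range b) (a * b)) := by
        rw [finrank_symBox, hs]
    _ ≤ _ := Submodule.finrank_mono (symBox_le_map_formSpan ha hb hs ht hst)
    _ ≤ _ := Submodule.finrank_map_le _ _

end Comparison

lemma formSpan_pow_le_Iab_pow (a b n : ℕ) {f : MvPolynomial (Fin (b + 1)) ℂ}
    (hf : f ∈ formSpan a b ^ n) : f ∈ Iab a b ^ n := by
  have h1 : formSpan a b ≤ (Iab a b).restrictScalars ℂ := by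
    refine Submodule.span_le.2 ?_
    exact Ideal.subset_span
  induction n generalizing f with
  | zero => simp
  | succ n ih =>
    induction hf using Submodule.mul_induction_on' with
    | mem_mul_mem p hp q hq => exact Ideal.mul_mem_mul (ih hp) (h1 hq)
    | add p _ q _ hp hq => exact Ideal.add_mem _ hp hq

lemma Iab_le_idealOfVars_pow (a b : ℕ) : Iab a b ≤ idealOfVars (Fin (b + 1)) ℂ ^ a := by
  refine Ideal.span_le.2 ?_
  rintro _ ⟨j, rfl⟩
  refine (mem_pow_idealOfVars_iff' ..).2 fun m hm => ?_
  by_contra hne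
  exact hm.ne (degree_eq_of_mem_support (isHomogeneous_coeff_genForm_pow b a _)
    (mem_support_iff.2 hne))

end Dunkl

/-- The `b`-th power of `I_{a,b}` equals the `(ab)`-th power of the maximal
homogeneous ideal `𝔪 = (u_0, …, u_b)`. -/
theorem Iab_pow_b_eq_max_ideal_pow (a b : ℕ) (ha : 1 ≤ a) (hb : 1 ≤ b) :
    Iab a b ^ b =
      (Ideal.span (Set.range (MvPolynomial.X : Fin (b + 1) → MvPolynomial (Fin (b + 1)) ℂ)))
        ^ (a * b) := by
  refine le_antisymm ?_ ?_
  · rw [pow_mul]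
    exact Ideal.pow_right_mono (Dunkl.Iab_le_idealOfVars_pow a b) b
  · refine (pow_idealOfVars_eq_span (σ := Fin (b + 1)) (R := ℂ) (a * b)).trans_le
      (Ideal.span_le.2 ?_)
    rintro _ ⟨m, hm, rfl⟩
    refine Dunkl.formSpan_pow_le_Iab_pow a b b ?_
    rw [Dunkl.formSpan_pow_eq ha hb]
    exact isHomogeneous_monomial 1 hm
end

section
/- The radical of the ideal I_{a,b} is the maximal homogeneous ideal: √I_{a,b} = 𝔪 = (u_0,…,u_b). (Hence I_{a,b} is an 𝔪-primary ideal, as asserted in the paper.) -/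
open MvPolynomial

theorem MvPolynomial.span_range_X_eq_ker_constantCoeff (σ R : Type*) [CommRing R] :
    Ideal.span (Set.range (X : σ → MvPolynomial σ R)) = RingHom.ker constantCoeff := by
  ext p
  rw [← Set.image_univ, mem_ideal_span_X_image, RingHom.mem_ker, constantCoeff_eq]
  constructor
  · intro h
    by_contra h0
    obtain ⟨i, -, hi⟩ := h 0 (mem_support_iff.mpr h0)
    exact hi rfl
  · intro h m hm
    have hm0 : m ≠ 0 := by
      rintro rfl
      exact mem_support_iff.mp hm h
    obtain ⟨i, hi⟩ := Finsupp.ne_iff.mp hm0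
    exact ⟨i, Set.mem_univ i, hi⟩

theorem genForm_isHomogeneous (b : ℕ) : (genForm b).IsHomogeneous b := by
  refine IsHomogeneous.sum _ _ _ fun i _ => ?_
  have h := (isHomogeneous_C_mul_X_pow (X i : MvPolynomial (Fin (b + 1)) ℂ)
    (0 : Fin 2) (i : ℕ)).mul (isHomogeneous_X_pow (1 : Fin 2) (b - (i : ℕ)))
  rwa [Nat.add_sub_cancel' (Nat.lt_succ_iff.mp i.isLt)] at h

theorem coeff_genForm (b : ℕ) (i : Fin (b + 1)) :
    coeff (Finsupp.single (0 : Fin 2) (i : ℕ) + Finsupp.single (1 : Fin 2) (b - (i : ℕ)))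
      (genForm b) = X i := by
  have hmon : ∀ j : Fin (b + 1),
      (C (X j) * X (0 : Fin 2) ^ (j : ℕ) * X (1 : Fin 2) ^ (b - (j : ℕ)) :
        MvPolynomial (Fin 2) (MvPolynomial (Fin (b + 1)) ℂ)) =
      monomial (Finsupp.single 0 (j : ℕ) + Finsupp.single 1 (b - (j : ℕ))) (X j) := by
    intro j
    rw [X_pow_eq_monomial, X_pow_eq_monomial, C_mul_monomial, monomial_mul, mul_one, mul_one]
  rw [genForm, coeff_sum, Finset.sum_eq_single i]
  · rw [hmon, coeff_monomial, if_pos rfl]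
  · intro j _ hji
    rw [hmon, coeff_monomial, if_neg]
    intro h
    have h0 := DFunLike.congr_fun h 0
    simp only [Finsupp.add_apply, Finsupp.single_apply] at h0
    exact hji (Fin.ext (by simpa using h0))
  · simp

theorem map_genForm_constantCoeff (b : ℕ) : map constantCoeff (genForm b) = 0 := by
  simp [genForm]

theorem coeff_genForm_pow_mem_Iab (a b : ℕ) (m : Fin 2 →₀ ℕ) :
    coeff m (genForm b ^ a) ∈ Iab a b := by
  by_cases hm : m.degree = b * a
  · rw [Finsupp.degree_eq_sum, Fin.sum_univ_two, mul_comm] at hm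
    refine Ideal.subset_span ⟨⟨m 0, by omega⟩, ?_⟩
    have hmeq : Finsupp.single 0 (m 0) + Finsupp.single 1 (a * b - m 0) = m := by
      ext k
      fin_cases k
      · simp
      · simp
        omega
    simp only [coeffC, hmeq]
  · rw [((genForm_isHomogeneous b).pow a).coeff_eq_zero hm]
    exact zero_mem _

/-- The radical of `I_{a,b}` is the maximal homogeneous ideal `𝔪 = (u_0, …, u_b)`,
so `I_{a,b}` is `𝔪`-primary. -/
theorem radical_Iab_eq_max_ideal (a b : ℕ) (ha : 1 ≤ a) (hb : 1 ≤ b) :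
    (Iab a b).radical =
      Ideal.span (Set.range (MvPolynomial.X : Fin (b + 1) → MvPolynomial (Fin (b + 1)) ℂ)) := by
  rw [span_range_X_eq_ker_constantCoeff]
  apply le_antisymm
  · refine (RingHom.ker_isPrime _).isRadical.radical_le_iff.mpr (Ideal.span_le.mpr ?_)
    rintro _ ⟨j, rfl⟩
    dsimp only
    rw [SetLike.mem_coe, RingHom.mem_ker, coeffC, ← coeff_map, map_pow,
      map_genForm_constantCoeff, zero_pow (by omega), coeff_zero]
  · rw [← span_range_X_eq_ker_constantCoeff, Ideal.span_le]
    rintro _ ⟨i, rfl⟩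
    let π := Ideal.Quotient.mk (Iab a b).radical
    have hred : IsReduced (MvPolynomial (Fin (b + 1)) ℂ ⧸ (Iab a b).radical) :=
      (Ideal.isRadical_iff_quotient_reduced _).mp (Ideal.radical_isRadical _)
    have hpow : map π (genForm b) ^ a = 0 := by
      ext m
      rw [← map_pow, coeff_map, coeff_zero]
      exact Ideal.Quotient.eq_zero_iff_mem.mpr
        (Ideal.le_radical (coeff_genForm_pow_mem_Iab a b m))
    rw [SetLike.mem_coe, ← Ideal.Quotient.eq_zero_iff_mem, ← coeff_genForm b i]
    change π _ = 0
    rw [← coeff_map, eq_zero_of_pow_eq_zero hpow, coeff_zero]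
end
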